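/- arXiv:math/0611387 — 2 statements merged into one kernel-verified Lean document; each statement's English description precedes it below -/
import Mathlib

section
/- Let d ≥ 3 and k ≥ 0 be integers. In the polynomial ring (ℤ/2)[x₁,x₂,x₃], consider the polynomial Q = x₂^k · x₃^k · ((x₁+x₂)·(x₁+x₃)·(x₂+x₃)·(x₁+x₂+x₃))^{k+1} (this equals (1/(x₂x₃))·(𝔓₃/x₁)^{k+1}, where 𝔓₃ = x₁x₂x₃(x₁+x₂)(x₁+x₃)(x₂+x₃)(x₁+x₂+x₃) is the Dickson polynomial in three variables). If Q does not belong to the ideal of (ℤ/2)[x₁,x₂,x₃] generated by x₁^d, x₂^d, x₃^d, then every mass distribution μ on ℝ^d admits an equipartition into (2k+2)×2×2 boxes by a collection of 2k+1 parallel hyperplanes (orthogonal to some unit vector u, at levels t_1 < ... < t_{2k+1}) and two additional hyperplanes orthogonal to unit vectors v and w respectively, with u, v, w pairwise non-parallel: each of the 4(2k+2) regions {x : t_i < ⟨x,u⟩ < t_{i+1}} ∩ {x : ⟨x,v⟩ ≶ s₁} ∩ {x : ⟨x,w⟩ ≶ s₂} (with t_0 = -∞, t_{2k+2} = +∞ and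 all four sign choices) has μ-measure μ(ℝ^d)/(4(2k+2)). -/
open MeasureTheory

/-- The open slab between consecutive parallel hyperplanes orthogonal to `u`:
for `0 ≤ i ≤ n`, the region `{x : t i < ⟪x,u⟫ < t (i+1)}`, with the conventions
`t 0 = -∞` and `t (n+1) = +∞` (i.e. the corresponding inequality is dropped). -/
noncomputable def slab {d : ℕ} (u : EuclideanSpace ℝ (Fin d)) (t : ℕ → ℝ) (n i : ℕ) :
    Set (EuclideanSpace ℝ (Fin d)) :=
  {x | (1 ≤ i → t i < (inner ℝ x u : ℝ)) ∧ (i + 1 ≤ n → (inner ℝ x u : ℝ) < t (i + 1))}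

/-- The open halfspace below (`b = true`) or above (`b = false`) the hyperplane
orthogonal to `v` at level `s`. -/
def halfSp {d : ℕ} (v : EuclideanSpace ℝ (Fin d)) (s : ℝ) (b : Bool) :
    Set (EuclideanSpace ℝ (Fin d)) :=
  if b then {x | (inner ℝ x v : ℝ) < s} else {x | s < (inner ℝ x v : ℝ)}



namespace BUx

abbrev Ch (V : Type*) := List V →₀ ZMod 2

section chains
variable {V : Type*}

noncomputable def cone (p : V) : Ch V →ₗ[ZMod 2] Ch V :=
  Finsupp.lmapDomain (ZMod 2) (ZMod 2) (List.cons p)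

noncomputable def bdL : List V → Ch V
  | [] => 0
  | v :: l => Finsupp.single l 1 + cone v (bdL l)

noncomputable def bd : Ch V →ₗ[ZMod 2] Ch V := Finsupp.linearCombination (ZMod 2) bdL

noncomputable def act (g : V → V) : Ch V →ₗ[ZMod 2] Ch V :=
  Finsupp.lmapDomain (ZMod 2) (ZMod 2) (List.map g)

noncomputable def ev (F : List V → ZMod 2) : Ch V →ₗ[ZMod 2] ZMod 2 :=
  Finsupp.linearCombination (ZMod 2) F

@[simp] lemma cone_single (p : V) (l : List V) (a : ZMod 2) :
    cone p (Finsupp.single l a) = Finsupp.single (p :: l) a := by simp [cone]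

@[simp] lemma bd_single (l : List V) : bd (Finsupp.single l 1) = bdL l := by simp [bd]

@[simp] lemma act_single (g : V → V) (l : List V) (a : ZMod 2) :
    act g (Finsupp.single l a) = Finsupp.single (l.map g) a := by simp [act]

@[simp] lemma ev_single (F : List V → ZMod 2) (l : List V) : ev F (Finsupp.single l 1) = F l := by
  simp [ev]

lemma lin_ext {M : Type*} [AddCommMonoid M] [Module (ZMod 2) M] {f g : Ch V →ₗ[ZMod 2] M}
    (h : ∀ l, f (Finsupp.single l 1) = g (Finsupp.single l 1)) (c : Ch V) : f c = g c := by
  have : f = g := by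
    apply Finsupp.lhom_ext'
    intro l
    apply LinearMap.ext_ring
    simpa using h l
  rw [this]

lemma ch_add_self (c : Ch V) : c + c = 0 := by
  ext l
  simp [CharTwo.add_self_eq_zero]

lemma bd_cone (p : V) (c : Ch V) : bd (cone p c) = c + cone p (bd c) := by
  refine lin_ext (f := bd ∘ₗ cone p) (g := LinearMap.id + cone p ∘ₗ bd) ?_ c
  intro l
  simp [bdL]

lemma bd_bd (c : Ch V) : bd (bd c) = 0 := by
  refine lin_ext (f := bd ∘ₗ bd) (g := 0) ?_ c
  intro l
  simp only [LinearMap.comp_apply, bd_single, LinearMap.zero_apply]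
  induction l with
  | nil => simp [bdL]
  | cons v l ih => simp [bdL, bd_cone, ih, ch_add_self]

lemma act_cone (g : V → V) (p : V) (c : Ch V) : act g (cone p c) = cone (g p) (act g c) := by
  refine lin_ext (f := act g ∘ₗ cone p) (g := cone (g p) ∘ₗ act g) ?_ c
  intro l
  simp

lemma bd_act (g : V → V) (c : Ch V) : bd (act g c) = act g (bd c) := by
  refine lin_ext (f := bd ∘ₗ act g) (g := act g ∘ₗ bd) ?_ c
  intro l
  simp only [LinearMap.comp_apply, bd_single, act_single]
  induction l with
  | nil => simp [bdL]
  | cons v l ih => simp [bdL, act_cone, ih]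

/-- The barycentric subdivision (for an abstract barycentre function). -/
noncomputable def Sd (bary : List V → V) : ℕ → (Ch V →ₗ[ZMod 2] Ch V)
  | 0 => LinearMap.id
  | n + 1 => Finsupp.linearCombination (ZMod 2) (fun l => cone (bary l) (Sd bary n (bdL l)))

lemma Sd_succ_single (bary : List V → V) (n : ℕ) (l : List V) :
    Sd bary (n + 1) (Finsupp.single l 1) = cone (bary l) (Sd bary n (bdL l)) := by
  simp [Sd]

lemma bd_Sd (bary : List V → V) (n : ℕ) (c : Ch V) :
    bd (Sd bary (n + 1) c) = Sd bary n (bd c) := by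
  induction n generalizing c with
  | zero =>
    refine lin_ext (f := bd ∘ₗ Sd bary 1) (g := Sd bary 0 ∘ₗ bd) ?_ c
    intro l
    simp only [LinearMap.comp_apply, Sd_succ_single, bd_single, bd_cone]
    simp only [Sd, LinearMap.id_apply]
    rw [← bd_single, bd_bd]
    simp
  | succ n ih =>
    refine lin_ext (f := bd ∘ₗ Sd bary (n + 2)) (g := Sd bary (n + 1) ∘ₗ bd) ?_ c
    intro l
    simp only [LinearMap.comp_apply, Sd_succ_single, bd_single, bd_cone, ih]
    rw [← bd_single, bd_bd]
    simp

lemma Sd_act (bary : List V → V) (g : V → V) (hg : ∀ l, bary (l.map g) = g (bary l)) (n : ℕ)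
    (c : Ch V) : Sd bary n (act g c) = act g (Sd bary n c) := by
  induction n generalizing c with
  | zero => simp [Sd]
  | succ n ih =>
    refine lin_ext (f := Sd bary (n + 1) ∘ₗ act g) (g := act g ∘ₗ Sd bary (n + 1)) ?_ c
    intro l
    simp only [LinearMap.comp_apply, Sd_succ_single, act_single, act_cone, hg, ← ih]
    rw [← bd_single, ← act_single, bd_act, bd_single]

/-- index set -/
abbrev B := Fin 3 →₀ ℕ

noncomputable def D {M : Type*} [Zero M] (i : Fin 3) (g : B → M) (b : B) : M :=
  if 0 < b i then g (b - Finsupp.single i 1) else 0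

lemma D_comm {M : Type*} [Zero M] (i j : Fin 3) (g : B → M) (b : B) :
    D i (fun b => D j g b) b = D j (fun b => D i g b) b := by
  by_cases hij : i = j
  · rw [hij]
  · have hji : ¬ j = i := fun h => hij h.symm
    simp only [D, Finsupp.tsub_apply, Finsupp.single_apply, hij, hji, if_false, tsub_zero]
    rw [tsub_tsub, tsub_tsub, add_comm (Finsupp.single i 1)]
    split_ifs <;> rfl

noncomputable def A (T : Fin 3 → V → V) (i : Fin 3) (g : B → Ch V) (b : B) : Ch V :=
  D i g b + act (T i) (D i g b)

lemma map_D {M N : Type*} [AddCommMonoid M] [AddCommMonoid N] [Module (ZMod 2) M]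
    [Module (ZMod 2) N] (φ : M →ₗ[ZMod 2] N) (i : Fin 3) (g : B → M) (b : B) :
    φ (D i g b) = D i (fun b => φ (g b)) b := by
  unfold D; split_ifs <;> simp

lemma D_add {M : Type*} [AddCommMonoid M] (i : Fin 3) (g h : B → M) (b : B) :
    D i (fun b => g b + h b) b = D i g b + D i h b := by
  unfold D; split_ifs <;> simp

lemma A_A (T : Fin 3 → V → V) (hT : ∀ i j v, T i (T j v) = T j (T i v)) (i j : Fin 3)
    (g : B → Ch V) (b : B) : A T i (A T j g) b = A T j (A T i g) b := by
  have hact : ∀ c : Ch V, act (T i) (act (T j) c) = act (T j) (act (T i) c) := by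
    intro c
    refine lin_ext (f := act (T i) ∘ₗ act (T j)) (g := act (T j) ∘ₗ act (T i)) ?_ c
    intro l
    simp [Function.comp_def, hT i j]
  have e : ∀ i j, A T i (A T j g) b = D i (fun b => D j g b) b + act (T j) (D i (fun b => D j g b) b)
      + act (T i) (D i (fun b => D j g b) b)
      + act (T i) (act (T j) (D i (fun b => D j g b) b)) := by
    intro i j
    have : D i (A T j g) b = D i (fun b => D j g b) b + act (T j) (D i (fun b => D j g b) b) := by
      rw [map_D (act (T j)), ← D_add]; rfl
    rw [A, this, map_add]; abel
  rw [e i j, e j i, D_comm j i, hact]; abel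

lemma A_self (T : Fin 3 → V → V) (hT2 : ∀ i v, T i (T i v) = v) (i : Fin 3)
    (g : B → Ch V) (b : B) : A T i (A T i g) b = 0 := by
  have hact : ∀ c : Ch V, act (T i) (act (T i) c) = c := by
    intro c
    refine lin_ext (f := act (T i) ∘ₗ act (T i)) (g := LinearMap.id) ?_ c
    intro l
    simp [Function.comp_def, hT2 i]
  have : D i (A T i g) b = D i (fun b => D i g b) b + act (T i) (D i (fun b => D i g b) b) := by
    rw [map_D (act (T i)), ← D_add]; rfl
  rw [A, this, map_add, hact, add_comm (act (T i) _), ch_add_self]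

lemma A_add (T : Fin 3 → V → V) (i : Fin 3) (g h : B → Ch V) (b : B) :
    A T i (fun b => g b + h b) b = A T i g b + A T i h b := by
  simp only [A, D_add, map_add]; abel

lemma map_A (T : Fin 3 → V → V) (φ : Ch V →ₗ[ZMod 2] Ch V)
    (hφ : ∀ i c, φ (act (T i) c) = act (T i) (φ c)) (i : Fin 3) (g : B → Ch V) (b : B) :
    φ (A T i g b) = A T i (fun b => φ (g b)) b := by
  simp only [A, map_add, hφ, map_D]

noncomputable def R (T : Fin 3 → V → V) (g : B → Ch V) (b : B) : Ch V := ∑ i, A T i g b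

lemma R_R (T : Fin 3 → V → V) (hT : ∀ i j v, T i (T j v) = T j (T i v))
    (hT2 : ∀ i v, T i (T i v) = v) (g : B → Ch V) (b : B) : R T (R T g) b = 0 := by
  have h : R T g = fun b => (A T 0 g b + A T 1 g b) + A T 2 g b := by
    funext b; simp [R, Fin.sum_univ_three]
  rw [h]
  simp only [R, Fin.sum_univ_three, A_add (V := V)]
  have h' : ∀ i j, A T i (fun b => A T j g b) b = A T j (fun b => A T i g b) b :=
    fun i j => A_A T hT i j g b
  have h2 : ∀ i, A T i (fun b => A T i g b) b = 0 := fun i => A_self T hT2 i g b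
  rw [h2, h2, h2, h' 1 0, h' 2 0, h' 2 1]
  have := ch_add_self (A T 0 (fun b => A T 1 g b) b)
  have h3 := ch_add_self (A T 0 (fun b => A T 2 g b) b)
  have h4 := ch_add_self (A T 1 (fun b => A T 2 g b) b)
  calc _ = (A T 0 (fun b => A T 1 g b) b + A T 0 (fun b => A T 1 g b) b) +
    (A T 0 (fun b => A T 2 g b) b + A T 0 (fun b => A T 2 g b) b) +
    (A T 1 (fun b => A T 2 g b) b + A T 1 (fun b => A T 2 g b) b) := by abel
    _ = 0 := by rw [this, h3, h4]; simp

noncomputable def E (p : B → V) (T : Fin 3 → V → V) : ℕ → B → Ch V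
  | 0 => fun b => if b = 0 then Finsupp.single [p 0] 1 else 0
  | n + 1 => fun b => cone (p b) (R T (E p T n) b)

lemma map_R (T : Fin 3 → V → V) (φ : Ch V →ₗ[ZMod 2] Ch V)
    (hφ : ∀ i c, φ (act (T i) c) = act (T i) (φ c)) (g : B → Ch V) (b : B) :
    φ (R T g b) = R T (fun b => φ (g b)) b := by
  simp only [R, map_sum, map_A T φ hφ]

lemma bd_E (p : B → V) (T : Fin 3 → V → V) (hT : ∀ i j v, T i (T j v) = T j (T i v))
    (hT2 : ∀ i v, T i (T i v) = v) (n : ℕ) (b : B) :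
    bd (E p T (n + 1) b) = R T (E p T n) b := by
  induction n generalizing b with
  | zero =>
    change bd (cone (p b) (R T (E p T 0) b)) = R T (E p T 0) b
    rw [bd_cone, map_R T bd (fun i c => bd_act _ _)]
    have : (fun b => bd (E p T 0 b)) = fun b => if b = 0 then Finsupp.single [] 1 else 0 := by
      funext b
      simp only [E]
      split_ifs <;> simp [bdL]
    rw [this]
    have h0 : R T (fun b => if b = 0 then Finsupp.single ([] : List V) 1 else 0) b = 0 := by
      unfold R
      apply Finset.sum_eq_zero
      intro i _
      unfold A
      have : act (T i) (D i (fun b => if b = 0 then Finsupp.single ([] : List V) 1 else 0) b)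
          = D i (fun b => if b = 0 then Finsupp.single ([] : List V) 1 else 0) b := by
        rw [map_D]
        congr 1
        funext b
        split_ifs <;> simp
      rw [this, ch_add_self]
    rw [h0]; simp
  | succ n ih =>
    change bd (cone (p b) (R T (E p T (n + 1)) b)) = R T (E p T (n + 1)) b
    rw [bd_cone, map_R T bd (fun i c => bd_act _ _)]
    have : (fun b => bd (E p T (n + 1) b)) = R T (E p T n) := by
      funext b; exact ih b
    rw [this, R_R T hT hT2]; simp

/-- the cup product of the coboundaries of `τ`s -/
def W : List (V → ZMod 2) → List V → ZMod 2
  | [], [_] => 1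
  | [], _ => 0
  | τ :: τs, v :: v' :: l => (τ v + τ v') * W τs (v' :: l)
  | _ :: _, _ => 0

def G (τ : V → ZMod 2) (τs : List (V → ZMod 2)) : List V → ZMod 2
  | [] => 0
  | v :: l => τ v * W τs (v :: l)

lemma W_nil (τs : List (V → ZMod 2)) : W τs ([] : List V) = 0 := by
  cases τs <;> simp [W]

lemma ev_cone (F : List V → ZMod 2) (p : V) (c : Ch V) :
    ev F (cone p c) = ev (fun l => F (p :: l)) c := by
  refine lin_ext (f := ev F ∘ₗ cone p) (g := ev (fun l => F (p :: l))) ?_ c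
  intro l; simp

lemma ev_G_cons (τ : V → ZMod 2) (τs : List (V → ZMod 2)) (v : V) (c : Ch V) :
    ev (G τ τs) (cone v c) = τ v * ev (W τs) (cone v c) := by
  refine lin_ext (f := ev (G τ τs) ∘ₗ cone v) (g := (τ v) • (ev (W τs) ∘ₗ cone v)) ?_ c
  intro l; simp [G]

lemma z2_add_self (a : ZMod 2) : a + a = 0 := CharTwo.add_self_eq_zero a

lemma W_bd (τs : List (V → ZMod 2)) : (∀ l, ev (W τs) (bdL l) = 0) ∧
    ∀ τ l, W (τ :: τs) l = ev (G τ τs) (bdL l) := by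
  have key : ∀ τs : List (V → ZMod 2), (∀ l, ev (W τs) (bdL l) = 0) →
      ∀ τ l, W (τ :: τs) l = ev (G τ τs) (bdL l) := by
    intro τs h τ l
    match l with
    | [] => simp [W, bdL]
    | [v] => simp [W, bdL, G]
    | v :: v' :: l =>
      have h1 := h (v :: v' :: l)
      simp only [W]
      rw [bdL, map_add, ev_single, ev_G_cons]
      rw [bdL, map_add, ev_single] at h1
      have h2 : ev (W τs) (cone v (bdL (v' :: l))) = W τs (v' :: l) := by
        have := z2_add_self (W τs (v' :: l))
        linear_combination h1 - this
      rw [h2]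
      simp only [G]; ring
  have main : ∀ l, ev (W τs) (bdL l) = 0 := by
    induction τs with
    | nil =>
      intro l
      match l with
      | [] => simp [bdL]
      | [v] => simp [bdL, W]
      | [v, v'] => simp [bdL, W]; exact z2_add_self 1
      | v :: v' :: v'' :: l =>
        simp only [bdL, map_add, ev_single, cone_single, W]
        simp only [ev_cone, W]
        simp only [zero_add]
        refine lin_ext (f := ev _) (g := 0) ?_ _
        intro l; simp
    | cons τ τs ih =>
      intro l
      have hk := key τs ih τ
      have : ev (W (τ :: τs)) = ev (G τ τs) ∘ₗ bd := by
        apply LinearMap.ext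
        intro c
        refine lin_ext ?_ c
        intro l
        simp [hk]
      rw [this, ← bd_single]
      simp only [LinearMap.comp_apply, bd_bd, map_zero]
  exact ⟨main, key τs main⟩

lemma ev_W_cons (τ : V → ZMod 2) (τs : List (V → ZMod 2)) (c : Ch V) :
    ev (W (τ :: τs)) c = ev (G τ τs) (bd c) := by
  refine lin_ext (f := ev _) (g := ev (G τ τs) ∘ₗ bd) ?_ c
  intro l
  simp [(W_bd τs).2]

lemma map_supp (φ : Ch V →ₗ[ZMod 2] Ch V) {s t : Set (List V)}
    (h : ∀ l ∈ s, φ (Finsupp.single l 1) ∈ Finsupp.supported (ZMod 2) (ZMod 2) t) {c : Ch V}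
    (hc : c ∈ Finsupp.supported (ZMod 2) (ZMod 2) s) :
    φ c ∈ Finsupp.supported (ZMod 2) (ZMod 2) t := by
  rw [Finsupp.supported_eq_span_single] at hc
  have : Submodule.span (ZMod 2) ((fun i => Finsupp.single i (1 : ZMod 2)) '' s) ≤
      (Finsupp.supported (ZMod 2) (ZMod 2) t).comap φ := by
    rw [Submodule.span_le]
    rintro _ ⟨l, hl, rfl⟩
    exact h l hl
  exact this hc

lemma ev_congr {F F' : List V → ZMod 2} {s : Set (List V)} (h : ∀ l ∈ s, F l = F' l) {c : Ch V}
    (hc : c ∈ Finsupp.supported (ZMod 2) (ZMod 2) s) : ev F c = ev F' c := by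
  simp only [ev, Finsupp.linearCombination_apply]
  apply Finsupp.sum_congr
  intro l hl
  rw [h l (hc hl)]

lemma ev_act (F : List V → ZMod 2) (g : V → V) (c : Ch V) :
    ev F (act g c) = ev (fun l => F (l.map g)) c := by
  refine lin_ext (f := ev F ∘ₗ act g) (g := ev (fun l => F (l.map g))) ?_ c
  intro l; simp

lemma W_map (T : Fin 3 → V → V) (S : Set V) (i : Fin 3)
    (L : List ((Fin 3 → ZMod 2) × (V → ZMod 2)))
    (hL : ∀ q ∈ L, ∀ v ∈ S, q.2 (T i v) = q.2 v + q.1 i) (l : List V) (hl : ∀ v ∈ l, v ∈ S) :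
    W (L.map Prod.snd) (l.map (T i)) = W (L.map Prod.snd) l := by
  induction L generalizing l with
  | nil => match l with
    | [] => rfl
    | [v] => rfl
    | v :: v' :: l => rfl
  | cons q L ih => match l with
    | [] => rfl
    | [v] => rfl
    | v :: v' :: l =>
      simp only [List.map_cons, W]
      have := ih (fun q hq => hL q (by simp [hq])) (v' :: l) (fun v hv => hl v (by simp at hv ⊢; tauto))
      rw [List.map_cons] at this
      rw [this, hL q (by simp) v (hl v (by simp)), hL q (by simp) v' (hl v' (by simp))]
      have := z2_add_self (q.1 i)
      linear_combination (W (List.map Prod.snd L) (v' :: l)) * this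

noncomputable def lin (ε : Fin 3 → ZMod 2) : MvPolynomial (Fin 3) (ZMod 2) :=
  ∑ i, MvPolynomial.C (ε i) * MvPolynomial.X i

theorem formal (T : Fin 3 → V → V) (S : Set V) (E : ℕ → B → Ch V) (p : V)
    (hE0 : ∀ b, E 0 b = if b = 0 then Finsupp.single [p] 1 else 0)
    (hE : ∀ n b, bd (E (n + 1) b) = R T (E n) b)
    (N : B)
    (hS : ∀ n, ∀ b ≤ N, E n b ∈ Finsupp.supported (ZMod 2) (ZMod 2) {l | ∀ v ∈ l, v ∈ S})
    (L : List ((Fin 3 → ZMod 2) × (V → ZMod 2)))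
    (hL : ∀ q ∈ L, ∀ i, ∀ v ∈ S, q.2 (T i v) = q.2 v + q.1 i) (b : B) (hb : b ≤ N) :
    ev (W (L.map Prod.snd)) (E L.length b) =
      MvPolynomial.coeff b (L.map (fun q => lin q.1)).prod := by
  induction L generalizing b with
  | nil =>
    simp only [List.map_nil, List.length_nil, hE0, List.prod_nil, MvPolynomial.coeff_one]
    by_cases h : b = 0
    · simp [h, W]
    · have h' : ¬ 0 = b := fun e => h e.symm
      simp [h, h']
  | cons q L ih =>
    have ih' := ih (fun q hq => hL q (by simp [hq]))
    simp only [List.map_cons, List.length_cons, List.prod_cons]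
    rw [ev_W_cons, hE, R, map_sum, lin, Finset.sum_mul, MvPolynomial.coeff_sum]
    apply Finset.sum_congr rfl
    intro i _
    rw [mul_assoc, MvPolynomial.coeff_C_mul, MvPolynomial.coeff_X_mul']
    simp only [A, D, Finsupp.mem_support_iff, Nat.pos_iff_ne_zero]
    split_ifs with h
    · have hb' : b - Finsupp.single i 1 ≤ N := le_trans tsub_le_self hb
      rw [← ih' _ hb', map_add, ev_act]
      have : ev (fun l => G q.2 (L.map Prod.snd) (l.map (T i))) (E L.length (b - Finsupp.single i 1))
          = ev (fun l => G q.2 (L.map Prod.snd) l + q.1 i * W (L.map Prod.snd) l)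
            (E L.length (b - Finsupp.single i 1)) := by
        refine ev_congr ?_ (hS _ _ hb')
        intro l hl
        match l with
        | [] => simp [G, W_nil]
        | v :: l =>
          have h1 := W_map T S i L (fun q hq v hv => hL q (by simp [hq]) i v hv) (v :: l) hl
          rw [List.map_cons] at h1 ⊢
          simp only [G]
          rw [h1, hL q (by simp) i v (hl v (by simp))]
          ring
      rw [this]
      have h2 : ev (fun l => G q.2 (L.map Prod.snd) l + q.1 i * W (L.map Prod.snd) l) 
          = ev (G q.2 (L.map Prod.snd)) + (q.1 i) • ev (W (L.map Prod.snd)) := by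
        apply LinearMap.ext
        intro c
        refine lin_ext ?_ c
        intro l; simp
      rw [h2, LinearMap.add_apply, ← add_assoc, z2_add_self]
      simp
    · simp

lemma W_zero (τs : List (V → ZMod 2)) (τ : V → ZMod 2) (hτ : τ ∈ τs) (l : List V)
    (h : ∀ v ∈ l, ∀ v' ∈ l, τ v = τ v') : W τs l = 0 := by
  induction τs generalizing l with
  | nil => simp at hτ
  | cons τ' τs ih => match l with
    | [] => rfl
    | [v] => rfl
    | v :: v' :: l =>
      simp only [W]
      rcases List.mem_cons.1 hτ with rfl | h'
      · rw [h v (by simp) v' (by simp), z2_add_self, zero_mul]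
      · rw [ih h' (v' :: l) (fun a ha b hb => h a (by simp at ha ⊢; tauto) b (by simp at hb ⊢; tauto)),
          mul_zero]

end chains
end BUx


namespace BUx

section mesh
variable {V : Type*} [NormedAddCommGroup V] [NormedSpace ℝ V]

noncomputable def bary (l : List V) : V := (l.length : ℝ)⁻¹ • l.sum

lemma bary_map (T : V →ₗ[ℝ] V) (l : List V) : bary (l.map T) = T (bary l) := by
  simp [bary, map_list_sum]

lemma bary_mem {K : Set V} (hK : Convex ℝ K) (l : List V) (hl : l ≠ []) (h : ∀ x ∈ l, x ∈ K) :
    bary l ∈ K := by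
  have hlen : (l.length : ℝ) ≠ 0 := by
    simpa using hl
  have : bary l = ∑ i : Fin l.length, (l.length : ℝ)⁻¹ • l.get i := by
    rw [bary, ← Finset.smul_sum]
    congr 1
    conv_lhs => rw [← List.ofFn_get l]
    rw [List.sum_ofFn]
  rw [this]
  apply hK.sum_mem
  · intro i _; positivity
  · simp [hlen]
  · intro i _; exact h _ (List.get_mem _ _)

lemma sum_sub_le (l : List V) (v : V) (δ : ℝ) (h : ∀ x ∈ l, dist x v ≤ δ) :
    ‖l.sum - (l.length : ℝ) • v‖ ≤ l.length * δ := by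
  induction l with
  | nil => simp
  | cons x l ih =>
    have h1 := ih (fun x hx => h x (by simp [hx]))
    have h2 := h x (by simp)
    rw [dist_eq_norm] at h2
    have : (x :: l).sum - ((x :: l).length : ℝ) • v
        = (x - v) + (l.sum - (l.length : ℝ) • v) := by
      simp only [List.sum_cons, List.length_cons, Nat.cast_add, Nat.cast_one, add_smul, one_smul]
      abel
    rw [this]
    refine (norm_add_le _ _).trans ?_
    simp only [List.length_cons, Nat.cast_add, Nat.cast_one]
    linarith

lemma dist_bary (N : ℕ) (δ : ℝ) (l : List V) (hlen : l.length ≤ N + 1)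
    (h : ∀ x ∈ l, ∀ y ∈ l, dist x y ≤ δ) (v : V) (hv : v ∈ l) :
    dist v (bary l) ≤ (N / (N + 1) : ℝ) * δ := by
  obtain ⟨a, b, rfl⟩ := List.append_of_mem hv
  have hδ : 0 ≤ δ := le_trans dist_nonneg (h v hv v hv)
  have h1 := sum_sub_le (a ++ b) v δ (fun x hx => h x (by simp at hx ⊢; tauto) v hv)
  set n := (a ++ b).length with hn
  have hl : (a ++ v :: b).length = n + 1 := by simp [hn]; ring
  have hnN : n ≤ N := by omega
  have hpos : (0 : ℝ) < n + 1 := by positivity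
  have hsum : (a ++ v :: b).sum = v + (a ++ b).sum := by simp; abel
  have e : bary (a ++ v :: b) - v = ((n : ℝ) + 1)⁻¹ • ((a ++ b).sum - (n : ℝ) • v) := by
    rw [bary, hl, hsum]
    have : v = ((n : ℝ) + 1)⁻¹ • (((n : ℝ) + 1) • v) := by
      rw [smul_smul, inv_mul_cancel₀ hpos.ne', one_smul]
    conv_lhs => rw [sub_eq_add_neg]; arg 2; rw [this]
    push_cast
    rw [← sub_eq_add_neg, ← smul_sub, add_smul, one_smul]
    congr 1
    abel
  rw [dist_comm, dist_eq_norm, e, norm_smul, Real.norm_of_nonneg (by positivity)]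
  calc ((n : ℝ) + 1)⁻¹ * ‖(a ++ b).sum - (n : ℝ) • v‖ ≤ ((n : ℝ) + 1)⁻¹ * (n * δ) := by gcongr
    _ = (n / (n + 1) : ℝ) * δ := by field_simp
    _ ≤ (N / (N + 1) : ℝ) * δ := by
      refine mul_le_mul_of_nonneg_right ?_ hδ
      rw [div_le_div_iff₀ hpos (by positivity)]
      have : (n : ℝ) ≤ N := by exact_mod_cast hnN
      nlinarith

lemma bdL_supp {V : Type*} (l : List V) : bdL l ∈ Finsupp.supported (ZMod 2) (ZMod 2)
    {l' | l'.length + 1 = l.length ∧ ∀ x ∈ l', x ∈ l} := by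
  induction l with
  | nil => simp [bdL]
  | cons v l ih =>
    rw [bdL]
    apply Submodule.add_mem
    · apply Finsupp.single_mem_supported
      simp
      tauto
    · refine map_supp (cone v) ?_ ih
      rintro l' ⟨h1, h2⟩
      rw [cone_single]
      apply Finsupp.single_mem_supported
      simp
      refine ⟨h1, fun a ha => Or.inr (h2 a ha)⟩

lemma Sd_supp (N : ℕ) (δ : ℝ) (n : ℕ) (hn : n ≤ N + 1) (l : List V) (hl : l.length = n)
    (h : ∀ x ∈ l, ∀ y ∈ l, dist x y ≤ δ) :
    Sd bary n (Finsupp.single l 1) ∈ Finsupp.supported (ZMod 2) (ZMod 2)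
      {l' : List V | l'.length = n ∧ (∀ x ∈ l', x ∈ convexHull ℝ {x | x ∈ l}) ∧
        ∀ x ∈ l', ∀ y ∈ l', dist x y ≤ (N / (N + 1) : ℝ) * δ} := by
  induction n generalizing l with
  | zero =>
    have : l = [] := by simpa using hl
    subst this
    simp only [Sd, LinearMap.id_apply]
    apply Finsupp.single_mem_supported
    simp
  | succ n ih =>
    rw [Sd_succ_single]
    have hne : l ≠ [] := by rintro rfl; simp at hl
    have hb : bary l ∈ convexHull ℝ {x | x ∈ l} :=
      bary_mem (convex_convexHull ℝ _) l hne (fun x hx => subset_convexHull ℝ _ hx)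
    obtain ⟨x0, hx0⟩ := List.exists_mem_of_ne_nil l hne
    have hδ : 0 ≤ δ := le_trans dist_nonneg (h x0 hx0 x0 hx0)
    have hball : convexHull ℝ {x | x ∈ l} ⊆ Metric.closedBall (bary l) ((N / (N + 1) : ℝ) * δ) := by
      apply convexHull_min
      · intro x hx
        exact dist_bary N δ l (by omega) h x hx
      · exact convex_closedBall _ _
    have h1 : Sd bary n (bdL l) ∈ Finsupp.supported (ZMod 2) (ZMod 2)
      {l' : List V | l'.length = n ∧ (∀ x ∈ l', x ∈ convexHull ℝ {x | x ∈ l}) ∧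
        ∀ x ∈ l', ∀ y ∈ l', dist x y ≤ (N / (N + 1) : ℝ) * δ} := by
      refine map_supp _ ?_ (bdL_supp l)
      rintro l1 ⟨hl1, hl2⟩
      have := ih (by omega) l1 (by omega) (fun x hx y hy => h x (hl2 x hx) y (hl2 y hy))
      refine Finsupp.supported_mono ?_ this
      rintro l' ⟨ha, hb, hc⟩
      refine ⟨ha, fun x hx => convexHull_mono (fun x hx => hl2 x hx) (hb x hx), hc⟩
    refine map_supp (cone _) ?_ h1
    rintro l' ⟨ha, hb', hc⟩
    rw [cone_single]
    apply Finsupp.single_mem_supported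
    refine ⟨by simp [ha], ?_, ?_⟩
    · intro x hx
      rcases List.mem_cons.1 hx with rfl | hx
      · exact hb
      · exact hb' x hx
    · intro x hx y hy
      rcases List.mem_cons.1 hx with rfl | hx <;> rcases List.mem_cons.1 hy with rfl | hy
      · rw [dist_self]; positivity
      · rw [dist_comm]; exact hball (hb' y hy)
      · exact hball (hb' x hx)
      · exact hc x hx y hy

noncomputable def Sdr (r n : ℕ) (c : Ch V) : Ch V := (Sd (bary (V := V)) n ^ r) c

lemma Sdr_succ (r n : ℕ) (c : Ch V) : Sdr (r + 1) n c = Sd bary n (Sdr r n c) := by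
  simp [Sdr, pow_succ']

lemma bd_Sdr (r n : ℕ) (c : Ch V) : bd (Sdr r (n + 1) c) = Sdr r n (bd c) := by
  induction r with
  | zero => simp [Sdr]
  | succ r ih => rw [Sdr_succ, Sdr_succ, bd_Sd, ih]

lemma Sdr_act (T : V →ₗ[ℝ] V) (r n : ℕ) (c : Ch V) : Sdr r n (act T c) = act T (Sdr r n c) := by
  induction r with
  | zero => simp [Sdr]
  | succ r ih => rw [Sdr_succ, Sdr_succ, ih, Sd_act _ _ (bary_map T)]

lemma Sdr_one (r : ℕ) (p : V) : Sdr r 1 (Finsupp.single [p] 1) = Finsupp.single [p] 1 := by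
  induction r with
  | zero => simp [Sdr]
  | succ r ih =>
    rw [Sdr_succ, ih, Sd_succ_single]
    simp [bdL, Sd, bary]

lemma Sdr_supp (N : ℕ) (δ : ℝ) (r : ℕ) (c : Ch V) (s : Set (List V))
    (hc : c ∈ Finsupp.supported (ZMod 2) (ZMod 2) s)
    (hs : ∀ l ∈ s, l.length = N + 1 ∧ ∀ x ∈ l, ∀ y ∈ l, dist x y ≤ δ) :
    Sdr r (N + 1) c ∈ Finsupp.supported (ZMod 2) (ZMod 2)
      {l' : List V | l'.length = N + 1 ∧ (∃ l ∈ s, ∀ x ∈ l', x ∈ convexHull ℝ {x | x ∈ l}) ∧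
        ∀ x ∈ l', ∀ y ∈ l', dist x y ≤ (N / (N + 1) : ℝ) ^ r * δ} := by
  induction r with
  | zero =>
    have : Sdr 0 (N + 1) c = c := by simp [Sdr]
    rw [this]
    refine Finsupp.supported_mono ?_ hc
    intro l hl
    refine ⟨(hs l hl).1, ⟨l, hl, fun x hx => subset_convexHull ℝ _ hx⟩, ?_⟩
    simpa using (hs l hl).2
  | succ r ih =>
    rw [Sdr_succ]
    refine map_supp _ ?_ ih
    rintro l ⟨h1, ⟨l0, hl0, h2⟩, h3⟩
    refine Finsupp.supported_mono ?_ (Sd_supp N _ (N + 1) le_rfl l h1 h3)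
    rintro l' ⟨h1', h2', h3'⟩
    refine ⟨h1', ⟨l0, hl0, fun x hx => ?_⟩, ?_⟩
    · exact convexHull_min h2 (convex_convexHull ℝ _) (h2' x hx)
    · intro x hx y hy
      rw [pow_succ', mul_assoc]
      exact h3' x hx y hy

end mesh
end BUx


namespace BUx

section sphere
variable {d : ℕ}

abbrev VV (d : ℕ) := Fin 3 → EuclideanSpace ℝ (Fin d)

noncomputable def TT (i : Fin 3) : VV d →ₗ[ℝ] VV d :=
  LinearMap.pi (fun j => (if j = i then (-1 : ℝ) else 1) • LinearMap.proj j)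

lemma TT_apply (i j : Fin 3) (v : VV d) : TT i v j = (if j = i then (-1 : ℝ) else 1) • v j := rfl

lemma TT_apply' (i j : Fin 3) (v : VV d) : TT i v j = if j = i then - v j else v j := by
  rw [TT_apply]; split_ifs <;> simp

noncomputable def pp (b : B) : VV d := fun i => WithLp.toLp 2 (fun j => if (j : ℕ) = b i then 1 else 0)

def SS : Set (VV d) := {v | ∀ i, v i ≠ 0}

def Good (b : B) (l : List (VV d)) : Prop :=
  ∃ s : Fin 3 → Fin d → ℝ, (∀ i, ∀ j : Fin d, (j : ℕ) = b i → s i j = 1) ∧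
    ∀ x ∈ l, ∀ i, (∀ j : Fin d, b i < j → x i j = 0) ∧ ∑ j, s i j * x i j = 1

lemma Good.hull {b : B} {l : List (VV d)} (h : Good b l) : convexHull ℝ {x | x ∈ l} ⊆ SS := by
  obtain ⟨s, -, hs⟩ := h
  have : convexHull ℝ {x | x ∈ l} ⊆ {x | ∀ i, ∑ j, s i j * x i j = 1} := by
    apply convexHull_min
    · intro x hx i; exact (hs x hx i).2
    · intro x hx y hy a c ha hc hac i
      have hx := hx i
      have hy := hy i
      simp only [Pi.add_apply, Pi.smul_apply, PiLp.add_apply, PiLp.smul_apply, smul_eq_mul, mul_add,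
        Finset.sum_add_distrib]
      have e1 : ∑ j, s i j * (a * x i j) = a * ∑ j, s i j * x i j := by
        rw [Finset.mul_sum]; congr 1; ext; ring
      have e2 : ∑ j, s i j * (c * y i j) = c * ∑ j, s i j * y i j := by
        rw [Finset.mul_sum]; congr 1; ext; ring
      rw [e1, e2, hx, hy]; linarith
  intro x hx i h0
  have := this hx i
  simp [h0] at this

lemma good_pp (b : B) (i : Fin 3) (s : Fin d → ℝ) (hs : ∀ j : Fin d, (j : ℕ) = b i → s j = 1)
    (hb : b i < d) :
    (∀ j : Fin d, b i < j → (pp b : VV d) i j = 0) ∧ ∑ j, s j * (pp b : VV d) i j = 1 := by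
  constructor
  · intro j hj
    simp [pp]; omega
  · rw [Finset.sum_eq_single ⟨b i, hb⟩]
    · simp [pp, hs]
    · intro j _ hj
      have : (j : ℕ) ≠ b i := fun h => hj (Fin.ext h)
      simp [pp, this]
    · simp

lemma good_step (b : B) (hb : ∀ i, b i < d) (i : Fin 3) (hi : 0 < b i) (l : List (VV d))
    (h : Good (b - Finsupp.single i 1) l) (η : ℝ) (hη : η * η = 1) (g : VV d → VV d)
    (hg : ∀ v j, g v j = (if j = i then η else 1) • v j) :
    Good b (pp b :: l.map g) := by
  obtain ⟨s, hs1, hs2⟩ := h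
  refine ⟨fun i' j => if i' = i then (if (j : ℕ) = b i then 1 else η * s i j) else s i' j, ?_, ?_⟩
  · intro i' j hj
    by_cases hi' : i' = i
    · subst hi'; simp [hj]
    · have : i ≠ i' := fun h => hi' h.symm
      simp only [hi', if_false]
      apply hs1
      simp [hj, this]
  · intro x hx i'
    rcases List.mem_cons.1 hx with rfl | hx
    · apply good_pp _ _ _ _ (hb i')
      intro j hj
      by_cases hi' : i' = i
      · subst hi'; simp [hj]
      · have : i ≠ i' := fun h => hi' h.symm
        simp only [hi', if_false]
        apply hs1
        simp [hj, this]
    · obtain ⟨y, hy, rfl⟩ := List.mem_map.1 hx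
      obtain ⟨h1, h2⟩ := hs2 y hy i'
      by_cases hi' : i' = i
      · subst hi'
        simp only [Finsupp.tsub_apply, Finsupp.single_apply, if_true] at h1
        constructor
        · intro j hj
          rw [hg]
          simp [h1 j (by omega)]
        · rw [← h2]
          apply Finset.sum_congr rfl
          intro j _
          rw [hg]
          simp only [if_true, PiLp.smul_apply, smul_eq_mul]
          by_cases hj : (j : ℕ) = b i'
          · rw [h1 j (by omega)]; simp
          · rw [if_neg hj]; linear_combination (s i' j * y i' j) * hη
      · have hne : i ≠ i' := fun h => hi' h.symm
        simp only [Finsupp.tsub_apply, Finsupp.single_apply, hne, if_false, tsub_zero] at h1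
        simp only [hg, hi', if_false, one_smul]
        exact ⟨h1, h2⟩

lemma E_supp (n : ℕ) (b : B) (hb : ∀ i, b i < d) :
    E (pp (d := d)) (fun i => TT i) n b ∈ Finsupp.supported (ZMod 2) (ZMod 2)
      {l | l.length = n + 1 ∧ Good b l} := by
  induction n generalizing b with
  | zero =>
    simp only [E]
    split_ifs with h
    · subst h
      apply Finsupp.single_mem_supported
      refine ⟨rfl, fun _ _ => 1, fun _ _ _ => rfl, ?_⟩
      intro x hx i
      rw [List.mem_singleton] at hx
      subst hx
      exact good_pp 0 i _ (fun _ _ => rfl) (hb i)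
    · exact Submodule.zero_mem _
  | succ n ih =>
    simp only [E, R, map_sum]
    apply Submodule.sum_mem
    intro i _
    simp only [A, D]
    split_ifs with hi
    · have hb' : ∀ j, (b - Finsupp.single i 1 : B) j < d := fun j =>
        lt_of_le_of_lt (by simp) (hb j)
      have h1 := ih _ hb'
      rw [map_add]
      apply Submodule.add_mem
      · refine map_supp (cone _) ?_ h1
        rintro l ⟨hl, hG⟩
        rw [cone_single]
        apply Finsupp.single_mem_supported
        refine ⟨by simp [hl], ?_⟩
        have := good_step b hb i hi l hG 1 (by norm_num) id (by simp)
        simpa using this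
      · refine map_supp (cone (pp b) ∘ₗ act _) ?_ h1
        rintro l ⟨hl, hG⟩
        simp only [LinearMap.comp_apply, act_single, cone_single]
        apply Finsupp.single_mem_supported
        refine ⟨by simp [hl], ?_⟩
        exact good_step b hb i hi l hG (-1) (by norm_num) _ (fun v j => TT_apply i j v)
    · simp

open Classical in
noncomputable def sig (x : EuclideanSpace ℝ (Fin d)) : ZMod 2 :=
  if WellOrderingRel x (-x) then 1 else 0

lemma sig_neg (x : EuclideanSpace ℝ (Fin d)) (hx : x ≠ 0) : sig (-x) = sig x + 1 := by
  have hne : x ≠ -x := by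
    intro h
    have h2 : (2 : ℝ) • x = 0 := by
      rw [two_smul]; nth_rewrite 2 [h]; simp
    exact hx ((smul_eq_zero.1 h2).resolve_left (by norm_num))
  unfold sig
  rw [neg_neg]
  rcases trichotomous_of WellOrderingRel x (-x) with h | h | h
  · have h' : ¬ WellOrderingRel (-x) x := asymm_of _ h
    rw [if_pos h, if_neg h']; decide
  · exact absurd h hne
  · have h' : ¬ WellOrderingRel x (-x) := asymm_of _ h
    rw [if_pos h, if_neg h']; decide

open Classical in
noncomputable def tau (ε : Fin 3 → ZMod 2) (f : VV d → ℝ) (v : VV d) : ZMod 2 :=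
  if f v < 0 then 1 else if 0 < f v then 0 else ∑ i, ε i * sig (v i)

lemma tau_T (ε : Fin 3 → ZMod 2) (f : VV d → ℝ) (i : Fin 3) (v : VV d) (hv : v ∈ SS)
    (hf : f (TT i v) = (if ε i = 0 then 1 else -1) * f v) :
    tau ε f (TT i v) = tau ε f v + ε i := by
  have hz : ∀ a : ZMod 2, a = 0 ∨ a = 1 := by decide
  have hsum : ∑ j, ε j * sig (TT i v j) = (∑ j, ε j * sig (v j)) + ε i := by
    have : ∀ j, ε j * sig (TT i v j) = ε j * sig (v j) + if j = i then ε j else 0 := by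
      intro j
      rw [TT_apply']
      split_ifs with h
      · rw [sig_neg _ (hv j)]; ring
      · ring
    simp only [this, Finset.sum_add_distrib]
    simp
  unfold tau
  rw [hf, hsum]
  have h11 : (1 : ZMod 2) + 1 = 0 := by decide
  rcases hz (ε i) with h | h
  · simp [h]
  · simp only [h, one_ne_zero, if_false, neg_mul, one_mul, Left.neg_neg_iff, Left.neg_pos_iff]
    rcases lt_trichotomy (f v) 0 with h0 | h0 | h0
    · simp [h0, h0.not_gt, h11]
    · simp [h0]
    · simp [h0, h0.not_gt]

lemma TT_comm (i j : Fin 3) (v : VV d) : TT i (TT j v) = TT j (TT i v) := by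
  funext k
  simp only [TT_apply, smul_smul]; rw [mul_comm]

lemma TT_TT (i : Fin 3) (v : VV d) : TT i (TT i v) = v := by
  funext k
  simp only [TT_apply, smul_smul]
  split_ifs <;> simp

lemma isOpen_SS : IsOpen (SS : Set (VV d)) := by
  have : (SS : Set (VV d)) = ⋂ i, {v | v i ≠ 0} := by ext; simp [SS]
  rw [this]
  apply isOpen_iInter_of_finite
  intro i
  exact isOpen_ne_fun (continuous_apply i) continuous_const

theorem BU (L : List ((Fin 3 → ZMod 2) × (VV d → ℝ)))
    (hcont : ∀ q ∈ L, ContinuousOn q.2 SS)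
    (heq : ∀ q ∈ L, ∀ i, ∀ v ∈ SS, q.2 (TT i v) = (if q.1 i = 0 then 1 else -1) * q.2 v)
    (a : B) (ha : ∀ i, a i < d)
    (hc : MvPolynomial.coeff a (L.map (fun q => lin q.1)).prod ≠ 0) :
    ∃ v ∈ (SS : Set (VV d)), ∀ q ∈ L, q.2 v = 0 := by
  by_contra hcon
  push Not at hcon
  set n := L.length with hn
  set E0 := E (pp (d := d)) (fun i => TT i) with hE0
  set s : Set (List (VV d)) := ((E0 n a).support : Set (List (VV d))) with hs
  have hsG : ∀ l ∈ s, l.length = n + 1 ∧ Good a l := fun l hl => E_supp n a ha hl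
  set K : Set (VV d) := ⋃ l ∈ s, convexHull ℝ {x | x ∈ l} with hK
  have hKc : IsCompact K := by
    apply Set.Finite.isCompact_biUnion (Finset.finite_toSet _)
    intro l _
    exact Set.Finite.isCompact_convexHull (𝕜 := ℝ) (List.finite_toSet l)
  have hKS : K ⊆ SS := by
    intro x hx
    simp only [hK, Set.mem_iUnion] at hx
    obtain ⟨l, hl, hx⟩ := hx
    exact (hsG l hl).2.hull hx
  obtain ⟨δ0, hδ0⟩ := Metric.isBounded_iff.1 hKc.isBounded
  -- Lebesgue number
  let U : {q // q ∈ L} × Bool → Set (VV d) := fun z =>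
    SS ∩ z.1.1.2 ⁻¹' (if z.2 then Set.Ioi 0 else Set.Iio 0)
  have hU : ∀ z, IsOpen (U z) := by
    intro z
    apply (hcont z.1.1 z.1.2).isOpen_inter_preimage isOpen_SS
    split_ifs
    · exact isOpen_Ioi
    · exact isOpen_Iio
  have hcov : K ⊆ ⋃ z, U z := by
    intro x hx
    obtain ⟨q, hq, hqx⟩ := hcon x (hKS hx)
    rw [Set.mem_iUnion]
    rcases lt_or_gt_of_ne hqx with h | h
    · exact ⟨(⟨q, hq⟩, false), hKS hx, by simpa using h⟩
    · exact ⟨(⟨q, hq⟩, true), hKS hx, by simpa using h⟩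
  obtain ⟨δ, hδ, hleb⟩ := lebesgue_number_lemma_of_metric hKc hU hcov
  have hq : Filter.Tendsto (fun r : ℕ => ((n : ℝ) / (n + 1)) ^ r * δ0) Filter.atTop (nhds 0) := by
    rw [← zero_mul δ0]
    apply Filter.Tendsto.mul_const
    apply tendsto_pow_atTop_nhds_zero_of_lt_one (by positivity)
    rw [div_lt_one (by positivity)]
    linarith
  obtain ⟨r, hr⟩ := (hq.eventually (gt_mem_nhds hδ)).exists
  let E' : ℕ → B → Ch (VV d) := fun n b => Sdr r (n + 1) (E0 n b)
  let L' : List ((Fin 3 → ZMod 2) × (VV d → ZMod 2)) := L.map (fun q => (q.1, tau q.1 q.2))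
  have hsd : ∀ m (c : Ch (VV d)) (t : Set (List (VV d))),
      c ∈ Finsupp.supported (ZMod 2) (ZMod 2) t → (∀ l ∈ t, l.length = m + 1) →
      Sdr r (m + 1) c ∈ Finsupp.supported (ZMod 2) (ZMod 2)
        {l' | ∃ l ∈ t, ∀ x ∈ l', x ∈ convexHull ℝ {x | x ∈ l}} := by
    intro m c t hct ht
    have hfin : (⋃ l ∈ c.support, {x | x ∈ l}).Finite := by
      apply Set.Finite.biUnion (Finset.finite_toSet _)
      intro l _; exact List.finite_toSet l
    obtain ⟨δ1, hδ1⟩ := Metric.isBounded_iff.1 hfin.isBounded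
    have := Sdr_supp m δ1 r c (c.support : Set (List (VV d))) (fun _ h => h) (by
      intro l hl
      refine ⟨ht l (hct hl), fun x hx y hy => hδ1 ?_ ?_⟩
      · simp only [Set.mem_iUnion]; exact ⟨l, hl, hx⟩
      · simp only [Set.mem_iUnion]; exact ⟨l, hl, hy⟩)
    refine Finsupp.supported_mono ?_ this
    rintro l' ⟨-, ⟨l, hl, h⟩, -⟩
    exact ⟨l, hct hl, h⟩
  have key := formal (fun i => TT (d := d) i) SS E' (pp 0) ?_ ?_ a ?_ L' ?_ a le_rfl
  · have hlen : L'.length = n := by simp [L', hn]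
    rw [hlen] at key
    have hprod : (L'.map (fun q => lin q.1)) = L.map (fun q => lin q.1) := by
      simp [L', Function.comp_def]
    rw [hprod] at key
    apply hc
    rw [← key]
    have hsup := Sdr_supp n δ0 r (E0 n a) s (fun _ h => h) (by
      intro l hl
      refine ⟨(hsG l hl).1, fun x hx y hy => hδ0 ?_ ?_⟩
      · simp only [hK, Set.mem_iUnion]; exact ⟨l, hl, subset_convexHull ℝ _ hx⟩
      · simp only [hK, Set.mem_iUnion]; exact ⟨l, hl, subset_convexHull ℝ _ hy⟩)
    have : ev (W (L'.map Prod.snd)) (E' n a) = ev (fun _ => 0) (E' n a) := by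
      refine ev_congr ?_ hsup
      rintro l' ⟨hl1, ⟨l, hl, hl2⟩, hl3⟩
      obtain ⟨x0, hx0⟩ := List.exists_mem_of_ne_nil l' (by rintro rfl; simp at hl1)
      obtain ⟨z, hz⟩ := hleb x0 (by
        simp only [hK, Set.mem_iUnion]; exact ⟨l, hl, hl2 x0 hx0⟩)
      have hin : ∀ x ∈ l', x ∈ U z := fun x hx => hz (lt_of_le_of_lt (hl3 x hx x0 hx0) hr)
      apply W_zero _ (tau z.1.1.1 z.1.1.2)
      · simp only [L', List.map_map, List.mem_map]
        exact ⟨z.1.1, z.1.2, rfl⟩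
      · have hconst : ∀ x ∈ l', tau z.1.1.1 z.1.1.2 x = if z.2 then 0 else 1 := by
          intro x hx
          have := (hin x hx).2
          unfold tau
          cases hz2 : z.2
          · simp only [hz2, Bool.false_eq_true, if_false, Set.mem_preimage, Set.mem_Iio] at this
            simp [this]
          · simp only [hz2, if_true, Set.mem_preimage, Set.mem_Ioi] at this
            simp [this, this.not_gt]
        intro x hx y hy
        rw [hconst x hx, hconst y hy]
    rw [this]
    refine lin_ext (f := ev _) (g := 0) ?_ _
    intro l; simp
  · intro b
    simp only [E', hE0, E]
    split_ifs with h
    · exact Sdr_one r _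
    · simp [Sdr]
  · intro m b
    simp only [E']
    rw [bd_Sdr, hE0, bd_E _ _ (fun i j v => TT_comm i j v) (fun i v => TT_TT i v)]
    exact map_R _ (Sd (bary (V := VV d)) (m + 1) ^ r) (fun i c => Sdr_act (TT i) r (m + 1) c) _ _
  · intro m b hb
    have hb' : ∀ i, b i < d := fun i => lt_of_le_of_lt (hb i) (ha i)
    have := hsd m _ _ (E_supp m b hb') (fun l hl => hl.1)
    refine Finsupp.supported_mono ?_ this
    rintro l' ⟨l, ⟨-, hl⟩, h⟩ v hv
    exact hl.hull (h v hv)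
  · intro q hq i v hv
    simp only [L', List.mem_map] at hq
    obtain ⟨q0, hq0, rfl⟩ := hq
    exact tau_T _ _ i v hv (heq q0 hq0 i v hv)

theorem BU' (L : List ((Fin 3 → ZMod 2) × (VV d → ℝ)))
    (hcont : ∀ q ∈ L, ContinuousOn q.2 SS)
    (heq : ∀ q ∈ L, ∀ i, ∀ v ∈ SS, q.2 (TT i v) = (if q.1 i = 0 then 1 else -1) * q.2 v)
    (hc : (L.map (fun q => lin q.1)).prod ∉ Ideal.span
      {(MvPolynomial.X 0 : MvPolynomial (Fin 3) (ZMod 2)) ^ d, MvPolynomial.X 1 ^ d,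
        MvPolynomial.X 2 ^ d}) :
    ∃ v ∈ (SS : Set (VV d)), ∀ q ∈ L, q.2 v = 0 := by
  set P := (L.map (fun q => lin q.1)).prod with hP
  by_contra hcon
  apply hc
  rw [P.as_sum]
  apply Ideal.sum_mem
  intro a ha
  have hz : ¬ ∀ i, a i < d := by
    intro h
    exact hcon (BU L hcont heq a h (MvPolynomial.mem_support_iff.1 ha))
  push Not at hz
  obtain ⟨i, hi⟩ := hz
  have hmem : (MvPolynomial.X i : MvPolynomial (Fin 3) (ZMod 2)) ^ d ∈ Ideal.span
      {(MvPolynomial.X 0 : MvPolynomial (Fin 3) (ZMod 2)) ^ d, MvPolynomial.X 1 ^ d,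
        MvPolynomial.X 2 ^ d} := by
    apply Ideal.subset_span
    fin_cases i <;> simp
  refine Ideal.mem_of_dvd _ ?_ hmem
  rw [MvPolynomial.X_pow_eq_monomial]
  rw [MvPolynomial.monomial_dvd_monomial]
  refine ⟨Or.inr ?_, by simp⟩
  intro j
  by_cases h : i = j
  · subst h; simpa using hi
  · simp [h]

end sphere
end BUx


namespace BUx

section meas
variable {d : ℕ}

abbrev EE (d : ℕ) := EuclideanSpace ℝ (Fin d)

lemma measurable_rsign : Measurable Real.sign := by
  unfold Real.sign
  exact Measurable.ite measurableSet_Iio measurable_const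
    (Measurable.ite measurableSet_Ioi measurable_const measurable_const)

lemma abs_rsign (r : ℝ) : |Real.sign r| ≤ 1 := by
  rcases Real.sign_apply_eq r with h | h | h <;> simp [h]

lemma contAt_rsign {r : ℝ} (hr : r ≠ 0) : ContinuousAt Real.sign r := by
  rcases lt_or_gt_of_ne hr with h | h
  · have : Real.sign =ᶠ[nhds r] fun _ => -1 := by
      filter_upwards [gt_mem_nhds h] with x hx using Real.sign_of_neg hx
    exact continuousAt_const.congr this.symm
  · have : Real.sign =ᶠ[nhds r] fun _ => 1 := by
      filter_upwards [lt_mem_nhds h] with x hx using Real.sign_of_pos hx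
    exact continuousAt_const.congr this.symm

lemma rsign_mono : Monotone Real.sign := by
  intro a b hab
  rcases lt_trichotomy a 0 with ha | ha | ha
  · rw [Real.sign_of_neg ha]; have := abs_le.1 (abs_rsign b); linarith
  · subst ha
    rcases hab.eq_or_lt with h | h
    · rw [← h]
    · rw [Real.sign_of_pos h, Real.sign_zero]; norm_num
  · rw [Real.sign_of_pos ha, Real.sign_of_pos (ha.trans_le hab)]

/-- The half-space indicator. -/
noncomputable def hh (u : EE d) (t : ℝ) (x : EE d) : ℝ := (1 - Real.sign (inner ℝ x u - t)) / 2

lemma hh_meas (u : EE d) (t : ℝ) : Measurable (hh u t) := by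
  unfold hh
  have : Measurable fun x : EE d => (inner ℝ x u - t : ℝ) :=
    (by fun_prop : Continuous fun x : EE d => (inner ℝ x u - t : ℝ)).measurable
  exact ((measurable_const.sub (measurable_rsign.comp this))).div_const 2

lemma hh_abs (u : EE d) (t : ℝ) (x : EE d) : |hh u t x| ≤ 1 := by
  have := abs_le.1 (abs_rsign (inner ℝ x u - t))
  rw [abs_le]; unfold hh; constructor <;> linarith

lemma hh_neg (u : EE d) (t : ℝ) (x : EE d) : hh (-u) (-t) x = 1 - hh u t x := by
  unfold hh
  rw [inner_neg_right, show (-inner ℝ x u - -t : ℝ) = -(inner ℝ x u - t) by ring, Real.sign_neg]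
  ring

variable (μ : Measure (EE d)) [IsFiniteMeasure μ]

lemma bdd_int {F : EE d → ℝ} (hm : Measurable F) (C : ℝ) (hb : ∀ x, |F x| ≤ C) : Integrable F μ :=
  Integrable.of_bound hm.aestronglyMeasurable C (Filter.Eventually.of_forall hb)

lemma cont_int {Y : Type*} [TopologicalSpace Y] [FirstCountableTopology Y] (F : Y → EE d → ℝ)
    (y0 : Y) (C : ℝ) (hm : ∀ y, Measurable (F y)) (hb : ∀ y x, |F y x| ≤ C)
    (hc : ∀ᵐ x ∂μ, ContinuousAt (fun y => F y x) y0) :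
    ContinuousAt (fun y => ∫ x, F y x ∂μ) y0 := by
  refine continuousAt_of_dominated (bound := fun _ => C) ?_ ?_ (integrable_const C) hc
  · exact Filter.Eventually.of_forall fun y => (hm y).aestronglyMeasurable
  · exact Filter.Eventually.of_forall fun y => Filter.Eventually.of_forall fun x => hb y x

noncomputable def gg (u : EE d) (t : ℝ) : ℝ := ∫ x, hh u t x ∂μ

lemma gg_neg (u : EE d) (t : ℝ) : gg μ (-u) (-t) = μ.real Set.univ - gg μ u t := by
  unfold gg
  simp only [hh_neg]
  rw [integral_sub (integrable_const _) (bdd_int μ (hh_meas u t) 1 (hh_abs u t))]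
  simp

variable (hpl : ∀ u : EE d, u ≠ 0 → ∀ t : ℝ, μ {x | inner ℝ x u = t} = 0)
  (hpos : ∀ U : Set (EE d), IsOpen U → U.Nonempty → 0 < μ U)

include hpl in
lemma ae_ne {u : EE d} (hu : u ≠ 0) (t : ℝ) : ∀ᵐ x ∂μ, (inner ℝ x u : ℝ) - t ≠ 0 := by
  rw [ae_iff]
  have : {x : EE d | ¬ ((inner ℝ x u : ℝ) - t ≠ 0)} = {x | inner ℝ x u = t} := by
    ext x; simp [sub_eq_zero]
  rw [this]; exact hpl u hu t

include hpl in
lemma ae_hh {Y : Type*} [TopologicalSpace Y] (y0 : Y) (u : Y → EE d) (t : Y → ℝ) (h0 : u y0 ≠ 0)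
    (hu : ContinuousAt u y0) (ht : ContinuousAt t y0) :
    ∀ᵐ x ∂μ, ContinuousAt (fun y => Real.sign (inner ℝ x (u y) - t y)) y0 := by
  filter_upwards [ae_ne μ hpl h0 (t y0)] with x hx
  have h1 : ContinuousAt (fun y => (inner ℝ x (u y) - t y : ℝ)) y0 :=
    (ContinuousAt.inner continuousAt_const hu).sub ht
  exact ContinuousAt.comp (g := Real.sign) (contAt_rsign hx) h1

include hpl in
lemma gg_cont {Y : Type*} [TopologicalSpace Y] [FirstCountableTopology Y] (y0 : Y) (u : Y → EE d)
    (t : Y → ℝ) (h0 : u y0 ≠ 0)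
    (hu : ContinuousAt u y0) (ht : ContinuousAt t y0) :
    ContinuousAt (fun y => gg μ (u y) (t y)) y0 := by
  refine cont_int μ _ y0 1 (fun y => hh_meas _ _) (fun y x => hh_abs _ _ _) ?_
  filter_upwards [ae_hh μ hpl y0 u t h0 hu ht] with x hx
  exact (continuousAt_const.sub hx).div_const 2

lemma exists_between {u : EE d} (hu : u ≠ 0) (t : ℝ) : ∃ x : EE d, inner ℝ x u = t := by
  refine ⟨(t / ‖u‖ ^ 2) • u, ?_⟩
  rw [real_inner_smul_left, real_inner_self_eq_norm_sq]
  have : ‖u‖ ≠ 0 := by simpa using hu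
  field_simp

include hpos in
lemma gg_strictMono {u : EE d} (hu : u ≠ 0) : StrictMono (gg μ u) := by
  intro t t' htt
  have hi := bdd_int μ (hh_meas u t) 1 (hh_abs u t)
  have hi' := bdd_int μ (hh_meas u t') 1 (hh_abs u t')
  have : 0 < ∫ x, (hh u t' - hh u t) x ∂μ := by
    rw [integral_pos_iff_support_of_nonneg _ (hi'.sub hi)]
    · refine lt_of_lt_of_le (hpos {x | t < inner ℝ x u ∧ inner ℝ x u < t'} ?_ ?_) (measure_mono ?_)
      · have hA : IsOpen {x : EE d | t < inner ℝ x u} := isOpen_lt (by fun_prop) (by fun_prop)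
        have hB : IsOpen {x : EE d | inner ℝ x u < t'} := isOpen_lt (by fun_prop) (by fun_prop)
        exact hA.inter hB
      · obtain ⟨x, hx⟩ := exists_between hu ((t + t') / 2)
        exact ⟨x, by rw [Set.mem_ofPred_eq, hx]; constructor <;> linarith⟩
      · rintro x ⟨h1, h2⟩
        rw [Function.mem_support]
        simp only [Pi.sub_apply, hh]
        rw [Real.sign_of_pos (sub_pos.2 h1), Real.sign_of_neg (sub_neg.2 h2)]
        norm_num
    · intro x
      have := rsign_mono (show (inner ℝ x u - t' : ℝ) ≤ inner ℝ x u - t by linarith)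
      simp only [Pi.zero_apply, Pi.sub_apply, hh]
      linarith
  rw [integral_sub' hi' hi] at this
  unfold gg; linarith

lemma gg_top (u : EE d) : Filter.Tendsto (gg μ u) Filter.atTop (nhds (μ.real Set.univ)) := by
  have : μ.real Set.univ = ∫ _, (1 : ℝ) ∂μ := by simp
  rw [this]
  unfold gg
  refine tendsto_integral_filter_of_dominated_convergence (fun _ => 1) ?_ ?_ (integrable_const 1) ?_
  · exact Filter.Eventually.of_forall fun t => (hh_meas u t).aestronglyMeasurable
  · exact Filter.Eventually.of_forall fun t => Filter.Eventually.of_forall fun x => hh_abs u t x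
  · refine Filter.Eventually.of_forall fun x => ?_
    apply tendsto_nhds_of_eventually_eq
    filter_upwards [Filter.eventually_gt_atTop (inner ℝ x u)] with t ht
    unfold hh
    rw [Real.sign_of_neg (sub_neg.2 ht)]; norm_num

lemma gg_bot (u : EE d) : Filter.Tendsto (gg μ u) Filter.atBot (nhds 0) := by
  have h := (gg_top μ (-u)).comp Filter.tendsto_neg_atBot_atTop
  have h2 : gg μ u = fun t => μ.real Set.univ - (gg μ (-u) ∘ Neg.neg) t := by
    funext t
    simp [gg_neg]
  rw [h2]
  have := h.const_sub (μ.real Set.univ)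
  simpa using this

include hpl in
lemma exists_q {u : EE d} (hu : u ≠ 0) {c : ℝ} (h0 : 0 < c) (h1 : c < μ.real Set.univ) :
    ∃ t, gg μ u t = c := by
  have hc : Continuous (gg μ u) := continuous_iff_continuousAt.2 fun t =>
    gg_cont μ hpl t (fun _ => u) id hu continuousAt_const continuousAt_id
  obtain ⟨a, ha⟩ := ((gg_bot μ u).eventually (gt_mem_nhds h0)).exists
  obtain ⟨b, hb⟩ := ((gg_top μ u).eventually (lt_mem_nhds h1)).exists
  exact mem_range_of_exists_le_of_exists_ge hc ⟨a, ha.le⟩ ⟨b, hb.le⟩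

open Classical in
noncomputable def qq (c : ℝ) (u : EE d) : ℝ := if h : ∃ t, gg μ u t = c then h.choose else 0

include hpl in
lemma gg_qq {u : EE d} (hu : u ≠ 0) {c : ℝ} (h0 : 0 < c) (h1 : c < μ.real Set.univ) :
    gg μ u (qq μ c u) = c := by
  have h := exists_q μ hpl hu h0 h1
  unfold qq
  rw [dif_pos h]
  exact h.choose_spec

include hpl hpos in
lemma qq_cont {u : EE d} (hu : u ≠ 0) {c : ℝ} (h0 : 0 < c) (h1 : c < μ.real Set.univ) :
    ContinuousAt (qq μ c) u := by
  have hne : ∀ᶠ v in nhds u, v ≠ 0 := isOpen_ne.mem_nhds hu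
  have hg := gg_qq μ hpl hu h0 h1
  refine tendsto_order.2 ⟨fun a ha => ?_, fun a ha => ?_⟩
  · have h2 : gg μ u a < c := by rw [← hg]; exact gg_strictMono μ hpos hu ha
    have h3 := gg_cont μ hpl u id (fun _ => a) hu continuousAt_id continuousAt_const
    filter_upwards [hne, h3.eventually (gt_mem_nhds h2)] with v hv hv2
    rw [← gg_qq μ hpl hv h0 h1] at hv2
    exact (gg_strictMono μ hpos hv).lt_iff_lt.1 hv2
  · have h2 : c < gg μ u a := by
      conv_lhs => rw [← hg]
      exact gg_strictMono μ hpos hu ha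
    have h3 := gg_cont μ hpl u id (fun _ => a) hu continuousAt_id continuousAt_const
    filter_upwards [hne, h3.eventually (lt_mem_nhds h2)] with v hv hv2
    rw [← gg_qq μ hpl hv h0 h1] at hv2
    exact (gg_strictMono μ hpos hv).lt_iff_lt.1 hv2

include hpl hpos in
lemma qq_neg {u : EE d} (hu : u ≠ 0) {c : ℝ} (h0 : 0 < c) (h1 : c < μ.real Set.univ) :
    qq μ (μ.real Set.univ - c) (-u) = - qq μ c u := by
  have hu' : -u ≠ 0 := neg_ne_zero.2 hu
  apply (gg_strictMono μ hpos hu').injective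
  rw [gg_neg, gg_qq μ hpl hu h0 h1, gg_qq μ hpl hu' (by linarith) (by linarith)]

end meas
end BUx

namespace BUx

section fin
variable {d : ℕ} (μ : Measure (EE d)) [IsFiniteMeasure μ] (k : ℕ)

noncomputable def cc (j : ℕ) : ℝ := j * μ.real Set.univ / (2 * k + 2)

noncomputable def tq (j : ℕ) (u : EE d) : ℝ := qq μ (cc μ k j) u

noncomputable def LL (j : ℕ) (u x : EE d) : ℝ :=
  if j = 0 then 0 else if j = 2 * k + 2 then 1 else hh u (tq μ k j u) x

noncomputable def chi (v x : EE d) : ℝ := Real.sign (inner ℝ x v - tq μ k (k + 1) v)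

noncomputable def integrand (i α β : ℕ) (u v w x : EE d) : ℝ :=
  (LL μ k (i + 1) u x - LL μ k i u x) * chi μ k v x ^ α * chi μ k w x ^ β

noncomputable def FF (i α β : ℕ) (u v w : EE d) : ℝ := ∫ x, integrand μ k i α β u v w x ∂μ

lemma LL_meas (j : ℕ) (u : EE d) : Measurable (LL μ k j u) := by
  unfold LL
  split_ifs
  · exact measurable_const
  · exact measurable_const
  · exact hh_meas _ _

lemma LL_abs (j : ℕ) (u x : EE d) : |LL μ k j u x| ≤ 1 := by
  unfold LL
  split_ifs
  · simp
  · simp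
  · exact hh_abs _ _ _

lemma chi_meas (v : EE d) : Measurable (chi μ k v) := by
  unfold chi
  have : Measurable fun x : EE d => (inner ℝ x v - tq μ k (k + 1) v : ℝ) :=
    (by fun_prop : Continuous fun x : EE d => (inner ℝ x v - tq μ k (k + 1) v : ℝ)).measurable
  exact measurable_rsign.comp this

lemma chi_pow_abs (v x : EE d) (α : ℕ) : |chi μ k v x ^ α| ≤ 1 := by
  rw [abs_pow]
  exact pow_le_one₀ (abs_nonneg _) (abs_rsign _)

lemma integrand_meas (i α β : ℕ) (u v w : EE d) : Measurable (integrand μ k i α β u v w) := by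
  unfold integrand
  exact (((LL_meas μ k _ u).sub (LL_meas μ k _ u)).mul ((chi_meas μ k v).pow_const α)).mul
    ((chi_meas μ k w).pow_const β)

lemma integrand_abs (i α β : ℕ) (u v w x : EE d) : |integrand μ k i α β u v w x| ≤ 2 := by
  unfold integrand
  rw [abs_mul, abs_mul]
  have h1 : |LL μ k (i + 1) u x - LL μ k i u x| ≤ 2 :=
    (abs_sub _ _).trans (by linarith [LL_abs μ k (i + 1) u x, LL_abs μ k i u x])
  calc _ ≤ 2 * 1 * (1 : ℝ) := by
        gcongr
        · exact chi_pow_abs μ k v x α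
        · exact chi_pow_abs μ k w x β
    _ = 2 := by norm_num

lemma integrand_int (i α β : ℕ) (u v w : EE d) : Integrable (integrand μ k i α β u v w) μ :=
  bdd_int μ (integrand_meas μ k i α β u v w) 2 (integrand_abs μ k i α β u v w)

variable (hM : 0 < μ.real Set.univ)

include hM in
lemma cc_mem {j : ℕ} (h1 : 1 ≤ j) (h2 : j ≤ 2 * k + 1) :
    0 < cc μ k j ∧ cc μ k j < μ.real Set.univ := by
  have h1' : (1 : ℝ) ≤ j := by exact_mod_cast h1
  have h2' : (j : ℝ) ≤ 2 * k + 1 := by exact_mod_cast h2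
  unfold cc
  constructor
  · positivity
  · rw [div_lt_iff₀ (by positivity)]
    nlinarith

lemma cc_sub {j : ℕ} (h2 : j ≤ 2 * k + 2) :
    μ.real Set.univ - cc μ k j = cc μ k (2 * k + 2 - j) := by
  unfold cc
  rw [Nat.cast_sub h2]
  push_cast
  field_simp

variable (hpl : ∀ u : EE d, u ≠ 0 → ∀ t : ℝ, μ {x | inner ℝ x u = t} = 0)
  (hpos : ∀ U : Set (EE d), IsOpen U → U.Nonempty → 0 < μ U)

include hM hpl hpos

lemma tq_neg {u : EE d} (hu : u ≠ 0) {j : ℕ} (h1 : 1 ≤ j) (h2 : j ≤ 2 * k + 1) :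
    tq μ k j (-u) = - tq μ k (2 * k + 2 - j) u := by
  have h3 : 1 ≤ 2 * k + 2 - j := by omega
  have h4 : 2 * k + 2 - j ≤ 2 * k + 1 := by omega
  obtain ⟨ha, hb⟩ := cc_mem μ k hM h3 h4
  have := qq_neg μ hpl hpos hu ha hb
  rw [cc_sub μ k (by omega), show 2 * k + 2 - (2 * k + 2 - j) = j by omega] at this
  exact this

lemma LL_neg {u : EE d} (hu : u ≠ 0) {j : ℕ} (h2 : j ≤ 2 * k + 2) (x : EE d) :
    LL μ k j (-u) x = 1 - LL μ k (2 * k + 2 - j) u x := by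
  unfold LL
  by_cases h0 : j = 0
  · subst h0; simp
  by_cases h3 : j = 2 * k + 2
  · subst h3; simp
  rw [if_neg h0, if_neg h3, if_neg (by omega), if_neg (by omega),
    tq_neg μ k hM hpl hpos hu (by omega) (by omega), hh_neg]

lemma FF_neg_u {u : EE d} (hu : u ≠ 0) (v w : EE d) (i α β : ℕ) (hi : i ≤ 2 * k + 1) :
    FF μ k i α β (-u) v w = FF μ k (2 * k + 1 - i) α β u v w := by
  unfold FF
  congr 1
  funext x
  unfold integrand
  rw [LL_neg μ k hM hpl hpos hu (by omega), LL_neg μ k hM hpl hpos hu (by omega),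
    show 2 * k + 2 - (i + 1) = 2 * k + 1 - i by omega,
    show 2 * k + 2 - i = 2 * k + 1 - i + 1 by omega]
  ring

lemma chi_neg {v : EE d} (hv : v ≠ 0) (x : EE d) : chi μ k (-v) x = - chi μ k v x := by
  unfold chi
  rw [tq_neg μ k hM hpl hpos hv (by omega) (by omega), inner_neg_right,
    show 2 * k + 2 - (k + 1) = k + 1 by omega, ← Real.sign_neg]
  congr 1; ring

lemma FF_neg_v {v : EE d} (hv : v ≠ 0) (u w : EE d) (i α β : ℕ) :
    FF μ k i α β u (-v) w = (-1) ^ α * FF μ k i α β u v w := by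
  unfold FF
  rw [← integral_const_mul]
  congr 1
  funext x
  unfold integrand
  rw [chi_neg μ k hM hpl hpos hv, neg_pow]
  ring

lemma FF_neg_w {w : EE d} (hw : w ≠ 0) (u v : EE d) (i α β : ℕ) :
    FF μ k i α β u v (-w) = (-1) ^ β * FF μ k i α β u v w := by
  unfold FF
  rw [← integral_const_mul]
  congr 1
  funext x
  unfold integrand
  rw [chi_neg μ k hM hpl hpos hw, neg_pow]
  ring

lemma tq_cont {u : EE d} (hu : u ≠ 0) {j : ℕ} (h1 : 1 ≤ j) (h2 : j ≤ 2 * k + 1) :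
    ContinuousAt (tq μ k j) u :=
  qq_cont μ hpl hpos hu (cc_mem μ k hM h1 h2).1 (cc_mem μ k hM h1 h2).2

lemma LL_ae {Y : Type*} [TopologicalSpace Y] (y0 : Y) (u : Y → EE d) (h0 : u y0 ≠ 0)
    (hu : ContinuousAt u y0) (j : ℕ) (hj : j ≤ 2 * k + 2) :
    ∀ᵐ x ∂μ, ContinuousAt (fun y => LL μ k j (u y) x) y0 := by
  unfold LL
  split_ifs with h1 h2
  · exact Filter.Eventually.of_forall fun _ => continuousAt_const
  · exact Filter.Eventually.of_forall fun _ => continuousAt_const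
  · have ht : ContinuousAt (fun y => tq μ k j (u y)) y0 :=
      ContinuousAt.comp (g := tq μ k j) (tq_cont μ k hM hpl hpos h0 (by omega) (by omega)) hu
    filter_upwards [ae_hh μ hpl y0 u _ h0 hu ht] with x hx
    exact (continuousAt_const.sub hx).div_const 2

lemma chi_ae {Y : Type*} [TopologicalSpace Y] (y0 : Y) (u : Y → EE d) (h0 : u y0 ≠ 0)
    (hu : ContinuousAt u y0) :
    ∀ᵐ x ∂μ, ContinuousAt (fun y => chi μ k (u y) x) y0 := by
  have ht : ContinuousAt (fun y => tq μ k (k + 1) (u y)) y0 :=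
    ContinuousAt.comp (g := tq μ k (k + 1)) (tq_cont μ k hM hpl hpos h0 (by omega) (by omega)) hu
  exact ae_hh μ hpl y0 u _ h0 hu ht

lemma FF_cont {Y : Type*} [TopologicalSpace Y] [FirstCountableTopology Y] (y0 : Y)
    (u v w : Y → EE d) (hu0 : u y0 ≠ 0) (hv0 : v y0 ≠ 0) (hw0 : w y0 ≠ 0)
    (hu : ContinuousAt u y0) (hv : ContinuousAt v y0) (hw : ContinuousAt w y0)
    (i α β : ℕ) (hi : i ≤ 2 * k + 1) :
    ContinuousAt (fun y => FF μ k i α β (u y) (v y) (w y)) y0 := by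
  refine cont_int μ _ y0 2 (fun y => integrand_meas μ k _ _ _ _ _ _)
    (fun y x => integrand_abs μ k _ _ _ _ _ _ _) ?_
  filter_upwards [LL_ae μ k hM hpl hpos y0 u hu0 hu (i + 1) (by omega),
    LL_ae μ k hM hpl hpos y0 u hu0 hu i (by omega), chi_ae μ k hM hpl hpos y0 v hv0 hv,
    chi_ae μ k hM hpl hpos y0 w hw0 hw] with x h1 h2 h3 h4
  exact ((h1.sub h2).mul (h3.pow α)).mul (h4.pow β)

lemma gg_tq {u : EE d} (hu : u ≠ 0) {j : ℕ} (h1 : 1 ≤ j) (h2 : j ≤ 2 * k + 1) :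
    gg μ u (tq μ k j u) = cc μ k j :=
  gg_qq μ hpl hu (cc_mem μ k hM h1 h2).1 (cc_mem μ k hM h1 h2).2

lemma LL_integral {u : EE d} (hu : u ≠ 0) {j : ℕ} (hj : j ≤ 2 * k + 2) :
    ∫ x, LL μ k j u x ∂μ = cc μ k j := by
  unfold LL
  split_ifs with h1 h2
  · subst h1; simp [cc]
  · subst h2
    simp only [cc]; push_cast; simp; field_simp
  · exact gg_tq μ k hM hpl hpos hu (by omega) (by omega)

lemma FF_zero {u : EE d} (hu : u ≠ 0) (v w : EE d) {i : ℕ} (hi : i ≤ 2 * k + 1) :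
    FF μ k i 0 0 u v w = μ.real Set.univ / (2 * k + 2) := by
  unfold FF integrand
  simp only [pow_zero, mul_one]
  rw [integral_sub (bdd_int μ (LL_meas μ k _ u) 1 (LL_abs μ k _ u))
    (bdd_int μ (LL_meas μ k _ u) 1 (LL_abs μ k _ u)),
    LL_integral μ k hM hpl hpos hu (by omega), LL_integral μ k hM hpl hpos hu (by omega)]
  unfold cc; push_cast; ring

lemma chi_integral {v : EE d} (hv : v ≠ 0) : ∫ x, chi μ k v x ∂μ = 0 := by
  have h := gg_tq μ k hM hpl hpos hv (j := k + 1) (by omega) (by omega)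
  have e : ∀ x, chi μ k v x = 1 - 2 * hh v (tq μ k (k + 1) v) x := by
    intro x; unfold chi hh; ring
  simp only [e]
  rw [integral_sub (integrable_const _)
    ((bdd_int μ (hh_meas v _) 1 (hh_abs v _)).const_mul 2), integral_const_mul]
  change _ - 2 * gg μ v (tq μ k (k + 1) v) = 0
  rw [h]; simp [cc]; field_simp; ring

omit hM hpl hpos in
lemma FF_sum (u v w : EE d) (α β : ℕ) :
    ∑ i ∈ Finset.range (2 * k + 2), FF μ k i α β u v w =
      ∫ x, chi μ k v x ^ α * chi μ k w x ^ β ∂μ := by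
  unfold FF
  rw [← integral_finsetSum _ (fun i _ => integrand_int μ k i α β u v w)]
  congr 1
  funext x
  unfold integrand
  rw [← Finset.sum_mul, ← Finset.sum_mul, Finset.sum_range_sub (fun i => LL μ k i u x)]
  simp [LL]

lemma tq_lt {u : EE d} (hu : u ≠ 0) {i j : ℕ} (h1 : 1 ≤ i) (hij : i < j) (h2 : j ≤ 2 * k + 1) :
    tq μ k i u < tq μ k j u := by
  apply (gg_strictMono μ hpos hu).lt_iff_lt.1
  rw [gg_tq μ k hM hpl hpos hu h1 (by omega), gg_tq μ k hM hpl hpos hu (by omega) h2]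
  unfold cc
  have : (i : ℝ) < j := by exact_mod_cast hij
  gcongr

omit hM hpl hpos in
lemma hh_eq (u : EE d) (t : ℝ) (x : EE d) (h : (inner ℝ x u : ℝ) - t ≠ 0) :
    hh u t x = if (inner ℝ x u : ℝ) < t then 1 else 0 := by
  unfold hh
  split_ifs with h1
  · rw [Real.sign_of_neg (sub_neg.2 h1)]; norm_num
  · rw [Real.sign_of_pos (lt_of_le_of_ne (sub_nonneg.2 (not_lt.1 h1)) h.symm)]; norm_num

open Classical in
lemma slab_ind {u : EE d} (hu : u ≠ 0) {i : ℕ} (hi : i ≤ 2 * k + 1) (x : EE d)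
    (hx : ∀ j, (inner ℝ x u : ℝ) - tq μ k j u ≠ 0) :
    LL μ k (i + 1) u x - LL μ k i u x =
      if x ∈ slab u (fun j => tq μ k j u) (2 * k + 1) i then 1 else 0 := by
  unfold LL slab
  rw [hh_eq _ _ _ (hx _), hh_eq _ _ _ (hx _)]
  have hne : ∀ j, (inner ℝ x u : ℝ) ≠ tq μ k j u := fun j => sub_ne_zero.1 (hx j)
  by_cases h0 : i = 0
  · subst h0
    simp
  · have hi1 : 1 ≤ i := by omega
    by_cases h1 : i = 2 * k + 1
    · subst h1
      rcases lt_or_gt_of_ne (hne (2 * k + 1)) with h | h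
      · simp [h, h.not_gt]
      · simp [h, h.not_gt]
    · have hlt := tq_lt μ k hM hpl hpos hu hi1 (Nat.lt_succ_self i) (by omega)
      have e1 : ¬ i + 1 = 2 * k + 2 := by omega
      have e2 : ¬ i = 2 * k + 2 := by omega
      have e3 : i + 1 ≤ 2 * k + 1 := by omega
      simp only [h0, e1, e2, e3, hi1, Nat.add_eq_zero_iff, one_ne_zero, and_false, if_false,
        Set.mem_ofPred_eq, forall_const]
      simp only [Nat.succ_eq_add_one] at hlt
      rcases lt_or_gt_of_ne (hne i) with h | h <;> rcases lt_or_gt_of_ne (hne (i + 1)) with h' | h'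
      · simp [h, h', h.not_gt]
      · linarith
      · simp [h, h', h.not_gt]
      · simp [h, h'.not_gt, h.not_gt]

open Classical in
omit hM hpl hpos in
lemma half_ind (v x : EE d) (b : Bool) (hx : (inner ℝ x v : ℝ) - tq μ k (k + 1) v ≠ 0) :
    (1 + (if b then -1 else 1) * chi μ k v x) / 2 =
      if x ∈ halfSp v (tq μ k (k + 1) v) b then 1 else 0 := by
  unfold chi halfSp
  rcases lt_or_gt_of_ne hx with h | h
  · have h' := sub_neg.1 h
    rw [Real.sign_of_neg h]
    cases b <;> simp [h', h'.not_gt] <;> norm_num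
  · have h' := sub_pos.1 h
    rw [Real.sign_of_pos h]
    cases b <;> simp [h', h'.not_gt] <;> norm_num

omit hM hpl hpos [IsFiniteMeasure μ] in
lemma box_meas (u v w : EE d) (t : ℕ → ℝ) (n i : ℕ) (s₁ s₂ : ℝ) (b₁ b₂ : Bool) :
    MeasurableSet (slab u t n i ∩ halfSp v s₁ b₁ ∩ halfSp w s₂ b₂) := by
  have hs : ∀ (v : EE d) s b, MeasurableSet (halfSp v s b) := by
    intro v s b
    unfold halfSp
    split_ifs
    · exact (isOpen_lt (by fun_prop) (by fun_prop)).measurableSet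
    · exact (isOpen_lt (by fun_prop) (by fun_prop)).measurableSet
  refine (MeasurableSet.inter ?_ (hs v s₁ b₁)).inter (hs w s₂ b₂)
  have : slab u t n i = {x | 1 ≤ i → t i < (inner ℝ x u : ℝ)} ∩
    {x | i + 1 ≤ n → (inner ℝ x u : ℝ) < t (i + 1)} := rfl
  rw [this]
  apply MeasurableSet.inter
  · by_cases h : 1 ≤ i
    · simp only [h, forall_const]
      exact (isOpen_lt (by fun_prop) (by fun_prop)).measurableSet
    · simp [h]
  · by_cases h : i + 1 ≤ n
    · simp only [h, forall_const]
      exact (isOpen_lt (by fun_prop) (by fun_prop)).measurableSet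
    · simp [h]

lemma box_val {u v w : EE d} (hu : u ≠ 0) (hv : v ≠ 0) (hw : w ≠ 0) {i : ℕ} (hi : i ≤ 2 * k + 1)
    (h10 : FF μ k i 1 0 u v w = 0) (h01 : FF μ k i 0 1 u v w = 0) (h11 : FF μ k i 1 1 u v w = 0)
    (b₁ b₂ : Bool) :
    μ.real (slab u (fun j => tq μ k j u) (2 * k + 1) i ∩ halfSp v (tq μ k (k + 1) v) b₁ ∩
      halfSp w (tq μ k (k + 1) w) b₂) = μ.real Set.univ / (4 * (2 * k + 2)) := by
  classical
  rw [← integral_indicator_one (box_meas _ _ _ _ _ _ _ _ _ _)]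
  set σ₁ : ℝ := if b₁ then -1 else 1 with hσ₁
  set σ₂ : ℝ := if b₂ then -1 else 1 with hσ₂
  have hae : ∀ᵐ x ∂μ, (slab u (fun j => tq μ k j u) (2 * k + 1) i ∩
      halfSp v (tq μ k (k + 1) v) b₁ ∩ halfSp w (tq μ k (k + 1) w) b₂).indicator
        (1 : EE d → ℝ) x =
      (1 / 4) * (integrand μ k i 0 0 u v w x + σ₁ * integrand μ k i 1 0 u v w x +
        σ₂ * integrand μ k i 0 1 u v w x + σ₁ * σ₂ * integrand μ k i 1 1 u v w x) := by
    filter_upwards [ae_all_iff.2 fun j => ae_ne μ hpl hu (tq μ k j u),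
      ae_ne μ hpl hv (tq μ k (k + 1) v), ae_ne μ hpl hw (tq μ k (k + 1) w)] with x h1 h2 h3
    have e1 := slab_ind μ k hM hpl hpos hu hi x h1
    have e2 := half_ind μ k v x b₁ h2
    have e3 := half_ind μ k w x b₂ h3
    rw [← hσ₁] at e2
    rw [← hσ₂] at e3
    have : (1 / 4) * (integrand μ k i 0 0 u v w x + σ₁ * integrand μ k i 1 0 u v w x +
        σ₂ * integrand μ k i 0 1 u v w x + σ₁ * σ₂ * integrand μ k i 1 1 u v w x) =
        (LL μ k (i + 1) u x - LL μ k i u x) * ((1 + σ₁ * chi μ k v x) / 2) *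
          ((1 + σ₂ * chi μ k w x) / 2) := by
      unfold integrand; ring
    rw [this, e1, e2, e3, Set.indicator_apply]
    simp only [Set.mem_inter_iff, Pi.one_apply]
    split_ifs <;> simp_all
  rw [integral_congr_ae hae, integral_const_mul]
  have I := fun α β => integrand_int μ k i α β u v w
  have I1 : Integrable (fun x => integrand μ k i 0 0 u v w x + σ₁ * integrand μ k i 1 0 u v w x) μ :=
    (I 0 0).add ((I 1 0).const_mul σ₁)
  have I2 : Integrable (fun x => integrand μ k i 0 0 u v w x + σ₁ * integrand μ k i 1 0 u v w x +
      σ₂ * integrand μ k i 0 1 u v w x) μ := I1.add ((I 0 1).const_mul σ₂)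
  rw [integral_add I2 ((I 1 1).const_mul _), integral_add I1 ((I 0 1).const_mul σ₂),
    integral_add (I 0 0) ((I 1 0).const_mul σ₁), integral_const_mul, integral_const_mul,
    integral_const_mul]
  change (1 / 4) * (FF μ k i 0 0 u v w + σ₁ * FF μ k i 1 0 u v w + σ₂ * FF μ k i 0 1 u v w
    + σ₁ * σ₂ * FF μ k i 1 1 u v w) = _
  rw [h10, h01, h11, FF_zero μ k hM hpl hpos hu v w hi]
  field_simp
  ring

end fin

/-- deduce vanishing of all the slab integrals -/
lemma all_zero_aux (Φ : ℕ → ℝ) (k : ℕ) (he : ∀ i < k, Φ i + Φ (2 * k + 1 - i) = 0)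
    (ho : ∀ i < k + 1, Φ i - Φ (2 * k + 1 - i) = 0)
    (hk : Φ k + Φ (2 * k + 1 - k) = 0) : ∀ i ≤ 2 * k + 1, Φ i = 0 := by
  have h1 : ∀ i ≤ k, Φ i = 0 ∧ Φ (2 * k + 1 - i) = 0 := by
    intro i hi
    have := ho i (by omega)
    rcases hi.eq_or_lt with rfl | h
    · constructor <;> linarith
    · have := he i h
      constructor <;> linarith
  intro i hi
  by_cases h : i ≤ k
  · exact (h1 i h).1
  · have := (h1 (2 * k + 1 - i) (by omega)).2
    rwa [show 2 * k + 1 - (2 * k + 1 - i) = i by omega] at this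

lemma all_zero_sum (Φ : ℕ → ℝ) (k : ℕ) (he : ∀ i < k, Φ i + Φ (2 * k + 1 - i) = 0)
    (hs : ∑ i ∈ Finset.range (2 * k + 2), Φ i = 0) : Φ k + Φ (2 * k + 1 - k) = 0 := by
  have h1 : ∑ i ∈ Finset.range (2 * k + 2), Φ i
      = ∑ i ∈ Finset.range (k + 1), Φ i + ∑ i ∈ Finset.range (k + 1), Φ (2 * k + 1 - i) := by
    rw [show 2 * k + 2 = (k + 1) + (k + 1) by ring, Finset.sum_range_add]
    congr 1
    rw [← Finset.sum_range_reflect]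
    apply Finset.sum_congr rfl
    intro i hi
    rw [Finset.mem_range] at hi
    congr 1
    omega
  rw [h1, ← Finset.sum_add_distrib, Finset.sum_range_succ, Finset.sum_eq_zero, zero_add] at hs
  · exact hs
  · intro i hi; exact he i (Finset.mem_range.1 hi)

end BUx

namespace BUx

section final
variable {d : ℕ}

noncomputable def nz (x : EE d) : EE d := ‖x‖⁻¹ • x

lemma nz_norm {x : EE d} (hx : x ≠ 0) : ‖nz x‖ = 1 := by
  unfold nz
  rw [norm_smul, norm_inv, norm_norm]
  exact inv_mul_cancel₀ (by simpa using hx)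

lemma nz_ne {x : EE d} (hx : x ≠ 0) : nz x ≠ 0 := by
  intro h
  have := nz_norm hx
  rw [h, norm_zero] at this
  norm_num at this

lemma nz_neg (x : EE d) : nz (-x) = - nz x := by
  unfold nz; simp

lemma nz_cont {x : EE d} (hx : x ≠ 0) : ContinuousAt (nz (d := d)) x := by
  unfold nz
  exact (continuousAt_id.norm.inv₀ (by simpa using hx)).smul continuousAt_id

noncomputable def sg (c : ZMod 2) : ℝ := if c = 0 then 1 else -1

lemma sg_sq (c : ZMod 2) : sg c * sg c = 1 := by unfold sg; split_ifs <;> norm_num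

variable (μ : Measure (EE d)) [IsFiniteMeasure μ] (k : ℕ)

noncomputable def Phi (i α β : ℕ) (y : VV d) : ℝ :=
  FF μ k i α β (nz (y 0)) (nz (y 1)) (nz (y 2))

noncomputable def Pp (c : ZMod 2) (α β i : ℕ) (y : VV d) : ℝ :=
  Phi μ k i α β y + sg c * Phi μ k (2 * k + 1 - i) α β y

noncomputable def blk (c : ZMod 2) (α β m : ℕ) : List ((Fin 3 → ZMod 2) × (VV d → ℝ)) :=
  (List.range m).map fun i => (![c, (α : ZMod 2), (β : ZMod 2)], Pp μ k c α β i)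

lemma blk_prod (c : ZMod 2) (α β m : ℕ) :
    ((blk μ k c α β m).map (fun q => lin q.1)).prod =
      lin ![c, (α : ZMod 2), (β : ZMod 2)] ^ m := by
  unfold blk
  rw [List.map_map, List.prod_eq_pow_card (m := lin ![c, (α : ZMod 2), (β : ZMod 2)])]
  · simp
  · intro x hx
    obtain ⟨i, -, rfl⟩ := List.mem_map.1 hx
    rfl

variable (hM : 0 < μ.real Set.univ)
variable (hpl : ∀ u : EE d, u ≠ 0 → ∀ t : ℝ, μ {x | inner ℝ x u = t} = 0)
  (hpos : ∀ U : Set (EE d), IsOpen U → U.Nonempty → 0 < μ U)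

include hM hpl hpos

lemma Phi_cont (i α β : ℕ) (hi : i ≤ 2 * k + 1) : ContinuousOn (Phi μ k i α β) SS := by
  intro y hy
  apply ContinuousAt.continuousWithinAt
  have h : ∀ j, ContinuousAt (fun y : VV d => nz (y j)) y := fun j =>
    ContinuousAt.comp (g := nz) (nz_cont (hy j)) (continuous_apply j).continuousAt
  exact FF_cont μ k hM hpl hpos y (fun y => nz (y 0)) (fun y => nz (y 1)) (fun y => nz (y 2))
    (nz_ne (hy 0)) (nz_ne (hy 1)) (nz_ne (hy 2)) (h 0) (h 1) (h 2) i α β hi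

lemma Phi_T0 (i α β : ℕ) (hi : i ≤ 2 * k + 1) (y : VV d) (hy : y ∈ SS) :
    Phi μ k i α β (TT 0 y) = Phi μ k (2 * k + 1 - i) α β y := by
  unfold Phi
  rw [TT_apply', TT_apply', TT_apply', if_pos rfl, if_neg (by decide), if_neg (by decide), nz_neg,
    FF_neg_u μ k hM hpl hpos (nz_ne (hy 0)) _ _ _ _ _ hi]

lemma Phi_T1 (i α β : ℕ) (y : VV d) (hy : y ∈ SS) :
    Phi μ k i α β (TT 1 y) = (-1) ^ α * Phi μ k i α β y := by
  unfold Phi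
  rw [TT_apply', TT_apply', TT_apply', if_pos rfl, if_neg (by decide), if_neg (by decide), nz_neg,
    FF_neg_v μ k hM hpl hpos (nz_ne (hy 1))]

lemma Phi_T2 (i α β : ℕ) (y : VV d) (hy : y ∈ SS) :
    Phi μ k i α β (TT 2 y) = (-1) ^ β * Phi μ k i α β y := by
  unfold Phi
  rw [TT_apply', TT_apply', TT_apply', if_pos rfl, if_neg (by decide), if_neg (by decide), nz_neg,
    FF_neg_w μ k hM hpl hpos (nz_ne (hy 2))]

lemma blk_cont (c : ZMod 2) (α β m : ℕ) (hm : m ≤ k + 1) :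
    ∀ q ∈ blk μ k c α β m, ContinuousOn q.2 SS := by
  intro q hq
  obtain ⟨i, hi, rfl⟩ := List.mem_map.1 hq
  rw [List.mem_range] at hi
  exact (Phi_cont μ k hM hpl hpos i α β (by omega)).add
    (continuousOn_const.mul (Phi_cont μ k hM hpl hpos _ α β (by omega)))

lemma blk_eq (c : ZMod 2) (α β m : ℕ) (hm : m ≤ k + 1) (hα : sg (α : ZMod 2) = (-1) ^ α)
    (hβ : sg (β : ZMod 2) = (-1) ^ β) :
    ∀ q ∈ blk μ k c α β m, ∀ i, ∀ v ∈ SS,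
      q.2 (TT i v) = (if q.1 i = 0 then 1 else -1) * q.2 v := by
  intro q hq
  obtain ⟨i, hi, rfl⟩ := List.mem_map.1 hq
  rw [List.mem_range] at hi
  intro j v hv
  change Pp μ k c α β i (TT j v) = sg (![c, (α : ZMod 2), (β : ZMod 2)] j) * Pp μ k c α β i v
  unfold Pp
  fin_cases j
  · change Phi μ k i α β (TT 0 v) + sg c * Phi μ k (2 * k + 1 - i) α β (TT 0 v) = sg c * _
    rw [Phi_T0 μ k hM hpl hpos _ _ _ (by omega) v hv,
      Phi_T0 μ k hM hpl hpos _ _ _ (by omega) v hv,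
      show 2 * k + 1 - (2 * k + 1 - i) = i by omega]
    linear_combination (- Phi μ k (2 * k + 1 - i) α β v) * sg_sq c
  · change Phi μ k i α β (TT 1 v) + sg c * Phi μ k (2 * k + 1 - i) α β (TT 1 v) =
      sg (α : ZMod 2) * _
    rw [Phi_T1 μ k hM hpl hpos _ _ _ v hv, Phi_T1 μ k hM hpl hpos _ _ _ v hv, hα]
    ring
  · change Phi μ k i α β (TT 2 v) + sg c * Phi μ k (2 * k + 1 - i) α β (TT 2 v) =
      sg (β : ZMod 2) * _
    rw [Phi_T2 μ k hM hpl hpos _ _ _ v hv, Phi_T2 μ k hM hpl hpos _ _ _ v hv, hβ]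
    ring

open MvPolynomial in
lemma core (hQ : X 1 ^ k * X 2 ^ k *
        ((X 0 + X 1) * (X 0 + X 2) * (X 1 + X 2) * (X 0 + X 1 + X 2)) ^ (k + 1) ∉
      Ideal.span {(X 0 : MvPolynomial (Fin 3) (ZMod 2)) ^ d, X 1 ^ d, X 2 ^ d}) :
    ∃ u v w : EE d, ‖u‖ = 1 ∧ ‖v‖ = 1 ∧ ‖w‖ = 1 ∧ ∀ i ≤ 2 * k + 1,
      FF μ k i 1 0 u v w = 0 ∧ FF μ k i 0 1 u v w = 0 ∧ FF μ k i 1 1 u v w = 0 := by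
  have s0 : sg ((0 : ℕ) : ZMod 2) = (-1) ^ 0 := by simp [sg]
  have s1 : sg ((1 : ℕ) : ZMod 2) = (-1) ^ 1 := by simp [sg]
  have C := blk_cont μ k hM hpl hpos
  have Q := blk_eq μ k hM hpl hpos
  obtain ⟨y, hy, h⟩ := BU' (blk μ k 0 1 0 k ++ blk μ k 1 1 0 (k + 1) ++ blk μ k 0 0 1 k ++
      blk μ k 1 0 1 (k + 1) ++ blk μ k 0 1 1 (k + 1) ++ blk μ k 1 1 1 (k + 1)) (by
      intro q hq
      simp only [List.mem_append] at hq
      rcases hq with ((((hq | hq) | hq) | hq) | hq) | hq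
      · exact C _ _ _ _ (by omega) q hq
      · exact C _ _ _ _ (by omega) q hq
      · exact C _ _ _ _ (by omega) q hq
      · exact C _ _ _ _ (by omega) q hq
      · exact C _ _ _ _ (by omega) q hq
      · exact C _ _ _ _ (by omega) q hq) (by
      intro q hq
      simp only [List.mem_append] at hq
      rcases hq with ((((hq | hq) | hq) | hq) | hq) | hq
      · exact Q _ _ _ _ (by omega) s1 s0 q hq
      · exact Q _ _ _ _ (by omega) s1 s0 q hq
      · exact Q _ _ _ _ (by omega) s0 s1 q hq
      · exact Q _ _ _ _ (by omega) s0 s1 q hq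
      · exact Q _ _ _ _ (by omega) s1 s1 q hq
      · exact Q _ _ _ _ (by omega) s1 s1 q hq) (by
      simp only [List.map_append, List.prod_append, blk_prod]
      have e1 : lin ![0, ((1 : ℕ) : ZMod 2), ((0 : ℕ) : ZMod 2)] = X 1 := by
        simp [lin, Fin.sum_univ_three]
      have e2 : lin ![1, ((1 : ℕ) : ZMod 2), ((0 : ℕ) : ZMod 2)] = X 0 + X 1 := by
        simp [lin, Fin.sum_univ_three]
      have e3 : lin ![0, ((0 : ℕ) : ZMod 2), ((1 : ℕ) : ZMod 2)] = X 2 := by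
        simp [lin, Fin.sum_univ_three]
      have e4 : lin ![1, ((0 : ℕ) : ZMod 2), ((1 : ℕ) : ZMod 2)] = X 0 + X 2 := by
        simp [lin, Fin.sum_univ_three]
      have e5 : lin ![0, ((1 : ℕ) : ZMod 2), ((1 : ℕ) : ZMod 2)] = X 1 + X 2 := by
        simp [lin, Fin.sum_univ_three]
      have e6 : lin ![1, ((1 : ℕ) : ZMod 2), ((1 : ℕ) : ZMod 2)] = X 0 + X 1 + X 2 := by
        simp [lin, Fin.sum_univ_three]
      rw [e1, e2, e3, e4, e5, e6]
      have e : ∀ a b c d e f : MvPolynomial (Fin 3) (ZMod 2),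
          a ^ k * b ^ (k + 1) * c ^ k * d ^ (k + 1) * e ^ (k + 1) * f ^ (k + 1) =
          a ^ k * c ^ k * (b * d * e * f) ^ (k + 1) := by
        intro a b c d e f
        rw [mul_pow, mul_pow, mul_pow]
        ring
      rw [e]
      exact hQ)
  have key : ∀ (c : ZMod 2) (α β m : ℕ), (∀ q ∈ blk μ k c α β m, q.2 y = 0) →
      ∀ i < m, Phi μ k i α β y + sg c * Phi μ k (2 * k + 1 - i) α β y = 0 := by
    intro c α β m hq i hi
    exact hq (_, Pp μ k c α β i) (List.mem_map.2 ⟨i, List.mem_range.2 hi, rfl⟩)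
  have t0 : sg 0 = 1 := by simp [sg]
  have t1 : sg 1 = -1 := by simp [sg]
  have k1 := key 0 1 0 k (fun q hq => h q (by simp [hq]))
  have k2 := key 1 1 0 (k + 1) (fun q hq => h q (by simp [hq]))
  have k3 := key 0 0 1 k (fun q hq => h q (by simp [hq]))
  have k4 := key 1 0 1 (k + 1) (fun q hq => h q (by simp [hq]))
  have k5 := key 0 1 1 (k + 1) (fun q hq => h q (by simp [hq]))
  have k6 := key 1 1 1 (k + 1) (fun q hq => h q (by simp [hq]))
  simp only [t0, t1, one_mul, neg_mul, ← sub_eq_add_neg] at k1 k2 k3 k4 k5 k6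
  refine ⟨nz (y 0), nz (y 1), nz (y 2), nz_norm (hy 0), nz_norm (hy 1), nz_norm (hy 2), ?_⟩
  have a1 := all_zero_aux (fun i => Phi μ k i 1 0 y) k k1 k2
    (all_zero_sum (fun i => Phi μ k i 1 0 y) k k1 (by
      unfold Phi
      rw [FF_sum]
      simpa using chi_integral μ k hM hpl hpos (nz_ne (hy 1))))
  have a2 := all_zero_aux (fun i => Phi μ k i 0 1 y) k k3 k4
    (all_zero_sum (fun i => Phi μ k i 0 1 y) k k3 (by
      unfold Phi
      rw [FF_sum]
      simpa using chi_integral μ k hM hpl hpos (nz_ne (hy 2))))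
  have a3 := all_zero_aux (fun i => Phi μ k i 1 1 y) k (fun i hi => k5 i (by omega)) k6
    (k5 k (by omega))
  exact fun i hi => ⟨a1 i hi, a2 i hi, a3 i hi⟩

end final

lemma hyper_vol {d : ℕ} (u : EE d) (hu : u ≠ 0) (t : ℝ) :
    (volume : Measure (EE d)) {x | inner ℝ x u = t} = 0 := by
  obtain ⟨x0, hx0⟩ := exists_between hu t
  let S : Submodule ℝ (EE d) := LinearMap.ker (innerₛₗ ℝ u)
  have hS : S ≠ ⊤ := by
    intro h
    have : u ∈ S := by rw [h]; trivial
    rw [LinearMap.mem_ker, innerₛₗ_apply_apply] at this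
    exact hu (inner_self_eq_zero.1 this)
  have h0 : (volume : Measure (EE d)) (S : Set (EE d)) = 0 := Measure.addHaar_submodule _ S hS
  have : {x : EE d | inner ℝ x u = t} = (fun x => x + (-x0)) ⁻¹' (S : Set (EE d)) := by
    ext x
    simp only [Set.mem_ofPred_eq, Set.mem_preimage, SetLike.mem_coe]
    change _ ↔ x + -x0 ∈ LinearMap.ker (innerₛₗ ℝ u)
    rw [LinearMap.mem_ker, innerₛₗ_apply_apply, inner_add_right, inner_neg_right,
      real_inner_comm x u, real_inner_comm x0 u, hx0]
    constructor <;> intro h <;> linarith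
  rw [this, measure_preimage_add_right, h0]

end BUx

open MvPolynomial in
/-- If `(1/(x₂x₃))·(𝔓₃/x₁)^(k+1) ∉ (x₁^d, x₂^d, x₃^d)` in `(ℤ/2)[x₁,x₂,x₃]`, then
every mass distribution in `ℝ^d` admits an equipartition into `(2k+2)×2×2` boxes
by `2k+1` parallel hyperplanes and two additional non-parallel hyperplanes. -/
theorem equipartition_three_directions_odd (d k : ℕ) (hd : 3 ≤ d)
    (hQ : X 1 ^ k * X 2 ^ k *
        ((X 0 + X 1) * (X 0 + X 2) * (X 1 + X 2) * (X 0 + X 1 + X 2)) ^ (k + 1) ∉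
      Ideal.span {(X 0 : MvPolynomial (Fin 3) (ZMod 2)) ^ d, X 1 ^ d, X 2 ^ d})
    (μ : Measure (EuclideanSpace ℝ (Fin d)))
    (f : EuclideanSpace ℝ (Fin d) → ℝ) (hf : Integrable f)
    (hμ : ∀ A : Set (EuclideanSpace ℝ (Fin d)), MeasurableSet A →
      μ A = ENNReal.ofReal (∫ x in A, f x))
    (hpos : ∀ U : Set (EuclideanSpace ℝ (Fin d)), IsOpen U → U.Nonempty → 0 < μ U) :
    ∃ (u v w : EuclideanSpace ℝ (Fin d)) (t : ℕ → ℝ) (s₁ s₂ : ℝ),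
      ‖u‖ = 1 ∧ ‖v‖ = 1 ∧ ‖w‖ = 1 ∧
      v ≠ u ∧ v ≠ -u ∧ w ≠ u ∧ w ≠ -u ∧ w ≠ v ∧ w ≠ -v ∧
      StrictMonoOn t (Set.Icc 1 (2 * k + 1)) ∧
      ∀ i ≤ 2 * k + 1, ∀ b₁ b₂ : Bool,
        μ (slab u t (2 * k + 1) i ∩ halfSp v s₁ b₁ ∩ halfSp w s₂ b₂) =
          μ Set.univ / ((4 * (2 * k + 2) : ℕ) : ENNReal) := by
  haveI : IsFiniteMeasure μ := ⟨by rw [hμ _ MeasurableSet.univ]; exact ENNReal.ofReal_lt_top⟩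
  have hM : 0 < μ.real Set.univ :=
    ENNReal.toReal_pos (hpos _ isOpen_univ Set.univ_nonempty).ne' (measure_ne_top _ _)
  have hpl : ∀ u : BUx.EE d, u ≠ 0 → ∀ t : ℝ, μ {x | inner ℝ x u = t} = 0 := by
    intro u hu t
    have hc : IsClosed {x : BUx.EE d | inner ℝ x u = t} :=
      isClosed_eq (by fun_prop) (by fun_prop)
    rw [hμ _ hc.measurableSet, setIntegral_measure_zero _ (BUx.hyper_vol u hu t)]
    simp
  obtain ⟨u, v, w, nu, nv, nw, h⟩ := BUx.core μ k hM hpl hpos hQ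
  have hu : u ≠ 0 := by rintro rfl; simp at nu
  have hv : v ≠ 0 := by rintro rfl; simp at nv
  have hw : w ≠ 0 := by rintro rfl; simp at nw
  have hbox : ∀ i ≤ 2 * k + 1, ∀ b₁ b₂ : Bool,
      μ.real (slab u (fun j => BUx.tq μ k j u) (2 * k + 1) i ∩
        halfSp v (BUx.tq μ k (k + 1) v) b₁ ∩ halfSp w (BUx.tq μ k (k + 1) w) b₂) =
        μ.real Set.univ / (4 * (2 * k + 2)) := fun i hi b₁ b₂ =>
    BUx.box_val μ k hM hpl hpos hu hv hw hi (h i hi).1 (h i hi).2.1 (h i hi).2.2 b₁ b₂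
  have hne : ∀ i ≤ 2 * k + 1, ∀ b₁ b₂ : Bool,
      (slab u (fun j => BUx.tq μ k j u) (2 * k + 1) i ∩
        halfSp v (BUx.tq μ k (k + 1) v) b₁ ∩ halfSp w (BUx.tq μ k (k + 1) w) b₂).Nonempty := by
    intro i hi b₁ b₂
    rw [Set.nonempty_iff_ne_empty]
    intro he
    have := hbox i hi b₁ b₂
    rw [he, measureReal_empty] at this
    have h2 : 0 < μ.real Set.univ / (4 * (2 * k + 2)) := by positivity
    linarith
  have hmono : StrictMonoOn (fun j => BUx.tq μ k j u) (Set.Icc 1 (2 * k + 1)) := by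
    intro i hi j hj hij
    exact BUx.tq_lt μ k hM hpl hpos hu hi.1 hij hj.2
  have hle : BUx.tq μ k 1 u ≤ BUx.tq μ k (2 * k + 1) u :=
    hmono.monotoneOn ⟨le_refl _, by omega⟩ ⟨by omega, le_refl _⟩ (by omega)
  -- nonemptiness facts
  have lo : ∀ b₁ b₂ : Bool, ∃ x : BUx.EE d, inner ℝ x u < BUx.tq μ k 1 u ∧
      x ∈ halfSp v (BUx.tq μ k (k + 1) v) b₁ ∧ x ∈ halfSp w (BUx.tq μ k (k + 1) w) b₂ := by
    intro b₁ b₂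
    obtain ⟨x, ⟨hx, h1⟩, h2⟩ := hne 0 (by omega) b₁ b₂
    exact ⟨x, hx.2 (by omega), h1, h2⟩
  have hi : ∀ b₁ b₂ : Bool, ∃ x : BUx.EE d, BUx.tq μ k (2 * k + 1) u < inner ℝ x u ∧
      x ∈ halfSp v (BUx.tq μ k (k + 1) v) b₁ ∧ x ∈ halfSp w (BUx.tq μ k (k + 1) w) b₂ := by
    intro b₁ b₂
    obtain ⟨x, ⟨hx, h1⟩, h2⟩ := hne (2 * k + 1) (by omega) b₁ b₂
    exact ⟨x, hx.1 (by omega), h1, h2⟩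
  have ht : ∀ (x z : BUx.EE d) s, x ∈ halfSp z s true ↔ inner ℝ x z < s := fun x z s => by
    simp [halfSp]
  have hf' : ∀ (x z : BUx.EE d) s, x ∈ halfSp z s false ↔ s < inner ℝ x z := fun x z s => by
    simp [halfSp]
  refine ⟨u, v, w, fun j => BUx.tq μ k j u, BUx.tq μ k (k + 1) v, BUx.tq μ k (k + 1) w, nu, nv, nw,
    ?_, ?_, ?_, ?_, ?_, ?_, hmono, ?_⟩
  · rintro rfl
    obtain ⟨x, a1, a2, -⟩ := lo false false
    obtain ⟨y, b1, b2, -⟩ := hi true false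
    rw [hf'] at a2; rw [ht] at b2
    linarith
  · intro e
    obtain ⟨x, a1, a2, -⟩ := lo true false
    obtain ⟨y, b1, b2, -⟩ := hi false false
    rw [ht, e, inner_neg_right] at a2; rw [hf', e, inner_neg_right] at b2
    linarith
  · rintro rfl
    obtain ⟨x, a1, -, a2⟩ := lo false false
    obtain ⟨y, b1, -, b2⟩ := hi false true
    rw [hf'] at a2; rw [ht] at b2
    linarith
  · intro e
    obtain ⟨x, a1, -, a2⟩ := lo false true
    obtain ⟨y, b1, -, b2⟩ := hi false false
    rw [ht, e, inner_neg_right] at a2; rw [hf', e, inner_neg_right] at b2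
    linarith
  · rintro rfl
    obtain ⟨x, -, a1, a2⟩ := lo true false
    rw [ht] at a1; rw [hf'] at a2
    linarith
  · intro e
    obtain ⟨x, -, a1, a2⟩ := lo true true
    obtain ⟨y, -, b1, b2⟩ := lo false false
    rw [ht] at a1 a2; rw [hf'] at b1 b2
    rw [e, inner_neg_right] at a2 b2
    linarith
  · intro i hi b₁ b₂
    have := hbox i hi b₁ b₂
    rw [← ENNReal.toReal_eq_toReal_iff' (measure_ne_top _ _)
      (ENNReal.div_ne_top (measure_ne_top _ _) (by simp)), ENNReal.toReal_div,
      ENNReal.toReal_natCast]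
    push_cast
    exact this
end

section
/- Every mass distribution μ on ℝ⁴ admits an equipartition into 12 = 3×2×2 boxes by a collection of 4 hyperplanes two of which are parallel: there exist a unit vector u ∈ ℝ⁴, real numbers t_1 < t_2, unit vectors v and w, and real numbers s₁, s₂, with u, v, w pairwise non-parallel (no two equal up to sign), such that each of the 12 regions {x : t_i < ⟨x,u⟩ < t_{i+1}} ∩ {x : ⟨x,v⟩ ≶ s₁} ∩ {x : ⟨x,w⟩ ≶ s₂} (for 0 ≤ i ≤ 2, with t_0 = -∞, t_3 = +∞, and all four sign choices) has μ-measure μ(ℝ⁴)/12. -/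
open MeasureTheory

namespace EqP
open Finsupp

abbrev Ch (X : Type*) := List X →₀ ZMod 2

section chains
variable {X : Type*}

/-- cone operator -/
noncomputable def cone (a : X) : Ch X →ₗ[ZMod 2] Ch X := Finsupp.lmapDomain _ _ (List.cons a)

noncomputable def bdL : List X → Ch X
  | [] => 0
  | a :: l => single l 1 + cone a (bdL l)

noncomputable def bd : Ch X →ₗ[ZMod 2] Ch X := Finsupp.linearCombination (ZMod 2) bdL

noncomputable def tm (g : X → X) : Ch X →ₗ[ZMod 2] Ch X := Finsupp.lmapDomain _ _ (List.map g)

lemma ch_add_self (c : Ch X) : c + c = 0 := by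
  ext l; simp [CharTwo.add_self_eq_zero]

@[simp] lemma cone_single (a : X) (l : List X) (r : ZMod 2) :
    cone a (single l r) = single (a :: l) r := by simp [cone]

@[simp] lemma tm_single (g : X → X) (l : List X) (r : ZMod 2) :
    tm g (single l r) = single (l.map g) r := by simp [tm]

@[simp] lemma bd_single (l : List X) : bd (single l 1) = bdL l := by simp [bd]

/-- two linear maps agreeing on basis lists satisfying `P` agree on chains supported there -/
lemma ext_on {M : Type*} [AddCommMonoid M] [Module (ZMod 2) M] (P : List X → Prop)
    (φ ψ : Ch X →ₗ[ZMod 2] M) (h : ∀ l, P l → φ (single l 1) = ψ (single l 1))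
    {c : Ch X} (hc : c ∈ supported (ZMod 2) (ZMod 2) {l | P l}) : φ c = ψ c := by
  rw [supported_eq_span_single] at hc
  induction hc using Submodule.span_induction with
  | mem x hx => obtain ⟨l, hl, rfl⟩ := hx; exact h l hl
  | zero => simp
  | add x y _ _ hx hy => simp [hx, hy]
  | smul a x _ hx => simp [hx]

lemma map_mem {M : Type*} [AddCommMonoid M] [Module (ZMod 2) M] (P : List X → Prop)
    (φ : Ch X →ₗ[ZMod 2] M) (q : Submodule (ZMod 2) M) (h : ∀ l, P l → φ (single l 1) ∈ q)
    {c : Ch X} (hc : c ∈ supported (ZMod 2) (ZMod 2) {l | P l}) : φ c ∈ q := by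
  rw [supported_eq_span_single] at hc
  induction hc using Submodule.span_induction with
  | mem x hx => obtain ⟨l, hl, rfl⟩ := hx; exact h l hl
  | zero => simp
  | add x y _ _ hx hy => rw [map_add]; exact q.add_mem hx hy
  | smul a x _ hx => rw [map_smul]; exact q.smul_mem _ hx

abbrev Su (P : List X → Prop) : Submodule (ZMod 2) (Ch X) := supported (ZMod 2) (ZMod 2) {l | P l}

lemma single_mem_Su {P : List X → Prop} {l : List X} (h : P l) (r : ZMod 2) : single l r ∈ Su P :=
  single_mem_supported _ _ h

lemma Su_mono {P Q : List X → Prop} (h : ∀ l, P l → Q l) : Su P ≤ Su Q :=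
  supported_mono h

lemma mem_Su_true (c : Ch X) : c ∈ Su (fun _ : List X => True) := by
  rw [Su, mem_supported]; intro x _; trivial

lemma bd_cone (a : X) (c : Ch X) : bd (cone a c) = c + cone a (bd c) := by
  have := ext_on (fun _ => True) (bd ∘ₗ cone a) (LinearMap.id + cone a ∘ₗ bd)
    (by intro l _; simp [bdL]) (mem_Su_true c)
  simpa using this

lemma bd_bdL (l : List X) : bd (bdL l) = 0 := by
  induction l with
  | nil => simp [bdL]
  | cons a l ih =>
    simp only [bdL, map_add, bd_cone, bd_single, ih, map_zero, add_zero]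
    exact ch_add_self _

lemma bd_bd (c : Ch X) : bd (bd c) = 0 := by
  have := ext_on (fun _ => True) (bd ∘ₗ bd) 0 (by intro l _; simp [bd_bdL]) (mem_Su_true c)
  simpa using this

lemma tm_cone (g : X → X) (a : X) (c : Ch X) : tm g (cone a c) = cone (g a) (tm g c) := by
  have := ext_on (fun _ => True) (tm g ∘ₗ cone a) (cone (g a) ∘ₗ tm g)
    (by intro l _; simp) (mem_Su_true c)
  simpa using this

lemma tm_bdL (g : X → X) (l : List X) : tm g (bdL l) = bdL (l.map g) := by
  induction l with
  | nil => simp [bdL]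
  | cons a l ih => simp [bdL, tm_cone, ih]

lemma tm_bd (g : X → X) (c : Ch X) : tm g (bd c) = bd (tm g c) := by
  have := ext_on (fun _ => True) (tm g ∘ₗ bd) (bd ∘ₗ tm g)
    (by intro l _; simp [tm_bdL]) (mem_Su_true c)
  simpa using this

lemma tm_tm (g h : X → X) (c : Ch X) : tm g (tm h c) = tm (g ∘ h) c := by
  have := ext_on (fun _ => True) (tm g ∘ₗ tm h) (tm (g ∘ h))
    (by intro l _; simp) (mem_Su_true c)
  simpa using this

lemma tm_id (c : Ch X) : tm id c = c := by
  have := ext_on (fun _ => True) (tm id) (LinearMap.id)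
    (by intro l _; simp) (mem_Su_true c)
  simpa using this

lemma cone_mem_Su {P Q : List X → Prop} (a : X) (h : ∀ l, P l → Q (a :: l)) {c : Ch X}
    (hc : c ∈ Su P) : cone a c ∈ Su Q :=
  map_mem P _ _ (fun l hl => by rw [cone_single]; exact single_mem_Su (h l hl) _) hc

lemma tm_mem_Su {P Q : List X → Prop} (g : X → X) (h : ∀ l, P l → Q (l.map g)) {c : Ch X}
    (hc : c ∈ Su P) : tm g c ∈ Su Q :=
  map_mem P _ _ (fun l hl => by rw [tm_single]; exact single_mem_Su (h l hl) _) hc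

lemma bdL_mem (l : List X) : bdL l ∈ Su (fun l' : List X => l'.length + 1 = l.length ∧ l' ⊆ l) := by
  induction l with
  | nil => simp [bdL]
  | cons a l ih =>
    refine Submodule.add_mem _ (single_mem_Su ?_ _) (cone_mem_Su a ?_ ih)
    · simp
    · rintro l' ⟨h1, h2⟩
      refine ⟨by simp [h1], ?_⟩
      exact List.cons_subset_cons a h2

lemma bd_mem_length {n : ℕ} {c : Ch X} (hc : c ∈ Su (fun l : List X => l.length = n + 1)) :
    bd c ∈ Su (fun l : List X => l.length = n) :=
  map_mem _ _ _ (fun l hl => by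
    rw [bd_single]
    exact Su_mono (fun l' h => by have := h.1; omega) (bdL_mem l)) hc

/-! subdivision -/

noncomputable def sd (β : List X → X) : ℕ → Ch X →ₗ[ZMod 2] Ch X
  | 0 => LinearMap.id
  | n + 1 => Finsupp.linearCombination (ZMod 2) (fun l => cone (β l) (sd β n (bdL l)))

lemma sd_succ_single (β : List X → X) (n : ℕ) (l : List X) :
    sd β (n + 1) (single l 1) = cone (β l) (sd β n (bdL l)) := by simp [sd]

lemma bd_sd (β : List X → X) (n : ℕ) : ∀ {c : Ch X}, c ∈ Su (fun l : List X => l.length = n + 1) →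
    bd (sd β (n + 1) c) = sd β n (bd c) := by
  induction n with
  | zero =>
    intro c hc
    refine ext_on (fun l => l.length = 1) (bd ∘ₗ sd β 1) (sd β 0 ∘ₗ bd) ?_ hc
    intro l hl
    obtain ⟨a, rfl⟩ := List.length_eq_one_iff.1 hl
    simp [sd, bdL]
  | succ n ih =>
    intro c hc
    refine ext_on (fun l => l.length = n + 1 + 1) (bd ∘ₗ sd β (n + 1 + 1)) (sd β (n + 1) ∘ₗ bd) ?_ hc
    intro l hl
    simp only [LinearMap.comp_apply, bd_single, sd_succ_single β (n + 1), bd_cone]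
    rw [ih (Su_mono (fun l' h => by have := h.1; omega) (bdL_mem l)), bd_bdL]
    simp

lemma tm_sd (β : List X → X) (g : X → X) (hg : ∀ l, β (l.map g) = g (β l)) (n : ℕ) (c : Ch X) :
    tm g (sd β n c) = sd β n (tm g c) := by
  induction n generalizing c with
  | zero => simp [sd]
  | succ n ih =>
    have := ext_on (fun _ => True) (tm g ∘ₗ sd β (n + 1)) (sd β (n + 1) ∘ₗ tm g)
      (by intro l _; simp [sd_succ_single, tm_cone, ih, tm_bdL, hg]) (mem_Su_true c)
    simpa using this

/-! evaluation of cup products of sign changes -/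

def eL : List (X → ZMod 2) → List X → ZMod 2
  | [], [_] => 1
  | s :: S, p :: q :: l => (s p + s q) * eL S (q :: l)
  | _, _ => 0

noncomputable def ev (S : List (X → ZMod 2)) : Ch X →ₗ[ZMod 2] ZMod 2 :=
  Finsupp.linearCombination (ZMod 2) (eL S)

def aL (s : X → ZMod 2) (S : List (X → ZMod 2)) : List X → ZMod 2
  | [] => 0
  | p :: l => s p * eL S (p :: l)

noncomputable def av (s : X → ZMod 2) (S : List (X → ZMod 2)) : Ch X →ₗ[ZMod 2] ZMod 2 :=
  Finsupp.linearCombination (ZMod 2) (aL s S)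

@[simp] lemma ev_single (S : List (X → ZMod 2)) (l : List X) : ev S (single l 1) = eL S l := by
  simp [ev]

@[simp] lemma av_single (s : X → ZMod 2) (S : List (X → ZMod 2)) (l : List X) :
    av s S (single l 1) = aL s S l := by
  simp [av]

lemma av_cone (s : X → ZMod 2) (S : List (X → ZMod 2)) (p : X) (c : Ch X) :
    av s S (cone p c) = s p * ev S (cone p c) := by
  have := ext_on (fun _ => True) (av s S ∘ₗ cone p) (s p • (ev S ∘ₗ cone p))
    (by intro l _; simp [aL]) (mem_Su_true c)
  simpa using this

lemma stokesAux (S : List (X → ZMod 2)) :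
    (∀ l : List X, l.length = S.length + 2 → ev S (bdL l) = 0) ∧
    (∀ s, ∀ l : List X, l.length = S.length + 2 → av s S (bdL l) = eL (s :: S) l) := by
  have key : ∀ S : List (X → ZMod 2), (∀ l : List X, l.length = S.length + 2 → ev S (bdL l) = 0) →
      (∀ s, ∀ l : List X, l.length = S.length + 2 → av s S (bdL l) = eL (s :: S) l) := by
    intro S h s l hl
    match l, hl with
    | p :: q :: r, hl =>
      have h1 := h (p :: q :: r) hl
      simp only [bdL, map_add, cone_single, ev_single] at h1
      simp only [bdL, map_add, cone_single, av_single, av_cone, aL, eL]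
      have h2 : eL S (p :: r) + ev S (cone p (cone q (bdL r))) = eL S (q :: r) := by
        have := congrArg (fun z => z + eL S (q :: r)) h1
        simp only [zero_add] at this
        rw [← this]
        have h3 := CharTwo.add_self_eq_zero (eL S (q :: r))
        linear_combination -h3
      rw [← mul_add, h2]; ring
  induction S with
  | nil =>
    have h0 : ∀ l : List X, l.length = ([] : List (X → ZMod 2)).length + 2 → ev [] (bdL l) = 0 := by
      intro l hl
      match l, hl with
      | [p, q], _ =>
        simp [bdL, eL]; exact CharTwo.add_self_eq_zero _
    exact ⟨h0, key _ h0⟩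
  | cons s S ih =>
    have h0 : ∀ l : List X, l.length = (s :: S).length + 2 → ev (s :: S) (bdL l) = 0 := by
      intro l hl
      have := ext_on (fun l : List X => l.length = S.length + 2) (ev (s :: S)) (av s S ∘ₗ bd)
        (by intro l hl; simp [ih.2 s l hl])
        (c := bdL l) (Su_mono (fun l' h => by have := h.1; simp at hl; omega) (bdL_mem l))
      rw [this]; simp [bd_bdL]
    exact ⟨h0, key _ h0⟩

lemma stokes (s : X → ZMod 2) (S : List (X → ZMod 2)) {c : Ch X}
    (hc : c ∈ Su (fun l : List X => l.length = S.length + 2)) :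
    ev (s :: S) c = av s S (bd c) :=
  ext_on (fun l : List X => l.length = S.length + 2) (ev (s :: S)) (av s S ∘ₗ bd)
        (by intro l hl; simp [(stokesAux S).2 s l hl]) hc

lemma eL_map (D : Set X) (g : X → X) : ∀ (S : List (X → ZMod 2)) 
    (_ : ∀ s ∈ S, ∃ r : ZMod 2, ∀ p ∈ D, s (g p) = s p + r) (l : List X) (_ : ∀ p ∈ l, p ∈ D),
    eL S (l.map g) = eL S l
  | [], _, [], _ => rfl
  | [], _, [_], _ => rfl
  | [], _, _ :: _ :: _, _ => rfl
  | _ :: _, _, [], _ => rfl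
  | _ :: _, _, [_], _ => rfl
  | s :: S, hS, p :: q :: l, hl => by
    have ih := eL_map D g S (fun s hs => hS s (by simp [hs])) (q :: l) (fun p hp => hl p (by simp [hp]))
    obtain ⟨r, hr⟩ := hS s (by simp)
    simp only [List.map_cons, eL] at ih ⊢
    rw [ih, hr p (hl p (by simp)), hr q (hl q (by simp))]
    have h3 := CharTwo.add_self_eq_zero r
    linear_combination (h3) * eL S (q :: l)

lemma av_map (D : Set X) (g : X → X) (S : List (X → ZMod 2)) 
    (hS : ∀ s ∈ S, ∃ r : ZMod 2, ∀ p ∈ D, s (g p) = s p + r) (s : X → ZMod 2) (r : ZMod 2)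
    (hs : ∀ p ∈ D, s (g p) = s p + r) {c : Ch X} (hc : c ∈ Su (fun l : List X => (∀ p ∈ l, p ∈ D)))
     : av s S (c + tm g c) = r * ev S c := by
  refine ext_on _ (av s S ∘ₗ (LinearMap.id + tm g)) (r • ev S) ?_ hc
  intro l hl
  cases l with
  | nil => cases S <;> simp [aL, eL]
  | cons p l =>
    have := eL_map D g S hS (p :: l) hl
    rw [List.map_cons] at this
    simp [aL, this, hs p (hl p (by simp))]
    have h3 := CharTwo.add_self_eq_zero (s p)
    linear_combination (h3) * eL S (p :: l)

lemma eL_ne_zero : ∀ (S : List (X → ZMod 2)) (l : List X), eL S l ≠ 0 →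
    ∀ s ∈ S, ∃ p ∈ l, ∃ q ∈ l, s p = 0 ∧ s q = 1
  | [], _, _ => by simp
  | _ :: _, [], h => by simp [eL] at h
  | _ :: _, [_], h => by simp [eL] at h
  | s :: S, p :: q :: l, h => by
    simp only [eL] at h
    intro s' hs'
    rcases List.mem_cons.1 hs' with rfl | hs'
    · have h1 : s' p + s' q ≠ 0 := left_ne_zero_of_mul h
      generalize hx : s' p = x at h1
      generalize hy : s' q = y at h1
      fin_cases x <;> fin_cases y
      · exact absurd rfl h1
      · exact ⟨p, by simp, q, by simp, hx, hy⟩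
      · exact ⟨q, by simp, p, by simp, hy, hx⟩
      · exact absurd rfl h1
    · obtain ⟨a, ha, b, hb, h⟩ := eL_ne_zero S (q :: l) (right_ne_zero_of_mul h) s' hs'
      exact ⟨a, by simp [ha], b, by simp [hb], h⟩

end chains

section fam

abbrev V := Fin 3 → Fin 5 → ℝ

noncomputable def T (j : Fin 3) : V →ₗ[ℝ] V :=
  LinearMap.pi (fun i => (if i = j then (-1 : ℝ) else 1) • LinearMap.proj i)

lemma T_apply (j i : Fin 3) (p : V) : T j p i = (if i = j then (-1 : ℝ) else 1) • p i := rfl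

lemma T_T (j : Fin 3) : (T j : V → V) ∘ (T j) = id := by
  funext p i
  simp only [Function.comp, T_apply, id]
  split_ifs <;> simp

lemma T_comm (i j : Fin 3) : (T i : V → V) ∘ (T j) = (T j) ∘ (T i) := by
  funext p k
  simp only [Function.comp, T_apply]
  rw [smul_comm]

def dec (m : Fin 3 → ℕ) (j : Fin 3) : Fin 3 → ℕ := Function.update m j (m j - 1)

noncomputable def Hs (h : (Fin 3 → ℕ) → Ch V) (m : Fin 3 → ℕ) : Ch V :=
  ∑ j, if m j = 0 then 0 else (h (dec m j) + tm (T j) (h (dec m j)))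

noncomputable def Evt (m : Fin 3 → ℕ) : V := fun j k => if k.val = m j then 1 else 0

noncomputable def H : ℕ → (Fin 3 → ℕ) → Ch V
  | 0, m => single [Evt m] 1
  | N + 1, m => cone (Evt m) (Hs (H N) m)

lemma sum_symm_zero (a : Fin 3 → Fin 3 → Ch V) (h1 : ∀ i j, a i j = a j i) (h0 : ∀ i, a i i = 0) :
    ∑ i, ∑ j, a i j = 0 := by
  simp only [Fin.sum_univ_three, h0, h1 1 0, h1 2 0, h1 2 1]
  have e1 := ch_add_self (a 0 1)
  have e2 := ch_add_self (a 0 2)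
  have e3 := ch_add_self (a 1 2)
  calc _ = (a 0 1 + a 0 1) + (a 0 2 + a 0 2) + (a 1 2 + a 1 2) := by abel
    _ = 0 := by rw [e1, e2, e3]; simp

lemma Hs_map (φ : Ch V →ₗ[ZMod 2] Ch V) (hφ : ∀ j c, φ (tm (T j) c) = tm (T j) (φ c))
    (h : (Fin 3 → ℕ) → Ch V) (m : Fin 3 → ℕ) : φ (Hs h m) = Hs (fun m => φ (h m)) m := by
  simp only [Hs, map_sum]
  refine Finset.sum_congr rfl (fun j _ => ?_)
  split_ifs <;> simp [hφ]

lemma Hs_Hs (h : (Fin 3 → ℕ) → Ch V) (m : Fin 3 → ℕ) : Hs (fun m => Hs h m) m = 0 := by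
  have : Hs (fun m => Hs h m) m = ∑ j, ∑ i, if m j = 0 then 0 else if dec m j i = 0 then 0 else
      (h (dec (dec m j) i) + tm (T i) (h (dec (dec m j) i))
        + tm (T j) (h (dec (dec m j) i) + tm (T i) (h (dec (dec m j) i)))) := by
    rw [Hs]
    refine Finset.sum_congr rfl (fun j _ => ?_)
    split_ifs with hj
    · simp
    · simp only [Hs, map_sum, ← Finset.sum_add_distrib]
      refine Finset.sum_congr rfl (fun i _ => ?_)
      split_ifs <;> simp
  rw [this]
  apply sum_symm_zero
  · intro i j
    by_cases hij : i = j
    · subst hij; rfl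
    · have e1 : dec m i j = m j := by simp [dec, Function.update_of_ne (Ne.symm hij)]
      have e2 : dec m j i = m i := by simp [dec, Function.update_of_ne hij]
      have e3 : dec (dec m i) j = dec (dec m j) i := by
        show Function.update (dec m i) j (dec m i j - 1) = Function.update (dec m j) i (dec m j i - 1)
        rw [e1, e2]
        exact Function.update_comm hij _ _ _
      rw [e1, e2, e3]
      split_ifs <;> try rfl
      simp only [map_add, tm_tm, T_comm i j]
      abel
  · intro i
    split_ifs <;> try rfl
    simp only [map_add, tm_tm, T_T, tm_id]
    generalize h (dec (dec m i) i) = c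
    calc _ = (c + c) + (tm (T i) c + tm (T i) c) := by abel
      _ = 0 := by rw [ch_add_self, ch_add_self]; simp

structure Fam (h : ℕ → (Fin 3 → ℕ) → Ch V) : Prop where
  base : ∀ m, ∃ p, h 0 m = single [p] 1
  rel : ∀ N m, bd (h (N + 1) m) = Hs (h N) m
  len : ∀ N m, h N m ∈ Su (fun l : List V => l.length = N + 1)

lemma Hs_mem {P Q : List V → Prop} (h : (Fin 3 → ℕ) → Ch V) (m : Fin 3 → ℕ) 
    (hP : ∀ j, m j ≠ 0 → h (dec m j) ∈ Su P) (hPQ : ∀ l, P l → Q l)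
    (hT : ∀ j l, P l → Q (l.map (T j))) : Hs h m ∈ Su Q := by
  refine Submodule.sum_mem _ (fun j _ => ?_)
  split_ifs with hj
  · exact Submodule.zero_mem _
  · exact Submodule.add_mem _ (Su_mono hPQ (hP j hj)) (tm_mem_Su _ (hT j) (hP j hj))

lemma fam_H : Fam H := by
  refine ⟨fun m => ⟨_, rfl⟩, ?_, ?_⟩
  · intro N
    induction N with
    | zero =>
      intro m
      rw [H, bd_cone]
      have : bd (Hs (H 0) m) = 0 := by
        simp only [Hs, map_sum]
        refine Finset.sum_eq_zero (fun j _ => ?_)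
        split_ifs
        · simp
        · simp [H, bdL, ch_add_self]
      rw [this]; simp
    | succ N ih =>
      intro m
      rw [H, bd_cone, Hs_map bd (fun j c => (tm_bd _ c).symm)]
      simp only [ih, Hs_Hs]
      simp
  · intro N
    induction N with
    | zero => intro m; exact single_mem_Su (by simp) _
    | succ N ih =>
      intro m
      refine cone_mem_Su (P := fun l : List V => l.length = N + 1) _ (by simp) ?_
      exact Hs_mem _ _ (fun j _ => ih _) (fun l h => h) (fun j l h => by simpa using h)

noncomputable def bary (l : List V) : V := (l.length : ℝ)⁻¹ • l.sum

lemma bary_map (j : Fin 3) (l : List V) : bary (l.map (T j)) = T j (bary l) := by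
  simp [bary, map_list_sum]

lemma sd_len {X : Type*} (β : List X → X) (n : ℕ) : ∀ {c : Ch X}, c ∈ Su (fun l : List X => l.length = n) →
    sd β n c ∈ Su (fun l : List X => l.length = n) := by
  induction n with
  | zero => intro c hc; exact hc
  | succ n ih =>
    intro c hc
    refine map_mem _ _ _ (fun l hl => ?_) hc
    rw [sd_succ_single]
    refine cone_mem_Su (P := fun l : List X => l.length = n) _ (by simp) (ih ?_)
    exact Su_mono (fun l' h => by have := h.1; omega) (bdL_mem l)

lemma fam_sd {h} (hh : Fam h) : Fam (fun N m => sd bary (N + 1) (h N m)) := by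
  refine ⟨?_, ?_, ?_⟩
  · intro m
    obtain ⟨p, hp⟩ := hh.base m
    exact ⟨bary [p], by simp [hp, sd, bdL]⟩
  · intro N m
    show bd (sd bary (N + 1 + 1) _) = _
    rw [bd_sd bary (N + 1) (hh.len _ _), hh.rel, Hs_map _ (fun j c => (tm_sd _ _ (bary_map j) _ _).symm)]
  · intro N m; exact sd_len _ _ (hh.len _ _)

noncomputable def hR (R : ℕ) : ℕ → (Fin 3 → ℕ) → Ch V := fun N m => (sd bary (N + 1))^[R] (H N m)

lemma fam_hR (R : ℕ) : Fam (hR R) := by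
  induction R with
  | zero => exact fam_H
  | succ R ih =>
    have heq : hR (R + 1) = fun N m => sd bary (N + 1) (hR R N m) := by
      funext N m
      simp only [hR, Function.iterate_succ_apply']
    rw [heq]
    exact fam_sd ih

def coef : List (Fin 3 → ZMod 2) → (Fin 3 → ℕ) → ZMod 2
  | [], _ => 1
  | χ :: L, m => ∑ j, if m j = 0 then 0 else χ j * coef L (dec m j)

def D (B : Fin 3 → ℕ) : Set V := {p | ∀ j, p j ≠ 0 ∧ ∀ k : Fin 5, B j < k.val → p j k = 0}

lemma dec_le (m : Fin 3 → ℕ) (j) : dec m j ≤ m := by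
  intro i
  by_cases h : i = j
  · subst h; simp [dec]
  · simp [dec, Function.update_of_ne h]

lemma eval_fam {h} (hh : Fam h) (B : Fin 3 → ℕ) 
    (hD : ∀ N m, m ≤ B → h N m ∈ Su (fun l : List V => ∀ p ∈ l, p ∈ D B)) :
    ∀ (SL : List ((V → ZMod 2) × (Fin 3 → ZMod 2))) 
      (_ : ∀ s ∈ SL, ∀ j, ∀ p ∈ D B, s.1 (T j p) = s.1 p + s.2 j) (m : Fin 3 → ℕ), m ≤ B →
      ev (SL.map Prod.fst) (h SL.length m) = coef (SL.map Prod.snd) m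
  | [], _, m, _ => by
    obtain ⟨p, hp⟩ := hh.base m
    simp [hp, coef, eL]
  | s :: SL, hS, m, hm => by
    have ih := eval_fam hh B hD SL (fun s hs => hS s (by simp [hs]))
    rw [List.map_cons, List.length_cons, stokes _ _ (by simpa using hh.len (SL.length + 1) m), hh.rel]
    simp only [Hs, map_sum, List.map_cons, coef]
    refine Finset.sum_congr rfl (fun j _ => ?_)
    have hmj : dec m j ≤ B := (dec_le m j).trans hm
    split_ifs
    · simp
    · rw [av_map (D B) (T j) (SL.map Prod.fst) ?_ s.1 (s.2 j) (hS s (by simp) j) (hD _ _ hmj), ih _ hmj]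
      intro s' hs'
      obtain ⟨a, ha, rfl⟩ := List.mem_map.1 hs'
      exact ⟨a.2 j, hS a (by simp [ha]) j⟩

/-! geometry -/

def Good (m : Fin 3 → ℕ) : Set V :=
  {p | ∀ j, (∀ k : Fin 5, m j < k.val → p j k = 0) ∧ (∀ k : Fin 5, k.val = m j → 0 ≤ p j k) ∧ p j ≠ 0}

abbrev hull (l : List V) : Set V := convexHull ℝ {x | x ∈ l}

lemma Good_dec {m : Fin 3 → ℕ} {j : Fin 3} (hj : m j ≠ 0) (p : V) (hp : p ∈ Good (dec m j)) :
    p ∈ Good m ∧ T j p ∈ Good m := by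
  have hi : ∀ i, i ≠ j → dec m j i = m i := fun i h => by simp [dec, Function.update_of_ne h]
  have hjj : dec m j j = m j - 1 := by simp [dec]
  have key : ∀ i, (∀ k : Fin 5, m i < k.val → p i k = 0) ∧ 
      (∀ k : Fin 5, k.val = m i → 0 ≤ p i k ∧ (i = j → p i k = 0)) ∧ p i ≠ 0 := by
    intro i
    obtain ⟨h1, h2, h3⟩ := hp i
    by_cases h : i = j
    · subst h
      rw [hjj] at h1
      refine ⟨fun k hk => h1 k (by omega), fun k hk => ?_, h3⟩
      have := h1 k (by omega)
      simp [this]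
    · rw [hi i h] at h1 h2
      exact ⟨h1, fun k hk => ⟨h2 k hk, fun h' => absurd h' h⟩, h3⟩
  refine ⟨fun i => ⟨(key i).1, fun k hk => ((key i).2.1 k hk).1, (key i).2.2⟩, fun i => ?_⟩
  obtain ⟨h1, h2, h3⟩ := key i
  rw [T_apply]
  by_cases h : i = j
  · simp only [h, if_true]
    subst h
    refine ⟨fun k hk => by simp [h1 k hk], fun k hk => by simp [(h2 k hk).2 rfl], by simpa using h3⟩
  · simp only [h, if_false, one_smul]
    exact ⟨h1, fun k hk => (h2 k hk).1, h3⟩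

lemma Evt_good {m : Fin 3 → ℕ} (hm : ∀ j, m j ≤ 4) : Evt m ∈ Good m := by
  intro j
  refine ⟨fun k hk => ?_, fun k hk => ?_, fun h => ?_⟩
  · simp [Evt]; omega
  · simp [Evt, hk]
  · have := congrFun h ⟨m j, by have := hm j; omega⟩
    simp [Evt] at this

lemma cone_good {m : Fin 3 → ℕ} (hm : ∀ j, m j ≤ 4) {l : List V} (hl : hull l ⊆ Good m) :
    hull (Evt m :: l) ⊆ Good m := by
  have hset : {x | x ∈ Evt m :: l} = insert (Evt m) {x | x ∈ l} := by ext x; simp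
  rcases l.eq_nil_or_concat' with rfl | hne
  · simp only [hull, List.mem_singleton, Set.ofPred_eq_eq_singleton, convexHull_singleton]
    rintro x rfl; exact Evt_good hm
  · have hne : ({x | x ∈ l} : Set V).Nonempty := by
      obtain ⟨L, b, rfl⟩ := hne; exact ⟨b, by simp⟩
    intro x hx
    rw [hull, hset, convexHull_insert hne] at hx
    simp only [convexJoin_singleton_left, Set.mem_iUnion] at hx
    obtain ⟨y, hy, hxy⟩ := hx
    obtain ⟨a, b, ha, hb, hab, rfl⟩ := hxy
    have hy' := hl hy
    intro j
    obtain ⟨h1, h2, h3⟩ := hy' j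
    obtain ⟨g1, g2, g3⟩ := Evt_good hm j
    refine ⟨fun k hk => by simp [h1 k hk, g1 k hk], fun k hk => ?_, fun h => ?_⟩
    · have := h2 k hk; have := g2 k hk
      simp only [Pi.add_apply, Pi.smul_apply, smul_eq_mul]; positivity
    · have hk := congrFun h ⟨m j, by have := hm j; omega⟩
      have e1 : Evt m j ⟨m j, by have := hm j; omega⟩ = 1 := by simp [Evt]
      have := h2 ⟨m j, by have := hm j; omega⟩ rfl
      simp only [Pi.add_apply, Pi.smul_apply, smul_eq_mul, e1, Pi.zero_apply] at hk
      have hbz := mul_nonneg hb this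
      have ha0 : a = 0 := by linarith
      have hb1 : b = 1 := by linarith
      subst ha0 hb1
      simp at h
      exact h3 h

lemma H_good (N : ℕ) : ∀ m : Fin 3 → ℕ, (∀ j, m j ≤ 4) → H N m ∈ Su (fun l : List V => hull l ⊆ Good m) := by
  induction N with
  | zero =>
    intro m hm
    refine single_mem_Su ?_ _
    exact cone_good hm (l := []) (by simp [hull])
  | succ N ih =>
    intro m hm
    refine cone_mem_Su (P := fun l : List V => hull l ⊆ Good m) _ (fun l hl => cone_good hm hl) ?_
    refine Submodule.sum_mem _ (fun j _ => ?_)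
    split_ifs with hj
    · exact Submodule.zero_mem _
    · have := ih (dec m j) (fun i => (dec_le m j i).trans (hm i))
      refine Submodule.add_mem _ (Su_mono ?_ this) (tm_mem_Su _ ?_ this)
      · intro l hl x hx; exact (Good_dec hj x (hl hx)).1
      · intro l hl x hx
        have : {x | x ∈ l.map (T j)} = Set.image (T j) {x | x ∈ l} := by ext x; simp
        rw [hull, this, ← LinearMap.image_convexHull] at hx
        obtain ⟨y, hy, rfl⟩ := hx
        exact (Good_dec hj y (hl hy)).2

lemma bary_mem_hull {l : List V} (hl : l ≠ []) : bary l ∈ hull l := by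
  have hn : (0 : ℝ) < l.length := by exact_mod_cast List.length_pos_of_ne_nil hl
  have : bary l = ∑ i : Fin l.length, (l.length : ℝ)⁻¹ • l.get i := by
    rw [← Finset.smul_sum, bary]
    congr 1
    simp [Fin.sum_univ_getElem]
  rw [this]
  refine (convex_convexHull ℝ _).sum_mem (fun _ _ => by positivity) ?_ ?_
  · simp; field_simp
  · intro i _; exact subset_convexHull ℝ _ (List.get_mem _ _)

lemma bary_dist {l : List V} {δ : ℝ} (hδ : 0 ≤ δ) (hd : ∀ p ∈ l, ∀ q ∈ l, dist p q ≤ δ)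
    {q : V} (hq : q ∈ hull l) {M : ℕ} (hM : l.length ≤ M) : dist (bary l) q ≤ (1 - (M : ℝ)⁻¹) * δ := by
  suffices h : ∀ q ∈ l, dist q (bary l) ≤ (1 - (M : ℝ)⁻¹) * δ by
    have := convexHull_min (t := Metric.closedBall (bary l) ((1 - (M : ℝ)⁻¹) * δ)) (s := {x | x ∈ l})
      (fun q hq => h q hq) (convex_closedBall _ _) hq
    rw [dist_comm]; exact this
  intro q hq
  have hne : l ≠ [] := by rintro rfl; simp at hq
  have hn : (0 : ℝ) < l.length := by exact_mod_cast List.length_pos_of_ne_nil hne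
  obtain ⟨i0, rfl⟩ := List.mem_iff_get.1 hq
  have e : l.get i0 - bary l = (l.length : ℝ)⁻¹ • ∑ i : Fin l.length, (l.get i0 - l.get i) := by
    rw [Finset.sum_sub_distrib, smul_sub, bary]
    congr 1
    · simp only [Finset.sum_const, Finset.card_univ, Fintype.card_fin]
      rw [← Nat.cast_smul_eq_nsmul ℝ, smul_smul, inv_mul_cancel₀ hn.ne', one_smul]
    · simp [Fin.sum_univ_getElem]
  rw [dist_eq_norm, e, norm_smul, norm_inv, Real.norm_natCast]
  have h1 : ‖∑ i : Fin l.length, (l.get i0 - l.get i)‖ ≤ (l.length - 1) * δ := by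
    calc ‖∑ i : Fin l.length, (l.get i0 - l.get i)‖ 
        ≤ ∑ i : Fin l.length, (δ - if i0 = i then δ else 0) := by
          refine norm_sum_le_of_le _ (fun i _ => ?_)
          split_ifs with h
          · subst h; simp
          · rw [sub_zero, ← dist_eq_norm]
            exact hd _ (List.get_mem _ _) _ (List.get_mem _ _)
      _ = (l.length - 1) * δ := by
          rw [Finset.sum_sub_distrib]
          simp
          ring
  calc (l.length : ℝ)⁻¹ * ‖∑ i : Fin l.length, (l.get i0 - l.get i)‖ 
      ≤ (l.length : ℝ)⁻¹ * ((l.length - 1) * δ) := by gcongr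
    _ = (1 - (l.length : ℝ)⁻¹) * δ := by field_simp
    _ ≤ (1 - (M : ℝ)⁻¹) * δ := by gcongr

lemma sd_mesh (M : ℕ) {δ : ℝ} (hδ : 0 ≤ δ) (n : ℕ) : ∀ l : List V, n ≤ M → l.length = n → 
    (∀ p ∈ l, ∀ q ∈ l, dist p q ≤ δ) → sd bary n (single l 1) ∈ 
      Su (fun l' : List V => (∀ p ∈ l', p ∈ hull l) ∧ 
        (∀ p ∈ l', ∀ q ∈ l', dist p q ≤ (1 - (M : ℝ)⁻¹) * δ)) := by
  induction n with
  | zero =>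
    intro l _ hl _
    have := List.length_eq_zero_iff.1 hl
    subst this
    exact single_mem_Su (by simp) _
  | succ n ih =>
    intro l hM hl hd
    rw [sd_succ_single]
    have hne : l ≠ [] := by rintro rfl; simp at hl
    have hM1 : (1 : ℝ) ≤ M := by exact_mod_cast (by omega : 1 ≤ M)
    have h1 : 0 ≤ (1 - (M : ℝ)⁻¹) * δ := mul_nonneg (by rw [sub_nonneg]; exact inv_le_one_of_one_le₀ hM1) hδ
    refine cone_mem_Su (P := fun l' : List V => (∀ p ∈ l', p ∈ hull l) ∧ 
        (∀ p ∈ l', ∀ q ∈ l', dist p q ≤ (1 - (M : ℝ)⁻¹) * δ)) _ ?_ ?_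
    · rintro l' ⟨ha, hb⟩
      have hbq : ∀ q ∈ l', dist (bary l) q ≤ (1 - (M : ℝ)⁻¹) * δ := fun q hq =>
        bary_dist hδ hd (ha q hq) (by omega)
      refine ⟨?_, ?_⟩
      · intro p hp
        rcases List.mem_cons.1 hp with rfl | hp
        · exact bary_mem_hull hne
        · exact ha p hp
      · intro p hp q hq
        rcases List.mem_cons.1 hp with rfl | hp <;> rcases List.mem_cons.1 hq with rfl | hq
        · simpa using h1
        · exact hbq q hq
        · rw [dist_comm]; exact hbq p hp
        · exact hb p hp q hq
    · refine map_mem _ _ _ (fun l' hl' => ?_) (bdL_mem l)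
      refine Su_mono ?_ (ih l' (by omega) (by have := hl'.1; omega) 
        (fun p hp q hq => hd p (hl'.2 hp) q (hl'.2 hq)))
      rintro l'' ⟨ha, hb⟩
      exact ⟨fun p hp => convexHull_mono (fun x hx => hl'.2 hx) (ha p hp), hb⟩

lemma hR_mesh (N : ℕ) (m : Fin 3 → ℕ) (d : ℝ) (hd0 : 0 ≤ d)
    (hd : ∀ l ∈ (H N m).support, ∀ p ∈ l, ∀ q ∈ l, dist p q ≤ d) (R : ℕ) :
    hR R N m ∈ Su (fun l : List V => (∃ l0 ∈ (H N m).support, ∀ p ∈ l, p ∈ hull l0) ∧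
      ∀ p ∈ l, ∀ q ∈ l, dist p q ≤ (1 - ((N + 1 : ℕ) : ℝ)⁻¹) ^ R * d) := by
  induction R with
  | zero =>
    rw [Su, mem_supported]
    intro l hl
    refine ⟨⟨l, hl, fun p hp => subset_convexHull ℝ _ hp⟩, ?_⟩
    simpa using hd l hl
  | succ R ih =>
    have heq : hR (R + 1) N m = sd bary (N + 1) (hR R N m) := by
      simp only [hR, Function.iterate_succ_apply']
    rw [heq]
    have hlen := (fam_hR R).len N m
    have h2 : hR R N m ∈ Su (fun l : List V => ((∃ l0 ∈ (H N m).support, ∀ p ∈ l, p ∈ hull l0) ∧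
      ∀ p ∈ l, ∀ q ∈ l, dist p q ≤ (1 - ((N + 1 : ℕ) : ℝ)⁻¹) ^ R * d) ∧ l.length = N + 1) := by
      rw [Su, mem_supported] at *
      intro l hl
      exact ⟨ih hl, hlen hl⟩
    refine map_mem _ _ _ ?_ h2
    rintro l ⟨⟨⟨l0, hl0, hl⟩, hdist⟩, hlen⟩
    have hc : (0 : ℝ) ≤ 1 - ((N + 1 : ℕ) : ℝ)⁻¹ := by
      rw [sub_nonneg]; exact inv_le_one_of_one_le₀ (by simp)
    refine Su_mono ?_ (sd_mesh (N + 1) (δ := (1 - ((N + 1 : ℕ) : ℝ)⁻¹) ^ R * d) (by positivity) (N + 1) l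
      le_rfl hlen hdist)
    rintro l' ⟨ha, hb⟩
    refine ⟨⟨l0, hl0, fun p hp => ?_⟩, fun p hp q hq => ?_⟩
    · exact convexHull_min (fun x hx => hl x hx) (convex_convexHull ℝ _) (ha p hp)
    · rw [pow_succ']
      rw [mul_assoc]
      exact hb p hp q hq

open Classical in
noncomputable def tau (x : Fin 5 → ℝ) : ZMod 2 := if 0 < toLex x then 1 else 0

lemma tau_neg {x : Fin 5 → ℝ} (hx : x ≠ 0) : tau (-x) = tau x + 1 := by
  have h1 : toLex x ≠ 0 := hx
  have h2 : toLex (-x) = - toLex x := rfl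
  unfold tau
  rw [h2]
  rcases lt_or_gt_of_ne h1 with h | h
  · have n1 : ¬ (0 < toLex x) := fun h' => lt_asymm h h'
    have n2 : 0 < - toLex x := Left.neg_pos_iff.2 h
    rw [if_neg n1, if_pos n2]; simp
  · have n1 : 0 < toLex x := h
    have n2 : ¬ (0 < - toLex x) := fun h' => lt_asymm (Left.neg_neg_iff.2 h) h'
    rw [if_pos n1, if_neg n2]; rfl

open Classical in
noncomputable def sgnF (F : (V → ℝ) × (Fin 3 → ZMod 2)) (p : V) : ZMod 2 :=
  if 0 < F.1 p then 1 else if F.1 p < 0 then 0 else ∑ i, F.2 i * tau (p i)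

lemma sgnF_one {F p} (h : sgnF F p = 1) : 0 ≤ F.1 p := by
  unfold sgnF at h
  by_contra hc
  push Not at hc
  rw [if_neg hc.not_gt, if_pos hc] at h
  exact absurd h (by decide)

lemma sgnF_zero {F p} (h : sgnF F p = 0) : F.1 p ≤ 0 := by
  unfold sgnF at h
  by_contra hc
  push Not at hc
  rw [if_pos hc] at h
  exact absurd h (by decide)

lemma sgnF_T (F : (V → ℝ) × (Fin 3 → ZMod 2)) (j : Fin 3) (p : V) (hp : ∀ j, p j ≠ 0)
    (h : F.1 (T j p) = (if F.2 j = 0 then 1 else -1) * F.1 p) :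
    sgnF F (T j p) = sgnF F p + F.2 j := by
  have hsum : ∑ i, F.2 i * tau (T j p i) = ∑ i, F.2 i * tau (p i) + F.2 j := by
    have : ∀ i, F.2 i * tau (T j p i) = F.2 i * tau (p i) + if i = j then F.2 j else 0 := by
      intro i
      rw [T_apply]
      split_ifs with hij
      · subst hij
        rw [neg_one_smul, tau_neg (hp i)]; ring
      · simp
    simp only [this, Finset.sum_add_distrib]
    simp
  unfold sgnF
  rw [hsum, h]
  have h01 : F.2 j = 0 ∨ F.2 j = 1 := by
    generalize F.2 j = x
    fin_cases x
    · left; rfl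
    · right; rfl
  rcases h01 with h0 | h0
  · simp [h0]
  · rw [h0]
    simp only [one_ne_zero, if_false, neg_mul, one_mul, Left.neg_pos_iff, Left.neg_neg_iff]
    rcases lt_trichotomy (F.1 p) 0 with h | h | h
    · simp [h, h.not_gt]
    · simp [h]
    · simp [h, h.not_gt]; rfl

theorem BU (m : Fin 3 → ℕ) (hm : ∀ j, m j ≤ 4) (FL : List ((V → ℝ) × (Fin 3 → ZMod 2)))
    (hcoef : coef (FL.map Prod.snd) m = 1)
    (hodd : ∀ F ∈ FL, ∀ j, ∀ p ∈ D m, F.1 (T j p) = (if F.2 j = 0 then 1 else -1) * F.1 p)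
    (hcont : ∀ F ∈ FL, ContinuousOn F.1 (D m)) : ∃ p ∈ Good m, ∀ F ∈ FL, F.1 p = 0 := by
  set N := FL.length with hN
  have hGD : ∀ m', m' ≤ m → Good m' ⊆ D m := fun m' h p hp j =>
    ⟨(hp j).2.2, fun k hk => (hp j).1 k ((h j).trans_lt hk)⟩
  set K : Set V := ⋃ l ∈ (H N m).support, hull l with hK
  have hKc : IsCompact K := by
    refine (Finset.finite_toSet _).isCompact_biUnion (fun l _ => ?_)
    exact Set.Finite.isCompact_convexHull ℝ (List.finite_toSet l)
  have hKG : K ⊆ Good m := by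
    refine Set.iUnion₂_subset (fun l hl => ?_)
    exact (mem_supported _ _).1 (H_good N m hm) hl
  have hmesh : ∀ N m, ∃ d : ℝ, 0 ≤ d ∧ ∀ l ∈ (H N m).support, ∀ p ∈ l, ∀ q ∈ l, dist p q ≤ d := by
    intro N m
    have hfin : (⋃ l ∈ (H N m).support, {x : V | x ∈ l}).Finite :=
      (Finset.finite_toSet _).biUnion (fun l _ => List.finite_toSet l)
    refine ⟨Metric.diam (⋃ l ∈ (H N m).support, {x : V | x ∈ l}), Metric.diam_nonneg, ?_⟩
    intro l hl p hp q hq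
    exact Metric.dist_le_diam_of_mem hfin.isBounded (Set.mem_biUnion hl hp) (Set.mem_biUnion hl hq)
  have hD : ∀ R N m', m' ≤ m → hR R N m' ∈ Su (fun l : List V => ∀ p ∈ l, p ∈ D m) := by
    intro R N m' hm'
    obtain ⟨d, hd0, hd⟩ := hmesh N m'
    refine Su_mono ?_ (hR_mesh N m' d hd0 hd R)
    rintro l ⟨⟨l0, hl0, hl⟩, _⟩ p hp
    have := (mem_supported _ _).1 (H_good N m' (fun j => (hm' j).trans (hm j))) hl0
    exact hGD _ hm' (this (hl p hp))
  obtain ⟨d, hd0, hd⟩ := hmesh N m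
  set c : ℝ := 1 - ((N + 1 : ℕ) : ℝ)⁻¹ with hcdef
  have hc0 : 0 ≤ c := by rw [hcdef, sub_nonneg]; exact inv_le_one_of_one_le₀ (by simp)
  have hc1 : c < 1 := by
    have : (0 : ℝ) < ((N + 1 : ℕ) : ℝ)⁻¹ := by positivity
    linarith
  have step : ∀ R : ℕ, ∃ p ∈ K, ∀ F ∈ FL, ∃ q ∈ K, ∃ q' ∈ K, dist q p ≤ c ^ R * d ∧ dist q' p ≤ c ^ R * d ∧
      F.1 q ≤ 0 ∧ 0 ≤ F.1 q' := by
    intro R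
    let SL : List ((V → ZMod 2) × (Fin 3 → ZMod 2)) := FL.map (fun F => (sgnF F, F.2))
    have hev := eval_fam (fam_hR R) m (hD R) SL (by
      intro s hs j p hp
      obtain ⟨F, hF, rfl⟩ := List.mem_map.1 hs
      exact sgnF_T F j p (fun j => (hp j).1) (hodd F hF j p hp)) m le_rfl
    have e1 : SL.map Prod.snd = FL.map Prod.snd := by simp [SL, Function.comp_def]
    have e2 : SL.length = N := by simp [SL, hN]
    rw [e1, hcoef, e2] at hev
    have hmem := hR_mesh N m d hd0 hd R
    have : ∃ l, ((∃ l0 ∈ (H N m).support, ∀ p ∈ l, p ∈ hull l0) ∧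
      ∀ p ∈ l, ∀ q ∈ l, dist p q ≤ c ^ R * d) ∧ eL (SL.map Prod.fst) l ≠ 0 := by
      by_contra hcon
      push Not at hcon
      have := ext_on _ (ev (SL.map Prod.fst)) 0 (fun l hl => by simpa using hcon l hl) hmem
      rw [hev] at this
      exact absurd this (by simp)
    obtain ⟨l, ⟨⟨l0, hl0, hl⟩, hdist⟩, hne⟩ := this
    have hlK : ∀ p ∈ l, p ∈ K := fun p hp => Set.mem_biUnion hl0 (hl p hp)
    have hlne : l ≠ [] := by
      rintro rfl
      apply hne
      cases SL.map Prod.fst <;> rfl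
    obtain ⟨p, hp⟩ := List.exists_mem_of_ne_nil l hlne
    refine ⟨p, hlK p hp, fun F hF => ?_⟩
    obtain ⟨q, hq, q', hq', h0, h1⟩ := eL_ne_zero _ l hne (sgnF F) (by
      simp only [SL, List.map_map, List.mem_map]
      exact ⟨F, hF, rfl⟩)
    exact ⟨q, hlK q hq, q', hlK q' hq', hdist q hq p hp, hdist q' hq' p hp, sgnF_zero h0, sgnF_one h1⟩
  choose p hpK hp using step
  obtain ⟨a, haK, φ, hφ, hlim⟩ := hKc.tendsto_subseq hpK
  refine ⟨a, hKG haK, fun F hF => ?_⟩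
  have hz : Filter.Tendsto (fun R : ℕ => c ^ φ R * d) Filter.atTop (nhds 0) := by
    have := ((tendsto_pow_atTop_nhds_zero_of_lt_one hc0 hc1).comp hφ.tendsto_atTop).mul_const d
    simpa using this
  have hFc : ContinuousWithinAt F.1 K a := ((hcont F hF).mono (hKG.trans (hGD m le_rfl))) a haK
  have lim : ∀ q : ℕ → V, (∀ R, q R ∈ K) → (∀ R, dist (q R) (p (φ R)) ≤ c ^ φ R * d) →
      Filter.Tendsto (fun R => F.1 (q R)) Filter.atTop (nhds (F.1 a)) := by
    intro q hqK hq
    have h1 : Filter.Tendsto q Filter.atTop (nhds a) := by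
      rw [tendsto_iff_dist_tendsto_zero]
      rw [tendsto_iff_dist_tendsto_zero] at hlim
      refine squeeze_zero (fun _ => dist_nonneg) (fun R => (dist_triangle _ (p (φ R)) _).trans
        (add_le_add (hq R) le_rfl)) ?_
      simpa using hz.add hlim
    exact hFc.tendsto.comp (tendsto_nhdsWithin_iff.2 ⟨h1, Filter.Eventually.of_forall hqK⟩)
  choose q hqK q' hqK' h1 h2 h3 h4 using fun R => hp R F hF
  apply le_antisymm
  · exact le_of_tendsto (lim (fun R => q (φ R)) (fun R => hqK _) (fun R => h1 _)) 
      (Filter.Eventually.of_forall (fun R => h3 _))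
  · exact ge_of_tendsto (lim (fun R => q' (φ R)) (fun R => hqK' _) (fun R => h2 _)) 
      (Filter.Eventually.of_forall (fun R => h4 _))

lemma coef_val : coef [![0,1,0], ![0,1,0], ![0,0,1], ![0,0,1], ![1,1,0], ![1,0,1], ![0,1,1], ![0,1,1], ![1,1,1]] ![3,4,2] = 1 := by
  decide +kernel

end fam

section meas
open MeasureTheory

abbrev E4 := EuclideanSpace ℝ (Fin 4)

noncomputable def aff (y : Fin 5 → ℝ) (x : E4) : ℝ := y 0 + ∑ k : Fin 4, y k.succ * x k

instance instMSSign : MeasurableSpace SignType := ⊤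

lemma measurable_sgn : Measurable (fun r : ℝ => SignType.sign r) := by
  have : (fun r : ℝ => SignType.sign r) = fun r => if 0 < r then 1 else if r < 0 then -1 else 0 := by
    funext r; rw [sign_apply]
  rw [this]
  exact Measurable.ite measurableSet_Ioi measurable_const
    (Measurable.ite measurableSet_Iio measurable_const measurable_const)

lemma aff_cont (y : Fin 5 → ℝ) : Continuous (aff y) := by
  unfold aff; fun_prop

lemma aff_cont' (x : E4) : Continuous (fun y => aff y x) := by
  unfold aff; fun_prop

abbrev Q := SignType × SignType × SignType × SignType

/-- sign vector of four affine functions -/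
noncomputable def sg (y : Fin 4 → Fin 5 → ℝ) (x : E4) : Q :=
  (SignType.sign (aff (y 0) x), SignType.sign (aff (y 1) x), SignType.sign (aff (y 2) x),
    SignType.sign (aff (y 3) x))

lemma sg_meas (y : Fin 4 → Fin 5 → ℝ) : Measurable (sg y) := by
  have h : ∀ i, Measurable (fun x => SignType.sign (aff (y i) x)) := fun i =>
    measurable_sgn.comp (aff_cont (y i)).measurable
  exact (h 0).prodMk ((h 1).prodMk ((h 2).prodMk (h 3)))

lemma Phi_meas (y : Fin 4 → Fin 5 → ℝ) (Φ : Q → ℝ) : Measurable (fun x => Φ (sg y x)) := by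
  have : Measurable Φ := Measurable.of_discrete
  exact this.comp (sg_meas y)

variable (μ : Measure E4) [IsFiniteMeasure μ]

lemma Phi_bound (Φ : Q → ℝ) : ∃ C : ℝ, ∀ q, ‖Φ q‖ ≤ C := by
  refine ⟨∑ q, ‖Φ q‖, fun q => ?_⟩
  exact Finset.single_le_sum (f := fun q => ‖Φ q‖) (fun _ _ => norm_nonneg _) (Finset.mem_univ q)

lemma Phi_int (y : Fin 4 → Fin 5 → ℝ) (Φ : Q → ℝ) : Integrable (fun x => Φ (sg y x)) μ := by
  obtain ⟨C, hC⟩ := Phi_bound Φ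
  exact Integrable.of_bound (Phi_meas y Φ).aestronglyMeasurable C (Filter.Eventually.of_forall (fun x => hC _))

noncomputable def II (y : Fin 4 → Fin 5 → ℝ) : (Q → ℝ) →ₗ[ℝ] ℝ where
  toFun Φ := ∫ x, Φ (sg y x) ∂μ
  map_add' Φ Ψ := by
    simp only [Pi.add_apply]
    exact integral_add (Phi_int μ y Φ) (Phi_int μ y Ψ)
  map_smul' c Φ := by
    simp only [Pi.smul_apply, smul_eq_mul, RingHom.id_apply]
    exact integral_const_mul _ _

lemma II_def (y : Fin 4 → Fin 5 → ℝ) (Φ : Q → ℝ) : II μ y Φ = ∫ x, Φ (sg y x) ∂μ := rfl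

lemma aff_null_vol {y : Fin 5 → ℝ} (hy : y ≠ 0) : (volume : Measure E4) {x | aff y x = 0} = 0 := by
  by_cases h : ∃ k : Fin 4, y k.succ ≠ 0
  · obtain ⟨k, hk⟩ := h
    let s : AffineSubspace ℝ E4 :=
      { carrier := {x | aff y x = 0}
        smul_vsub_vadd_mem' := by
          intro c p1 p2 p3 h1 h2 h3
          simp only [Set.mem_ofPred_eq, aff] at *
          have : ∑ k : Fin 4, y k.succ * (c • (p1 -ᵥ p2) +ᵥ p3) k = 
            c * (∑ k : Fin 4, y k.succ * p1 k - ∑ k : Fin 4, y k.succ * p2 k) + ∑ k : Fin 4, y k.succ * p3 k := by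
            rw [← Finset.sum_sub_distrib, Finset.mul_sum, ← Finset.sum_add_distrib]
            refine Finset.sum_congr rfl (fun k _ => ?_)
            simp
            ring
          rw [this]
          linear_combination c * h1 - c * h2 + h3 }
    refine Measure.addHaar_affineSubspace volume s ?_
    intro htop
    have hall : ∀ x : E4, aff y x = 0 := fun x => by
      have : x ∈ s := htop ▸ AffineSubspace.mem_top ℝ E4 x
      exact this
    have h0 := hall 0
    have h1 := hall (EuclideanSpace.single k 1)
    simp [aff] at h0 h1
    rw [h0] at h1
    simp at h1
    exact hk h1
  · push Not at h
    have h0 : y 0 ≠ 0 := by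
      intro h0
      apply hy
      funext i
      refine Fin.cases h0 (fun k => h k) i
    have : {x : E4 | aff y x = 0} = ∅ := by
      ext x; simp [aff, h, h0]
    rw [this]; simp

lemma aff_ne_ae (hac : μ ≪ volume) {y : Fin 5 → ℝ} (hy : y ≠ 0) : ∀ᵐ x ∂μ, aff y x ≠ 0 := by
  have := hac (aff_null_vol hy)
  rw [ae_iff]
  simpa using this

lemma II_cont (hac : μ ≪ volume) {P : Type*} [TopologicalSpace P] [FirstCountableTopology P] (S : Set P)
    (y : P → Fin 4 → Fin 5 → ℝ) (hy : ∀ i, ContinuousOn (fun p => y p i) S)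
    (hne : ∀ p ∈ S, ∀ i, y p i ≠ 0) (Φ : Q → ℝ) : ContinuousOn (fun p => II μ (y p) Φ) S := by
  intro p hp
  obtain ⟨C, hC⟩ := Phi_bound Φ
  simp only [II_def]
  refine continuousWithinAt_of_dominated (bound := fun _ => C) ?_ ?_ (integrable_const _) ?_
  · exact Filter.Eventually.of_forall (fun p => (Phi_meas _ Φ).aestronglyMeasurable)
  · exact Filter.Eventually.of_forall (fun p => Filter.Eventually.of_forall (fun x => hC _))
  · have h : ∀ i, ∀ᵐ x ∂μ, aff (y p i) x ≠ 0 := fun i => aff_ne_ae μ hac (hne p hp i)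
    filter_upwards [h 0, h 1, h 2, h 3] with x h0 h1 h2 h3
    have hc : ∀ i, aff (y p i) x ≠ 0 → ContinuousWithinAt (fun p => SignType.sign (aff (y p i) x)) S p := by
      intro i hi
      have h1 : ContinuousWithinAt (fun p => aff (y p i) x) S p :=
        (aff_cont' x).continuousAt.comp_continuousWithinAt (hy i p hp)
      have h2 : ContinuousAt (SignType.sign : ℝ → SignType) ((fun p => aff (y p i) x) p) :=
        continuousAt_sign_of_ne_zero hi
      exact ContinuousAt.comp_continuousWithinAt (f := fun p => aff (y p i) x) h2 h1
    have hΦ : Continuous Φ := continuous_of_discreteTopology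
    exact hΦ.continuousAt.comp_continuousWithinAt
      ((hc 0 h0).prodMk ((hc 1 h1).prodMk ((hc 2 h2).prodMk (hc 3 h3))))

/-! quantiles -/

noncomputable def af (t : ℝ) (a : Fin 4 → ℝ) : Fin 5 → ℝ := Fin.cons t a

lemma aff_af (t : ℝ) (a : Fin 4 → ℝ) (x : E4) : aff (af t a) x = t + ∑ k, a k * x k := by
  simp [aff, af]

lemma af_ne {t : ℝ} {a : Fin 4 → ℝ} (ha : a ≠ 0) : af t a ≠ 0 := by
  intro h
  apply ha
  funext k
  have := congrFun h k.succ
  simpa [af] using this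

lemma af_cont {P : Type*} [TopologicalSpace P] {S : Set P} {t : P → ℝ} {a : P → Fin 4 → ℝ}
    (ht : ContinuousOn t S) (ha : ContinuousOn a S) : ContinuousOn (fun p => af (t p) (a p)) S := by
  rw [continuousOn_pi] at ha ⊢
  intro i
  refine Fin.cases ?_ (fun k => ?_) i
  · simpa [af] using ht
  · simpa [af] using ha k

noncomputable def Fq (a : Fin 4 → ℝ) (t : ℝ) : ℝ := μ.real {x : E4 | ∑ k, a k * x k ≤ t}

lemma dot_cont (a : Fin 4 → ℝ) : Continuous (fun x : E4 => ∑ k, a k * x k) := by fun_prop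

lemma Fq_eq (a : Fin 4 → ℝ) (t : ℝ) : Fq μ a t = II μ (fun _ => af (-t) a)
    (fun q => if q.1 = 1 then 0 else 1) := by
  rw [II_def, Fq, ← integral_indicator_one (measurableSet_le (dot_cont a).measurable measurable_const)]
  congr 1
  funext x
  simp only [Set.indicator_apply, Set.mem_ofPred_eq, sg, aff_af, Pi.one_apply]
  by_cases h : ∑ k, a k * x k ≤ t
  · have : ¬ (0 < -t + ∑ k, a k * x k) := by linarith
    simp [h, sign_eq_one_iff, this]
  · have : (0 < -t + ∑ k, a k * x k) := by linarith
    simp [h, sign_eq_one_iff, this]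

lemma Fq_cont_t (hac : μ ≪ volume) {a : Fin 4 → ℝ} (ha : a ≠ 0) : Continuous (Fq μ a) := by
  rw [← continuousOn_univ]
  have := II_cont μ hac (Set.univ : Set ℝ) (fun t _ => af (-t) a) 
    (fun i => af_cont (by fun_prop) (by fun_prop)) (fun p _ i => af_ne ha) (fun q => if q.1 = 1 then 0 else 1)
  simpa only [← Fq_eq] using this

lemma Fq_cont_a (hac : μ ≪ volume) (t : ℝ) : ContinuousOn (fun a => Fq μ a t) {a | a ≠ 0} := by
  have := II_cont μ hac ({a | a ≠ 0} : Set (Fin 4 → ℝ)) (fun a _ => af (-t) a) 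
    (fun i => af_cont (by fun_prop) (by fun_prop)) (fun p hp i => af_ne hp) (fun q => if q.1 = 1 then 0 else 1)
  simpa only [← Fq_eq] using this

lemma exists_dot {a : Fin 4 → ℝ} (ha : a ≠ 0) (r : ℝ) : ∃ x : E4, ∑ k, a k * x k = r := by
  obtain ⟨k, hk⟩ := Function.ne_iff.1 ha
  refine ⟨EuclideanSpace.single k (r / a k), ?_⟩
  simp at hk
  simp
  field_simp

lemma Fq_strict (hpos : ∀ U : Set E4, IsOpen U → U.Nonempty → 0 < μ U) {a : Fin 4 → ℝ} (ha : a ≠ 0) : StrictMono (Fq μ a) := by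
  intro s t hst
  have ho : IsOpen {x : E4 | s < ∑ k, a k * x k ∧ ∑ k, a k * x k < t} :=
    (isOpen_lt continuous_const (dot_cont a)).inter (isOpen_lt (dot_cont a) continuous_const)
  have hp := hpos _ ho (by
    obtain ⟨x, hx⟩ := exists_dot ha ((s + t) / 2)
    exact ⟨x, by rw [Set.mem_ofPred_eq, hx]; constructor <;> linarith⟩)
  have hp' : 0 < μ.real {x : E4 | s < ∑ k, a k * x k ∧ ∑ k, a k * x k < t} := by
    rw [measureReal_def]; exact ENNReal.toReal_pos hp.ne' (measure_ne_top _ _)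
  have hd : Disjoint {x : E4 | ∑ k, a k * x k ≤ s} {x : E4 | s < ∑ k, a k * x k ∧ ∑ k, a k * x k < t} := by
    rw [Set.disjoint_left]
    intro x hx hx'
    simp only [Set.mem_ofPred_eq] at hx hx'
    linarith [hx'.1]
  have hu := measureReal_union (μ := μ) hd ho.measurableSet
  have hm : μ.real ({x : E4 | ∑ k, a k * x k ≤ s} ∪ {x : E4 | s < ∑ k, a k * x k ∧ ∑ k, a k * x k < t})
      ≤ Fq μ a t := by
    apply measureReal_mono _ (measure_ne_top _ _)
    rintro x (hx | hx) <;> simp only [Set.mem_ofPred_eq] at hx ⊢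
    · linarith
    · linarith [hx.2]
  unfold Fq at *
  linarith

lemma M_pos (hpos : ∀ U : Set E4, IsOpen U → U.Nonempty → 0 < μ U) : 0 < μ.real Set.univ := by
  rw [measureReal_def]
  exact ENNReal.toReal_pos (hpos _ isOpen_univ Set.univ_nonempty).ne' (measure_ne_top _ _)

lemma Fq_top (a : Fin 4 → ℝ) : Filter.Tendsto (Fq μ a) Filter.atTop (nhds (μ.real Set.univ)) := by
  set ν := μ.map (fun x : E4 => ∑ k, a k * x k) with hν
  have hFν : ∀ t, Fq μ a t = (ν (Set.Iic t)).toReal := by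
    intro t
    rw [hν, Measure.map_apply (dot_cont a).measurable measurableSet_Iic]; rfl
  have hνu : ν Set.univ = μ Set.univ := by
    rw [hν, Measure.map_apply (dot_cont a).measurable MeasurableSet.univ]; rfl
  have := (ENNReal.tendsto_toReal (measure_ne_top ν _)).comp (tendsto_measure_Iic_atTop ν)
  rw [hνu] at this
  have h2 : Fq μ a = ENNReal.toReal ∘ (fun t => ν (Set.Iic t)) := funext hFν
  rw [h2]
  exact this

lemma Fq_disj (a : Fin 4 → ℝ) {s t : ℝ} (h : s + t < 0) : Fq μ a s + Fq μ (-a) t ≤ μ.real Set.univ := by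
  have hd : Disjoint {x : E4 | ∑ k, a k * x k ≤ s} {x : E4 | ∑ k, (-a) k * x k ≤ t} := by
    rw [Set.disjoint_left]
    intro x hx hx'
    simp only [Set.mem_ofPred_eq, Pi.neg_apply, neg_mul, Finset.sum_neg_distrib] at hx hx'
    linarith
  have hu := measureReal_union (μ := μ) hd
    (measurableSet_le (dot_cont (-a)).measurable measurable_const)
  unfold Fq
  rw [← hu]
  exact measureReal_mono (Set.subset_univ _) (measure_ne_top _ _)

lemma exists_q (hac : μ ≪ volume) (hpos : ∀ U : Set E4, IsOpen U → U.Nonempty → 0 < μ U) {a : Fin 4 → ℝ} (ha : a ≠ 0) : ∃ t, Fq μ a t = μ.real Set.univ / 3 := by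
  have hM := M_pos μ hpos
  obtain ⟨t0, h0⟩ := ((Fq_top μ (-a)).eventually
    (lt_mem_nhds (show 2 * μ.real Set.univ / 3 < μ.real Set.univ by linarith))).exists
  obtain ⟨t1, h1⟩ := ((Fq_top μ a).eventually
    (lt_mem_nhds (show μ.real Set.univ / 3 < μ.real Set.univ by linarith))).exists
  have h2 := Fq_disj μ a (s := - t0 - 1) (t := t0) (by linarith)
  exact mem_range_of_exists_le_of_exists_ge (Fq_cont_t μ hac ha)
    ⟨- t0 - 1, by linarith⟩ ⟨t1, h1.le⟩

lemma exists_tq (hac : μ ≪ volume) (hpos : ∀ U : Set E4, IsOpen U → U.Nonempty → 0 < μ U) : ∃ τ : (Fin 4 → ℝ) → ℝ, (∀ a, a ≠ 0 → Fq μ a (τ a) = μ.real Set.univ / 3) ∧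
    ContinuousOn τ {a | a ≠ 0} := by
  have h : ∀ a : Fin 4 → ℝ, ∃ t, a ≠ 0 → Fq μ a t = μ.real Set.univ / 3 := by
    intro a
    by_cases ha : a ≠ 0
    · obtain ⟨t, ht⟩ := exists_q μ hac hpos ha
      exact ⟨t, fun _ => ht⟩
    · exact ⟨0, fun h => absurd h ha⟩
  choose τ hτ using h
  refine ⟨τ, hτ, ?_⟩
  intro a ha
  rw [ContinuousWithinAt, tendsto_order]
  constructor
  · intro b hb
    have h1 : Fq μ a b < μ.real Set.univ / 3 := by
      rw [← hτ a ha]; exact Fq_strict μ hpos ha hb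
    filter_upwards [(Fq_cont_a μ hac b a ha).eventually (gt_mem_nhds h1), self_mem_nhdsWithin] with c hc hc0
    rw [← hτ c hc0] at hc
    exact (Fq_strict μ hpos hc0).lt_iff_lt.1 hc
  · intro b hb
    have h1 : μ.real Set.univ / 3 < Fq μ a b := by
      rw [← hτ a ha]; exact Fq_strict μ hpos ha hb
    filter_upwards [(Fq_cont_a μ hac b a ha).eventually (lt_mem_nhds h1), self_mem_nhdsWithin] with c hc hc0
    rw [← hτ c hc0] at hc
    exact (Fq_strict μ hpos hc0).lt_iff_lt.1 hc

end meas

section final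
open MeasureTheory

def cc (i : Fin 3) (q : Q) : ℤ :=
  match i with
  | 0 => if q.1 = -1 then 1 else 0
  | 1 => if q.1 = 1 ∧ q.2.1 = -1 then 1 else 0
  | 2 => if q.2.1 = 1 then 1 else 0

def s3 (q : Q) : ℤ := (q.2.2.1 : ℤ)
def s4 (q : Q) : ℤ := (q.2.2.2 : ℤ)

def PhiL : List ((Q → ℤ) × (Fin 3 → ZMod 2)) :=
  [(fun q => cc 1 q * s3 q, ![0,1,0]),
   (fun q => (cc 0 q + cc 2 q) * s3 q, ![0,1,0]),
   (fun q => cc 1 q * s4 q, ![0,0,1]),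
   (fun q => (cc 0 q + cc 2 q) * s4 q, ![0,0,1]),
   (fun q => (cc 0 q - cc 2 q) * s3 q, ![1,1,0]),
   (fun q => (cc 0 q - cc 2 q) * s4 q, ![1,0,1]),
   (fun q => cc 1 q * (s3 q * s4 q), ![0,1,1]),
   (fun q => (cc 0 q + cc 2 q) * (s3 q * s4 q), ![0,1,1]),
   (fun q => (cc 0 q - cc 2 q) * (s3 q * s4 q), ![1,1,1])]

def prm (j : Fin 3) (q : Q) : Q :=
  match j with
  | 0 => (-q.2.1, -q.1, q.2.2.1, q.2.2.2)
  | 1 => (q.1, q.2.1, -q.2.2.1, q.2.2.2)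
  | 2 => (q.1, q.2.1, q.2.2.1, -q.2.2.2)

lemma PhiL_odd : ∀ F ∈ PhiL, ∀ (j : Fin 3) (q : Q),
    F.1 (prm j q) = (if F.2 j = 0 then 1 else -1) * F.1 q := by
  decide +kernel

lemma aff_neg (y : Fin 5 → ℝ) (x : E4) : aff (-y) x = - aff y x := by
  simp [aff]; ring

lemma af_neg (t : ℝ) (a : Fin 4 → ℝ) : - af t a = af (-t) (-a) := by
  funext i
  refine Fin.cases ?_ (fun k => ?_) i <;> simp [af]

/-- linear part of the first vector -/
def aP (p : V) : Fin 4 → ℝ := fun k => p 0 k.castSucc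

lemma aP_ne {p : V} (hp : p ∈ D ![3,4,2]) : aP p ≠ 0 := by
  intro h
  have h0 := hp 0
  apply h0.1
  funext k
  refine Fin.lastCases ?_ (fun k => ?_) k
  · exact h0.2 _ (by simp)
  · exact congrFun h k

noncomputable def yP (τ : (Fin 4 → ℝ) → ℝ) (p : V) : Fin 4 → Fin 5 → ℝ :=
  ![af (-τ (aP p)) (aP p), af (τ (-aP p)) (aP p), p 1, p 2]

lemma yP_T (τ : (Fin 4 → ℝ) → ℝ) (j : Fin 3) (p : V) (x : E4) :
    sg (yP τ (T j p)) x = prm j (sg (yP τ p) x) := by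
  fin_cases j
  · have h : aP (T 0 p) = - aP p := by
      funext k; simp [aP, T_apply]
    simp only [sg, yP, prm, Fin.isValue, Fin.zero_eta, h, neg_neg, Matrix.cons_val, T_apply]
    have e1 : af (-τ (-aP p)) (-aP p) = - af (τ (-aP p)) (aP p) := by rw [af_neg]
    have e2 : af (τ (aP p)) (-aP p) = - af (-τ (aP p)) (aP p) := by rw [af_neg, neg_neg]
    rw [e1, e2]
    simp [aff_neg, Left.sign_neg]
  · have h : aP (T 1 p) = aP p := by
      funext k; simp [aP, T_apply]
    simp [sg, yP, prm, h, T_apply, aff_neg, Left.sign_neg]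
  · have h : aP (T 2 p) = aP p := by
      funext k; simp [aP, T_apply]
    simp [sg, yP, prm, h, T_apply, aff_neg, Left.sign_neg]

lemma yP_ne (τ : (Fin 4 → ℝ) → ℝ) {p : V} (hp : p ∈ D ![3,4,2]) (i : Fin 4) : yP τ p i ≠ 0 := by
  have ha := aP_ne hp
  fin_cases i
  · exact af_ne ha
  · exact af_ne ha
  · exact (hp 1).1
  · exact (hp 2).1

lemma yP_cont (τ : (Fin 4 → ℝ) → ℝ) (hτ : ContinuousOn τ {a | a ≠ 0}) (i : Fin 4) :
    ContinuousOn (fun p => yP τ p i) (D ![3,4,2]) := by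
  have hc : Continuous aP := by unfold aP; fun_prop
  have h1 : ContinuousOn (fun p => τ (aP p)) (D ![3,4,2]) :=
    hτ.comp hc.continuousOn (fun p hp => aP_ne hp)
  have h2 : ContinuousOn (fun p => τ (-aP p)) (D ![3,4,2]) :=
    hτ.comp hc.neg.continuousOn (fun p hp => neg_ne_zero.2 (aP_ne hp))
  fin_cases i
  · exact af_cont h1.neg hc.continuousOn
  · exact af_cont h2 hc.continuousOn
  · exact (continuous_apply (1 : Fin 3)).continuousOn
  · exact (continuous_apply (2 : Fin 3)).continuousOn

lemma Good_D {m : Fin 3 → ℕ} {p : V} (hp : p ∈ Good m) : p ∈ D m :=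
  fun j => ⟨(hp j).2.2, (hp j).1⟩

lemma PhiL_deg : PhiL.map Prod.snd = [![0,1,0], ![0,1,0], ![0,0,1], ![0,0,1], ![1,1,0], ![1,0,1],
    ![0,1,1], ![0,1,1], ![1,1,1]] := rfl

lemma exists_p (μ : Measure E4) [IsFiniteMeasure μ] (hac : μ ≪ volume)
    (τ : (Fin 4 → ℝ) → ℝ) (hτ : ContinuousOn τ {a | a ≠ 0}) :
    ∃ p ∈ D ![3,4,2], ∀ F ∈ PhiL, II μ (yP τ p) (fun q => (F.1 q : ℝ)) = 0 := by
  have hodd : ∀ F ∈ (PhiL.map (fun F : (Q → ℤ) × (Fin 3 → ZMod 2) => ((fun p => II μ (yP τ p) (fun q => (F.1 q : ℝ)) : V → ℝ), F.2))),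
      ∀ j, ∀ p ∈ D ![3,4,2], F.1 (T j p) = (if F.2 j = 0 then 1 else -1) * F.1 p := by
    intro F hF j p hp
    obtain ⟨G, hG, rfl⟩ := List.mem_map.1 hF
    simp only [II_def, yP_T]
    rw [← integral_const_mul]
    congr 1
    funext x
    rw [PhiL_odd G hG]
    split_ifs <;> simp
  have hcont : ∀ F ∈ (PhiL.map (fun F : (Q → ℤ) × (Fin 3 → ZMod 2) => ((fun p => II μ (yP τ p) (fun q => (F.1 q : ℝ)) : V → ℝ), F.2))),
      ContinuousOn F.1 (D ![3,4,2]) := by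
    intro F hF
    obtain ⟨G, hG, rfl⟩ := List.mem_map.1 hF
    exact II_cont μ hac _ (yP τ) (yP_cont τ hτ) (fun p hp i => yP_ne τ hp i) _
  obtain ⟨p, hp, h⟩ := BU ![3,4,2] (by decide) _
    (by rw [List.map_map]; exact (congrArg (fun l => coef l ![3,4,2]) PhiL_deg).trans coef_val) hodd hcont
  refine ⟨p, Good_D hp, fun F hF => ?_⟩
  exact h _ (List.mem_map_of_mem hF)

lemma exists_p' (μ : Measure E4) [IsFiniteMeasure μ] (hac : μ ≪ volume)
    (τ : (Fin 4 → ℝ) → ℝ) (hτ : ContinuousOn τ {a | a ≠ 0}) :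
    ∃ p ∈ D ![3,4,2], ∀ i : Fin 3, II μ (yP τ p) (fun q => (cc i q : ℝ) * s3 q) = 0 ∧
      II μ (yP τ p) (fun q => (cc i q : ℝ) * s4 q) = 0 ∧
      II μ (yP τ p) (fun q => (cc i q : ℝ) * (s3 q * s4 q)) = 0 := by
  obtain ⟨p, hp, h⟩ := exists_p μ hac τ hτ
  refine ⟨p, hp, ?_⟩
  simp only [PhiL, List.forall_mem_cons, List.not_mem_nil, false_implies, implies_true, and_true,
    Int.cast_mul, Int.cast_add, Int.cast_sub] at h
  obtain ⟨h1, h2, h3, h4, h5, h6, h7, h8, h9⟩ := h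
  have key : ∀ g : Q → ℝ, II μ (yP τ p) (fun q => (cc 1 q : ℝ) * g q) = 0 →
      II μ (yP τ p) (fun q => ((cc 0 q : ℝ) + cc 2 q) * g q) = 0 →
      II μ (yP τ p) (fun q => ((cc 0 q : ℝ) - cc 2 q) * g q) = 0 →
      ∀ i, II μ (yP τ p) (fun q => (cc i q : ℝ) * g q) = 0 := by
    intro g g1 g2 g3 i
    have a1 : (fun q => (cc 0 q : ℝ) * g q) = (1/2 : ℝ) • ((fun q => ((cc 0 q : ℝ) + cc 2 q) * g q)
      + (fun q => ((cc 0 q : ℝ) - cc 2 q) * g q)) := by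
      funext q; simp; ring
    have a2 : (fun q => (cc 2 q : ℝ) * g q) = (1/2 : ℝ) • ((fun q => ((cc 0 q : ℝ) + cc 2 q) * g q)
      - (fun q => ((cc 0 q : ℝ) - cc 2 q) * g q)) := by
      funext q; simp; ring
    fin_cases i
    · show II μ (yP τ p) (fun q => (cc 0 q : ℝ) * g q) = 0
      rw [a1, map_smul, map_add, g2, g3]; simp
    · exact g1
    · show II μ (yP τ p) (fun q => (cc 2 q : ℝ) * g q) = 0
      rw [a2, map_smul, map_sub, g2, g3]; simp
  intro i
  exact ⟨key _ h1 h2 h5 i, key _ h3 h4 h6 i, key _ h7 h8 h9 i⟩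


lemma II_c0 (μ : Measure E4) [IsFiniteMeasure μ] (hac : μ ≪ volume) (τ : (Fin 4 → ℝ) → ℝ)
    {p : V} (hp : p ∈ D ![3,4,2]) :
    II μ (yP τ p) (fun q => (cc 0 q : ℝ)) = Fq μ (aP p) (τ (aP p)) := by
  rw [Fq_eq, II_def, II_def]
  apply integral_congr_ae
  have h : ∀ᵐ x ∂μ, aff (yP τ p 0) x ≠ 0 := aff_ne_ae μ hac (yP_ne τ hp 0)
  filter_upwards [h] with x hx
  have e : yP τ p 0 = af (-τ (aP p)) (aP p) := rfl
  simp only [sg, cc, ← e]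
  rcases lt_or_gt_of_ne hx with hs | hs
  · simp [sign_neg hs]
  · simp [sign_pos hs]

lemma II_c2 (μ : Measure E4) [IsFiniteMeasure μ] (hac : μ ≪ volume) (τ : (Fin 4 → ℝ) → ℝ)
    {p : V} (hp : p ∈ D ![3,4,2]) :
    II μ (yP τ p) (fun q => (cc 2 q : ℝ)) = Fq μ (-aP p) (τ (-aP p)) := by
  rw [Fq_eq, II_def, II_def]
  apply integral_congr_ae
  have h : ∀ᵐ x ∂μ, aff (yP τ p 1) x ≠ 0 := aff_ne_ae μ hac (yP_ne τ hp 1)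
  filter_upwards [h] with x hx
  have e : af (-τ (-aP p)) (-aP p) = - yP τ p 1 := by
    show _ = - af (τ (-aP p)) (aP p)
    rw [af_neg]
  simp only [sg, cc, e, aff_neg, Left.sign_neg]
  rcases lt_or_gt_of_ne hx with hs | hs
  · simp [sign_neg hs]
  · simp [sign_pos hs]

lemma t_lt (μ : Measure E4) [IsFiniteMeasure μ]
    (hpos : ∀ U : Set E4, IsOpen U → U.Nonempty → 0 < μ U) (τ : (Fin 4 → ℝ) → ℝ)
    (hτ : ∀ a, a ≠ 0 → Fq μ a (τ a) = μ.real Set.univ / 3) {a : Fin 4 → ℝ} (ha : a ≠ 0) :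
    τ a < - τ (-a) := by
  by_contra! hle
  have hM := M_pos μ hpos
  have h1 := hτ a ha
  have h2 := hτ (-a) (neg_ne_zero.2 ha)
  have hu : ({x : E4 | ∑ k, a k * x k ≤ τ a} ∪ {x : E4 | ∑ k, (-a) k * x k ≤ τ (-a)}) = Set.univ := by
    apply Set.eq_univ_of_forall
    intro x
    by_cases h : ∑ k, a k * x k ≤ τ a
    · exact Or.inl h
    · right
      simp only [Set.mem_ofPred_eq, Pi.neg_apply, neg_mul, Finset.sum_neg_distrib]
      linarith
  have h3 := measureReal_union_le (μ := μ) {x : E4 | ∑ k, a k * x k ≤ τ a}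
    {x : E4 | ∑ k, (-a) k * x k ≤ τ (-a)}
  rw [hu] at h3
  unfold Fq at h1 h2
  linarith

lemma cc_sum : ∀ q : Q, q.1 ≠ 0 → q.2.1 ≠ 0 → ¬ (q.1 = -1 ∧ q.2.1 = 1) →
    cc 0 q + cc 1 q + cc 2 q = 1 := by decide +kernel

lemma II_c (μ : Measure E4) [IsFiniteMeasure μ] (hac : μ ≪ volume)
    (hpos : ∀ U : Set E4, IsOpen U → U.Nonempty → 0 < μ U) (τ : (Fin 4 → ℝ) → ℝ)
    (hτ : ∀ a, a ≠ 0 → Fq μ a (τ a) = μ.real Set.univ / 3)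
    {p : V} (hp : p ∈ D ![3,4,2]) (i : Fin 3) :
    II μ (yP τ p) (fun q => (cc i q : ℝ)) = μ.real Set.univ / 3 := by
  have ha := aP_ne hp
  have h0 := (II_c0 μ hac τ hp).trans (hτ _ ha)
  have h2 := (II_c2 μ hac τ hp).trans (hτ _ (neg_ne_zero.2 ha))
  have ht := t_lt μ hpos τ hτ ha
  have hs : II μ (yP τ p) (fun q => (cc 0 q : ℝ)) + II μ (yP τ p) (fun q => (cc 1 q : ℝ)) +
      II μ (yP τ p) (fun q => (cc 2 q : ℝ)) = μ.real Set.univ := by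
    rw [← map_add, ← map_add, II_def]
    have : ∫ x : E4, (1 : ℝ) ∂μ = μ.real Set.univ := by simp
    rw [← this]
    apply integral_congr_ae
    filter_upwards [aff_ne_ae μ hac (yP_ne τ hp 0), aff_ne_ae μ hac (yP_ne τ hp 1)] with x hx0 hx1
    have := cc_sum (sg (yP τ p) x) (sign_ne_zero.2 hx0) (sign_ne_zero.2 hx1) (by
      rintro ⟨g1, g2⟩
      have g1' := sign_eq_neg_one_iff.1 g1
      have g2' := sign_eq_one_iff.1 g2
      have e0 : yP τ p 0 = af (-τ (aP p)) (aP p) := rfl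
      have e1 : yP τ p 1 = af (τ (-aP p)) (aP p) := rfl
      rw [e0, aff_af] at g1'
      rw [e1, aff_af] at g2'
      linarith)
    simp only [Pi.add_apply]
    exact_mod_cast this
  fin_cases i
  · exact h0
  · show II μ (yP τ p) (fun q => (cc 1 q : ℝ)) = _
    linarith
  · exact h2

def boxI (i : Fin 3) (e3 e4 : SignType) (q : Q) : ℤ :=
  if cc i q = 1 ∧ q.2.2.1 = e3 ∧ q.2.2.2 = e4 then 1 else 0

lemma boxI_eq : ∀ (i : Fin 3) (e3 e4 : SignType), e3 ≠ 0 → e4 ≠ 0 → ∀ q : Q, q.2.2.1 ≠ 0 →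
    q.2.2.2 ≠ 0 → 4 * boxI i e3 e4 q = cc i q + e3 * (cc i q * s3 q) + e4 * (cc i q * s4 q) +
      (e3 * e4) * (cc i q * (s3 q * s4 q)) := by
  decide +kernel

def boxS (y : Fin 4 → Fin 5 → ℝ) (i : Fin 3) (e3 e4 : SignType) : Set E4 :=
  {x | cc i (sg y x) = 1 ∧ (sg y x).2.2.1 = e3 ∧ (sg y x).2.2.2 = e4}

lemma boxS_meas (y : Fin 4 → Fin 5 → ℝ) (i : Fin 3) (e3 e4 : SignType) :
    MeasurableSet (boxS y i e3 e4) := by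
  have : MeasurableSet {q : Q | cc i q = 1 ∧ q.2.2.1 = e3 ∧ q.2.2.2 = e4} := MeasurableSet.of_discrete
  exact sg_meas y this

lemma II_box (μ : Measure E4) [IsFiniteMeasure μ] (y : Fin 4 → Fin 5 → ℝ) (i : Fin 3) (e3 e4 : SignType) :
    II μ y (fun q => (boxI i e3 e4 q : ℝ)) = μ.real (boxS y i e3 e4) := by
  rw [II_def, ← integral_indicator_one (boxS_meas y i e3 e4)]
  congr 1
  funext x
  by_cases h : x ∈ boxS y i e3 e4
  · rw [Set.indicator_of_mem h]
    have h' : cc i (sg y x) = 1 ∧ (sg y x).2.2.1 = e3 ∧ (sg y x).2.2.2 = e4 := h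
    simp [boxI, if_pos h']
  · rw [Set.indicator_of_notMem h]
    have h' : ¬ (cc i (sg y x) = 1 ∧ (sg y x).2.2.1 = e3 ∧ (sg y x).2.2.2 = e4) := h
    simp only [boxI, if_neg h', Int.cast_zero]

lemma main_box (μ : Measure E4) [IsFiniteMeasure μ] (hac : μ ≪ volume)
    (hpos : ∀ U : Set E4, IsOpen U → U.Nonempty → 0 < μ U) (τ : (Fin 4 → ℝ) → ℝ)
    (hτ : ∀ a, a ≠ 0 → Fq μ a (τ a) = μ.real Set.univ / 3) (hτc : ContinuousOn τ {a | a ≠ 0}) :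
    ∃ p ∈ D ![3,4,2], ∀ (i : Fin 3) (e3 e4 : SignType), e3 ≠ 0 → e4 ≠ 0 →
      μ.real (boxS (yP τ p) i e3 e4) = μ.real Set.univ / 12 := by
  obtain ⟨p, hp, h⟩ := exists_p' μ hac τ hτc
  refine ⟨p, hp, fun i e3 e4 he3 he4 => ?_⟩
  obtain ⟨g3, g4, g34⟩ := h i
  have gc := II_c μ hac hpos τ hτ hp i
  rw [← II_box]
  have key : II μ (yP τ p) (fun q => (boxI i e3 e4 q : ℝ)) = II μ (yP τ p)
    ((1/4 : ℝ) • ((fun q => (cc i q : ℝ)) + ((e3 : ℤ) : ℝ) • (fun q => (cc i q : ℝ) * s3 q) +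
      ((e4 : ℤ) : ℝ) • (fun q => (cc i q : ℝ) * s4 q) +
      (((e3 : ℤ) : ℝ) * ((e4 : ℤ) : ℝ)) • (fun q => (cc i q : ℝ) * (s3 q * s4 q)))) := by
    rw [II_def, II_def]
    apply integral_congr_ae
    filter_upwards [aff_ne_ae μ hac (yP_ne τ hp 2), aff_ne_ae μ hac (yP_ne τ hp 3)] with x hx0 hx1
    have := boxI_eq i e3 e4 he3 he4 (sg (yP τ p) x) (sign_ne_zero.2 hx0) (sign_ne_zero.2 hx1)
    have h2 := congrArg (Int.cast : ℤ → ℝ) this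
    simp only [Pi.add_apply, Pi.smul_apply, smul_eq_mul]
    simp only [Int.cast_mul, Int.cast_add, Int.cast_ofNat] at h2
    linarith
  rw [key]
  simp only [map_smul, map_add, g3, g4, g34, gc, smul_eq_mul]
  ring


/-- unit vector in the direction of `b` -/
noncomputable def nv (b : Fin 4 → ℝ) : E4 := ‖(WithLp.toLp 2 b : E4)‖⁻¹ • (WithLp.toLp 2 b : E4)

noncomputable def nb (b : Fin 4 → ℝ) : ℝ := ‖(WithLp.toLp 2 b : E4)‖

lemma nb_pos {b : Fin 4 → ℝ} (hb : b ≠ 0) : 0 < nb b := by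
  rw [nb, norm_pos_iff]
  intro h
  apply hb
  funext k
  have := congrArg (fun z : E4 => z k) h
  simpa using this

lemma nv_norm {b : Fin 4 → ℝ} (hb : b ≠ 0) : ‖nv b‖ = 1 := by
  have h := nb_pos hb
  unfold nb at h
  rw [nv, norm_smul, norm_inv, norm_norm, inv_mul_cancel₀ h.ne']

lemma nv_inner (b : Fin 4 → ℝ) (x : E4) : (inner ℝ x (nv b) : ℝ) = (∑ k, b k * x k) / nb b := by
  rw [nv, inner_smul_right, PiLp.inner_apply, nb, div_eq_inv_mul]
  simp

lemma inner_lt_iff {b : Fin 4 → ℝ} (hb : b ≠ 0) (x : E4) (s : ℝ) :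
    (inner ℝ x (nv b) : ℝ) < s / nb b ↔ aff (af (-s) b) x < 0 := by
  rw [nv_inner, div_lt_div_iff_of_pos_right (nb_pos hb), aff_af]
  constructor <;> intro h <;> linarith

lemma lt_inner_iff {b : Fin 4 → ℝ} (hb : b ≠ 0) (x : E4) (s : ℝ) :
    s / nb b < (inner ℝ x (nv b) : ℝ) ↔ 0 < aff (af (-s) b) x := by
  rw [nv_inner, div_lt_div_iff_of_pos_right (nb_pos hb), aff_af]
  constructor <;> intro h <;> linarith

lemma af_eta (y : Fin 5 → ℝ) : af (- - y 0) (fun k => y k.succ) = y := by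
  funext i
  refine Fin.cases ?_ (fun k => ?_) i <;> simp [af]

def bs (b : Bool) : SignType := if b then -1 else 1

lemma bs_ne (b : Bool) : bs b ≠ 0 := by cases b <;> decide


lemma lin_ne (μ : Measure E4) {y : Fin 4 → Fin 5 → ℝ}
    (hne : ∀ (i : Fin 3) (b₁ b₂ : Bool), (boxS y i (bs b₁) (bs b₂)).Nonempty) :
    (fun k : Fin 4 => y 2 k.succ) ≠ 0 ∧ (fun k : Fin 4 => y 3 k.succ) ≠ 0 := by
  have hz : ∀ (z : Fin 5 → ℝ) (x x' : E4), (fun k : Fin 4 => z k.succ) = 0 → aff z x = aff z x' := by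
    intro z x x' h
    have : ∀ k : Fin 4, z k.succ = 0 := fun k => congrFun h k
    simp [aff, this]
  obtain ⟨x, -, hx2, hx3⟩ := hne 0 true true
  obtain ⟨x', -, hx2', hx3'⟩ := hne 0 false false
  constructor <;> intro h
  · simp only [sg, bs] at hx2 hx2'
    rw [hz _ x x' h, hx2'] at hx2
    simp at hx2
  · simp only [sg, bs] at hx3 hx3'
    rw [hz _ x x' h, hx3'] at hx3
    simp at hx3

lemma cc_iff (y : Fin 4 → Fin 5 → ℝ) (x : E4) :
    (cc 0 (sg y x) = 1 ↔ aff (y 0) x < 0) ∧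
    (cc 1 (sg y x) = 1 ↔ 0 < aff (y 0) x ∧ aff (y 1) x < 0) ∧
    (cc 2 (sg y x) = 1 ↔ 0 < aff (y 1) x) := by
  simp [cc, sg, sign_eq_neg_one_iff, sign_eq_one_iff]

end final

section assemble

lemma halfSp_iff {y : Fin 5 → ℝ} (hb : (fun k : Fin 4 => y k.succ) ≠ 0) (x : E4) (b : Bool) :
    x ∈ halfSp (nv (fun k => y k.succ)) (-y 0 / nb (fun k => y k.succ)) b ↔
      SignType.sign (aff y x) = bs b := by
  cases b
  · simp only [halfSp, bs, Bool.false_eq_true, if_false, Set.mem_ofPred_eq]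
    rw [lt_inner_iff hb, af_eta, sign_eq_one_iff]
  · simp only [halfSp, bs, if_true, Set.mem_ofPred_eq]
    rw [inner_lt_iff hb, af_eta, sign_eq_neg_one_iff]

lemma slab_iff (τ : (Fin 4 → ℝ) → ℝ) {p : V} (hp : p ∈ D ![3,4,2]) (x : E4) (i : Fin 3) :
    x ∈ slab (nv (aP p)) (fun n => if n ≤ 1 then τ (aP p) / nb (aP p) else - τ (- aP p) / nb (aP p)) 2 i ↔
      cc i (sg (yP τ p) x) = 1 := by
  obtain ⟨h0, h1, h2⟩ := cc_iff (yP τ p) x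
  have ha := aP_ne hp
  have e0 : yP τ p 0 = af (-τ (aP p)) (aP p) := rfl
  have e1 : yP τ p 1 = af (- -τ (-aP p)) (aP p) := by rw [neg_neg]; rfl
  rw [e0] at h0
  rw [e0, e1] at h1
  rw [e1] at h2
  rw [← inner_lt_iff ha] at h0
  rw [← inner_lt_iff ha, ← lt_inner_iff ha] at h1
  rw [← lt_inner_iff ha] at h2
  fin_cases i
  · refine Iff.trans ?_ h0.symm
    simp [slab]
  · refine Iff.trans ?_ h1.symm
    simp [slab]
  · refine Iff.trans ?_ h2.symm
    simp [slab]

lemma nonpar_slab {u v : E4} {t : ℕ → ℝ} {s : ℝ} (ht : t 1 < t 2)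
    (h : ∀ i, i ≤ 2 → ∀ b : Bool, (slab u t 2 i ∩ halfSp v s b).Nonempty) : v ≠ u ∧ v ≠ -u := by
  constructor
  · rintro rfl
    obtain ⟨x, hx, hx'⟩ := h 0 (by norm_num) false
    obtain ⟨z, hz, hz'⟩ := h 2 (by norm_num) true
    simp [slab, halfSp] at hx hx' hz hz'
    linarith
  · rintro rfl
    obtain ⟨x, hx, hx'⟩ := h 0 (by norm_num) true
    obtain ⟨z, hz, hz'⟩ := h 2 (by norm_num) false
    simp [slab, halfSp, inner_neg_right] at hx hx' hz hz'
    linarith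

lemma nonpar_half {v w : E4} {s s' : ℝ}
    (h : ∀ b b' : Bool, (halfSp v s b ∩ halfSp w s' b').Nonempty) : w ≠ v ∧ w ≠ -v := by
  constructor
  · rintro rfl
    obtain ⟨x, hx, hx'⟩ := h true false
    obtain ⟨z, hz, hz'⟩ := h false true
    simp [halfSp] at hx hx' hz hz'
    linarith
  · rintro rfl
    obtain ⟨x, hx, hx'⟩ := h true true
    obtain ⟨z, hz, hz'⟩ := h false false
    simp [halfSp, inner_neg_right] at hx hx' hz hz'
    linarith

theorem main_result (μ : Measure E4) [IsFiniteMeasure μ] (hac : μ ≪ volume)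
    (hpos : ∀ U : Set E4, IsOpen U → U.Nonempty → 0 < μ U) :
    ∃ (u v w : E4) (t : ℕ → ℝ) (s₁ s₂ : ℝ),
      ‖u‖ = 1 ∧ ‖v‖ = 1 ∧ ‖w‖ = 1 ∧
      v ≠ u ∧ v ≠ -u ∧ w ≠ u ∧ w ≠ -u ∧ w ≠ v ∧ w ≠ -v ∧
      StrictMonoOn t (Set.Icc 1 2) ∧
      ∀ i ≤ 2, ∀ b₁ b₂ : Bool,
        μ (slab u t 2 i ∩ halfSp v s₁ b₁ ∩ halfSp w s₂ b₂) =
          μ Set.univ / 12 := by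
  obtain ⟨τ, hτ, hτc⟩ := exists_tq μ hac hpos
  obtain ⟨p, hp, hbox⟩ := main_box μ hac hpos τ hτ hτc
  have hM := M_pos μ hpos
  have hne : ∀ (i : Fin 3) (b₁ b₂ : Bool), (boxS (yP τ p) i (bs b₁) (bs b₂)).Nonempty := by
    intro i b₁ b₂
    rw [Set.nonempty_iff_ne_empty]
    intro h
    have h1 := hbox i _ _ (bs_ne b₁) (bs_ne b₂)
    rw [h] at h1
    rw [measureReal_empty] at h1
    linarith
  obtain ⟨hl1, hl2⟩ := lin_ne μ hne
  have ha := aP_ne hp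
  have ht0 := t_lt μ hpos τ hτ ha
  let u := nv (aP p)
  let v := nv (fun k => yP τ p 2 k.succ)
  let w := nv (fun k => yP τ p 3 k.succ)
  let t : ℕ → ℝ := fun n => if n ≤ 1 then τ (aP p) / nb (aP p) else - τ (- aP p) / nb (aP p)
  let s₁ := -yP τ p 2 0 / nb (fun k => yP τ p 2 k.succ)
  let s₂ := -yP τ p 3 0 / nb (fun k => yP τ p 3 k.succ)
  have hset : ∀ (i : Fin 3) (b₁ b₂ : Bool), slab u t 2 i ∩ halfSp v s₁ b₁ ∩ halfSp w s₂ b₂ =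
      boxS (yP τ p) i (bs b₁) (bs b₂) := by
    intro i b₁ b₂
    ext x
    rw [Set.mem_inter_iff, Set.mem_inter_iff, halfSp_iff hl1, halfSp_iff hl2, slab_iff τ hp, and_assoc]
    rfl
  have hne' : ∀ i, i ≤ 2 → ∀ b₁ b₂ : Bool,
      (slab u t 2 i ∩ halfSp v s₁ b₁ ∩ halfSp w s₂ b₂).Nonempty := by
    intro i hi b₁ b₂
    have := hne ⟨i, by omega⟩ b₁ b₂
    rwa [← hset] at this
  have ht : t 1 < t 2 := by
    simp only [t]
    norm_num
    rw [div_lt_div_iff_of_pos_right (nb_pos ha)]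
    exact ht0
  have n1 := nonpar_slab (u := u) (v := v) (s := s₁) ht (fun i hi b => by
    obtain ⟨x, ⟨h1, h2⟩, h3⟩ := hne' i hi b true
    exact ⟨x, h1, h2⟩)
  have n2 := nonpar_slab (u := u) (v := w) (s := s₂) ht (fun i hi b => by
    obtain ⟨x, ⟨h1, h2⟩, h3⟩ := hne' i hi true b
    exact ⟨x, h1, h3⟩)
  have n3 := nonpar_half (v := v) (w := w) (s := s₁) (s' := s₂) (fun b b' => by
    obtain ⟨x, ⟨h1, h2⟩, h3⟩ := hne' 0 (by norm_num) b b'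
    exact ⟨x, h2, h3⟩)
  refine ⟨u, v, w, t, s₁, s₂, nv_norm ha, nv_norm hl1, nv_norm hl2, n1.1, n1.2, n2.1, n2.2,
    n3.1, n3.2, ?_, ?_⟩
  · intro i hi j hj hij
    have h1 : i = 1 := by have := hi.1; have := hj.2; omega
    have h2 : j = 2 := by have := hi.1; have := hj.2; omega
    rw [h1, h2]
    exact ht
  · intro i hi b₁ b₂
    have h1 := hset ⟨i, by omega⟩ b₁ b₂
    simp only at h1
    rw [h1]
    have h2 := hbox ⟨i, by omega⟩ _ _ (bs_ne b₁) (bs_ne b₂)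
    rw [measureReal_def, measureReal_def] at h2
    rw [← ENNReal.toReal_eq_toReal_iff' (measure_ne_top _ _)
      (ENNReal.div_ne_top (measure_ne_top _ _) (by norm_num)), h2, ENNReal.toReal_div]
    norm_num

end assemble
end EqP

/-- Every mass distribution in `ℝ^4` admits an equipartition into `12` boxes
by a collection of `2` parallel hyperplanes and two additional non-parallel
hyperplanes. -/
theorem equipartition_R4_twelve_boxes
    (μ : Measure (EuclideanSpace ℝ (Fin 4)))
    (f : EuclideanSpace ℝ (Fin 4) → ℝ) (hf : Integrable f)
    (hμ : ∀ A : Set (EuclideanSpace ℝ (Fin 4)), MeasurableSet A →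
      μ A = ENNReal.ofReal (∫ x in A, f x))
    (hpos : ∀ U : Set (EuclideanSpace ℝ (Fin 4)), IsOpen U → U.Nonempty → 0 < μ U) :
    ∃ (u v w : EuclideanSpace ℝ (Fin 4)) (t : ℕ → ℝ) (s₁ s₂ : ℝ),
      ‖u‖ = 1 ∧ ‖v‖ = 1 ∧ ‖w‖ = 1 ∧
      v ≠ u ∧ v ≠ -u ∧ w ≠ u ∧ w ≠ -u ∧ w ≠ v ∧ w ≠ -v ∧
      StrictMonoOn t (Set.Icc 1 2) ∧
      ∀ i ≤ 2, ∀ b₁ b₂ : Bool,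
        μ (slab u t 2 i ∩ halfSp v s₁ b₁ ∩ halfSp w s₂ b₂) =
          μ Set.univ / 12 := by
  have hfin : IsFiniteMeasure μ := ⟨by rw [hμ _ MeasurableSet.univ]; exact ENNReal.ofReal_lt_top⟩
  have hac : μ ≪ volume := by
    refine Measure.AbsolutelyContinuous.mk (fun A hA h0 => ?_)
    rw [hμ A hA, Measure.restrict_eq_zero.2 h0]
    simp
  exact EqP.main_result μ hac hpos
end
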